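/- Let 𝒜 be a complex Banach function algebra defined on its maximal ideal space 𝔐(𝒜). Then there is a bijection i : [ID₁(𝒜₂)] → [𝔐(𝒜), S²] between the set of connected components of the set ID₁(𝒜₂) of idempotent 2×2 matrices with entries in 𝒜 whose Gelfand transform has constant rank 1 on 𝔐(𝒜), and the set of homotopy classes of continuous maps from 𝔐(𝒜) to the two-dimensional unit sphere S². -/

import Mathlib

open WeakDual

/-- The homotopy relation on continuous maps, as a setoid. -/
def htpySetoid (X Y : Type*) [TopologicalSpace X] [TopologicalSpace Y] :
    Setoid C(X, Y) :=
  ⟨ContinuousMap.Homotopic, ContinuousMap.Homotopic.equivalence⟩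

/-- The set `[X, Y]` of homotopy classes of continuous maps from `X` to `Y`. -/
def HtpyClasses (X Y : Type*) [TopologicalSpace X] [TopologicalSpace Y] :=
  Quotient (htpySetoid X Y)

/-- The unit two-dimensional sphere `S² ⊂ ℝ³`. -/
abbrev TwoSphere : Type := Metric.sphere (0 : EuclideanSpace ℝ (Fin 3)) 1

/-- The space `ID₁(𝒜₂)` of idempotent `2×2` matrices with entries in `𝒜` whose Gelfand
transform has constant rank `1` on the maximal ideal space (character space) of `𝒜`,
topologized as a subspace of `M₂(𝒜)`. -/
abbrev ID1 (𝒜 : Type*) [NormedCommRing 𝒜] [NormedAlgebra ℂ 𝒜] : Type _ :=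
  {G : Matrix (Fin 2) (Fin 2) 𝒜 // G * G = G ∧
    ∀ φ : characterSpace ℂ 𝒜, (G.map fun a => φ a).rank = 1}

set_option linter.unusedSectionVars false

section Generalities

open Topology

/-- A property that is locally invariant on `V` propagates along paths in `V`. -/
lemma JoinedIn.propagate {X : Type*} [TopologicalSpace X] {V : Set X} {a b : X}
    (h : JoinedIn V a b) (p : X → Prop)
    (hp : ∀ y ∈ V, ∃ W ∈ 𝓝 y, ∀ z ∈ W, z ∈ V → ∀ z' ∈ W, z' ∈ V → p z → p z') (ha : p a) :
    p b := by
  obtain ⟨γ, hγ⟩ := h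
  have hloc : IsLocallyConstant (fun t => p (γ t)) := by
    rw [IsLocallyConstant.iff_eventually_eq]
    intro t
    obtain ⟨W, hW, hWp⟩ := hp _ (hγ t)
    filter_upwards [γ.continuous.continuousAt hW] with s hs
    exact propext ⟨hWp _ hs (hγ s) _ (mem_of_mem_nhds hW) (hγ t),
      hWp _ (mem_of_mem_nhds hW) (hγ t) _ hs (hγ s)⟩
  have := hloc.apply_eq_of_isPreconnected isPreconnected_univ (Set.mem_univ 0) (Set.mem_univ 1)
  simp only [γ.source, γ.target] at this
  exact this ▸ ha

variable {E : Type*} [NormedCommRing E] [NormedAlgebra ℂ E] [CompleteSpace E]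

lemma isUnit_of_forall_algHom {a : E} (h : ∀ ψ : E →ₐ[ℂ] ℂ, ψ a ≠ 0) : IsUnit a := by
  by_contra hn
  obtain ⟨f, hf⟩ := WeakDual.CharacterSpace.exists_apply_eq_zero hn
  exact h (WeakDual.CharacterSpace.toAlgHom f) hf

lemma continuous_gelfandTransform : Continuous (WeakDual.gelfandTransform ℂ E) := by
  refine AddMonoidHomClass.continuous_of_bound _ ‖(1 : E)‖ fun a => ?_
  rw [ContinuousMap.norm_le _ (by positivity)]
  intro x
  rw [mul_comm]
  exact AlgHom.norm_apply_le_self_mul_norm_one (WeakDual.CharacterSpace.toAlgHom x) a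

lemma isOpen_forall_algHom {O : Set ℂ} (hO : IsOpen O) :
    IsOpen {a : E | ∀ ψ : E →ₐ[ℂ] ℂ, ψ a ∈ O} := by
  have h1 := ContinuousMap.isOpen_setOfPred_mapsTo (X := characterSpace ℂ E) isCompact_univ hO
  have h2 := h1.preimage (continuous_gelfandTransform (E := E))
  convert h2 using 1
  ext a
  constructor
  · intro h x _
    exact h (WeakDual.CharacterSpace.toAlgHom x)
  · intro h ψ
    exact h (Set.mem_univ (WeakDual.CharacterSpace.equivAlgHom.symm ψ))

variable (E) in
/-- Elements whose Gelfand transform has positive real part. -/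
def posPart : Set E := {a | ∀ ψ : E →ₐ[ℂ] ℂ, 0 < (ψ a).re}

lemma isOpen_posPart : IsOpen (posPart E) :=
  isOpen_forall_algHom (isOpen_lt continuous_const Complex.continuous_re)

lemma isUnit_of_mem_posPart {a : E} (h : a ∈ posPart E) : IsUnit a :=
  isUnit_of_forall_algHom fun ψ h0 => by have := h ψ; simp [h0] at this

omit [CompleteSpace E] in
lemma one_mem_posPart : (1 : E) ∈ posPart E := fun ψ => by simp

omit [CompleteSpace E] in
lemma add_mem_posPart {a b : E} (ha : a ∈ posPart E) (hb : b ∈ posPart E) : a + b ∈ posPart E :=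
  fun ψ => by have := ha ψ; have := hb ψ; simp only [map_add, Complex.add_re]; linarith

omit [CompleteSpace E] in
lemma convex_posPart : Convex ℝ (posPart E) := by
  intro a ha b hb s t hs ht hst ψ
  have h1 := ha ψ
  have h2 := hb ψ
  have e1 : s • a = (s : ℂ) • a := rfl
  have e2 : t • b = (t : ℂ) • b := rfl
  rw [e1, e2]
  simp only [map_add, map_smul, Complex.add_re, smul_eq_mul, Complex.re_ofReal_mul]
  rcases hs.eq_or_lt with rfl | hs
  · have : t = 1 := by linarith
    subst this; simpa using h2
  · nlinarith [mul_pos hs h1, mul_nonneg ht h2.le]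

lemma eventually_exists_sqrt {N : Set E} (hN : N ∈ 𝓝 (1 : E)) :
    ∀ᶠ z in 𝓝 (1 : E), ∃ s ∈ N, s * s = z := by
  have h1 : HasStrictFDerivAt (fun x : E => x * x) _ 1 :=
    (hasStrictFDerivAt_id (𝕜 := ℂ) (1 : E)).mul' (hasStrictFDerivAt_id (𝕜 := ℂ) (1 : E))
  have h2 := h1.map_nhds_eq_of_surj (by
    rw [LinearMap.range_eq_top]
    intro y
    refine ⟨(2⁻¹ : ℂ) • y, ?_⟩
    simp [← add_smul]
    norm_num)
  simp only [mul_one] at h2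
  have h3 : (fun x : E => x * x) '' N ∈ 𝓝 (1 : E) := by
    rw [← h2]; exact Filter.image_mem_map hN
  filter_upwards [h3] with z hz
  obtain ⟨s, hs, e⟩ := hz
  exact ⟨s, hs, e⟩

lemma sqrt_unique_of_mem_posPart {s s' : E} (hs : s ∈ posPart E) (hs' : s' ∈ posPart E)
    (h : s * s = s' * s') : s = s' := by
  have h1 : (s - s') * (s + s') = 0 := by linear_combination h
  have h2 := isUnit_of_mem_posPart (add_mem_posPart hs hs')
  exact sub_eq_zero.1 ((h2.mul_left_eq_zero).1 h1)

lemma isOpen_sector : IsOpen {z : ℂ | |z.im| < z.re} :=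
  isOpen_lt (by fun_prop) (by fun_prop)

omit [CompleteSpace E] in
lemma mul_mem_posPart_of_sector {s r : E} (hs : s ∈ posPart E) (hs2 : s * s ∈ posPart E)
    (hr : ∀ ψ : E →ₐ[ℂ] ℂ, ψ r ∈ {z : ℂ | |z.im| < z.re}) : s * r ∈ posPart E := by
  intro ψ
  have h1 := hs ψ
  have h2 := hs2 ψ
  have h3 : |(ψ r).im| < (ψ r).re := hr ψ
  have h4 : 0 < (ψ r).re := (abs_nonneg _).trans_lt h3
  simp only [map_mul, Complex.mul_re] at h2 ⊢
  have h5 : |(ψ s).im| < (ψ s).re := abs_lt_of_sq_lt_sq (by nlinarith) h1.le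
  have h6 : |(ψ s).im * (ψ r).im| < (ψ s).re * (ψ r).re := by
    rw [abs_mul]
    exact mul_lt_mul'' h5 h3 (abs_nonneg _) (abs_nonneg _)
  linarith [le_abs_self ((ψ s).im * (ψ r).im)]

/-- The ratio of nearby units is close to one. -/
lemma exists_sqrt_ratio {y : E} (hy : IsUnit y) {N : Set E} (hN : N ∈ 𝓝 (1 : E)) :
    ∃ W ∈ 𝓝 y, ∀ z ∈ W, ∀ z' ∈ W, ∃ s ∈ N, z' = z * (s * s) := by
  obtain ⟨u, rfl⟩ := hy
  have hc : ContinuousAt (fun q : E × E => q.2 * Ring.inverse q.1) ((u : E), (u : E)) := by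
    have := (NormedRing.inverse_continuousAt u)
    have h1 : ContinuousAt (fun q : E × E => Ring.inverse q.1) ((u : E), (u : E)) :=
      ContinuousAt.comp (f := fun q : E × E => q.1) (x := ((u : E), (u : E))) this
        continuous_fst.continuousAt
    exact continuous_snd.continuousAt.mul h1
  have h1 : ∀ᶠ q : E × E in 𝓝 ((u : E), (u : E)), ∃ s ∈ N, s * s = q.2 * Ring.inverse q.1 := by
    have : Filter.Tendsto (fun q : E × E => q.2 * Ring.inverse q.1) (𝓝 ((u : E), (u : E)))
        (𝓝 1) := by
      have := hc.tendsto
      simpa using this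
    exact this.eventually (eventually_exists_sqrt hN)
  have h2 : ∀ᶠ z : E in 𝓝 (u : E), IsUnit z := Units.nhds u
  rw [nhds_prod_eq] at h1
  obtain ⟨W, hW, hWp⟩ :=
    (Filter.eventually_prod_self_iff
      (r := fun z z' : E => ∃ s ∈ N, s * s = z' * Ring.inverse z)).1 h1
  refine ⟨W ∩ {z | IsUnit z}, Filter.inter_mem hW h2, fun z hz z' hz' => ?_⟩
  obtain ⟨s, hs, e⟩ := hWp z hz.1 z' hz'.1
  refine ⟨s, hs, ?_⟩
  rw [e]
  have := Ring.mul_inverse_cancel z hz.2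
  linear_combination (-z') * this

lemma sector_mem_nhds : {r : E | ∀ ψ : E →ₐ[ℂ] ℂ, ψ r ∈ {z : ℂ | |z.im| < z.re}} ∈ 𝓝 (1 : E) :=
  (isOpen_forall_algHom isOpen_sector).mem_nhds (fun ψ => by simp)

omit [CompleteSpace E] in
lemma joinedIn_posPart {x y : E} (hx : x ∈ posPart E) (hy : y ∈ posPart E) :
    JoinedIn (posPart E) x y :=
  JoinedIn.of_segment_subset (convex_posPart.segment_subset hx hy)

lemma exists_sqrt {y : E} (hy : y ∈ posPart E) : ∃ s ∈ posPart E, s * s = y := by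
  refine (joinedIn_posPart one_mem_posPart hy).propagate (fun y => ∃ s ∈ posPart E, s * s = y) ?_
    ⟨1, one_mem_posPart, one_mul 1⟩
  intro y hy
  obtain ⟨W, hW, h⟩ := exists_sqrt_ratio (isUnit_of_mem_posPart hy) (sector_mem_nhds (E := E))
  refine ⟨W, hW, ?_⟩
  rintro z hz hzV z' hz' _ ⟨s, hs, rfl⟩
  obtain ⟨r, hr, rfl⟩ := h _ hz z' hz'
  exact ⟨s * r, mul_mem_posPart_of_sector hs hzV hr, by ring⟩

variable (E) in
lemma exists_sqrt_fun : ∃ σ : E → E, ContinuousOn σ (posPart E) ∧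
    ∀ y ∈ posPart E, σ y ∈ posPart E ∧ σ y * σ y = y := by
  choose! σ h1 h2 using fun (y : E) (hy : y ∈ posPart E) => exists_sqrt hy
  refine ⟨σ, ?_, fun y hy => ⟨h1 y hy, h2 y hy⟩⟩
  intro y hy N hN
  have hN' : {r : E | σ y * r ∈ N} ∈ 𝓝 (1 : E) := by
    have hc : ContinuousAt (fun r => σ y * r) 1 := by fun_prop
    exact hc (by simpa using hN)
  obtain ⟨W, hW, h⟩ := exists_sqrt_ratio (isUnit_of_mem_posPart hy)
    (Filter.inter_mem hN' (sector_mem_nhds (E := E)))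
  rw [Filter.mem_map]
  filter_upwards [mem_nhdsWithin_of_mem_nhds hW, self_mem_nhdsWithin] with z hz hzp
  obtain ⟨r, ⟨hr1, hr2⟩, e⟩ := h y (mem_of_mem_nhds hW) z hz
  have : σ z = σ y * r := by
    refine sqrt_unique_of_mem_posPart (h1 z hzp) ?_ ?_
    · exact mul_mem_posPart_of_sector (h1 y hy) (by rw [h2 y hy]; exact hy) hr2
    · rw [h2 z hzp, e]; linear_combination (-(r * r)) * h2 y hy
  show σ z ∈ N
  rw [this]; exact hr1

end Generalities

section DenseLift

open Topology

lemma exists_joinedIn_of_denseRange {V W : Type*} [AddCommGroup V] [Module ℝ V]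
    [TopologicalSpace V] [ContinuousAdd V] [ContinuousSMul ℝ V]
    [NormedAddCommGroup W] [NormedSpace ℝ W] (T : V →ₗ[ℝ] W)
    (hd : DenseRange T) {U : Set W} (hU : IsOpen U) {v₀ : V} {w : W}
    (h : JoinedIn U (T v₀) w) {ε : ℝ} (hε : 0 < ε) :
    ∃ v, JoinedIn (T ⁻¹' U) v₀ v ∧ dist (T v) w < ε := by
  refine h.propagate
    (fun w => ∀ ε > (0 : ℝ), ∃ v, JoinedIn (T ⁻¹' U) v₀ v ∧ dist (T v) w < ε) ?_ ?_ ε hε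
  · intro y hy
    obtain ⟨r, hr, hrU⟩ := Metric.isOpen_iff.1 hU y hy
    refine ⟨Metric.ball y r, Metric.ball_mem_nhds y hr, ?_⟩
    intro z hz _ z' hz' _ hp ε hε
    rw [Metric.mem_ball] at hz hz'
    obtain ⟨v, hv, hvz⟩ := hp (r - dist z y) (by linarith)
    obtain ⟨v', hv'⟩ := hd.exists_dist_lt z' (lt_min hε (show 0 < r - dist z' y by linarith))
    rw [dist_comm, lt_min_iff] at hv'
    have h1 : T v ∈ Metric.ball y r := by
      have := dist_triangle (T v) z y
      rw [Metric.mem_ball]; linarith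
    have h2 : T v' ∈ Metric.ball y r := by
      have := dist_triangle (T v') z' y
      rw [Metric.mem_ball]; linarith [hv'.2]
    have h3 : JoinedIn (T ⁻¹' Metric.ball y r) v v' :=
      JoinedIn.of_segment_subset (((convex_ball y r).linear_preimage T).segment_subset h1 h2)
    exact ⟨v', hv.trans (h3.mono (Set.preimage_mono hrU)), hv'.1⟩
  · intro ε hε
    exact ⟨v₀, JoinedIn.refl h.source_mem, by simpa using hε⟩

lemma joinedIn_preimage_of_denseRange {V W : Type*} [AddCommGroup V] [Module ℝ V]
    [TopologicalSpace V] [ContinuousAdd V] [ContinuousSMul ℝ V]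
    [NormedAddCommGroup W] [NormedSpace ℝ W] (T : V →ₗ[ℝ] W)
    (hd : DenseRange T) {U : Set W} (hU : IsOpen U) {v₀ v₁ : V}
    (h : JoinedIn U (T v₀) (T v₁)) : JoinedIn (T ⁻¹' U) v₀ v₁ := by
  obtain ⟨r, hr, hrU⟩ := Metric.isOpen_iff.1 hU _ h.target_mem
  obtain ⟨v, hv, hd⟩ := exists_joinedIn_of_denseRange T hd hU h hr
  refine hv.trans (JoinedIn.mono (JoinedIn.of_segment_subset
    (((convex_ball (T v₁) r).linear_preimage T).segment_subset ?_ ?_)) (Set.preimage_mono hrU))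
  · exact hd
  · simpa using hr

end DenseLift

section Exponential

open Topology NormedSpace

variable {R : Type*} [NormedRing R] [NormedAlgebra ℂ R] [CompleteSpace R]

/-- The exponential, as a unit. -/
noncomputable def expUnit (x : R) : Rˣ :=
  letI : NormedAlgebra ℚ R := NormedAlgebra.restrictScalars ℚ ℂ R
  letI := invertibleExp x
  ⟨exp x, ⅟(exp x), mul_invOf_self _, invOf_mul_self _⟩

@[simp] lemma val_expUnit (x : R) : (expUnit x : R) = exp x := rfl

lemma continuous_exp_complex : Continuous (exp : R → R) :=
  letI : NormedAlgebra ℚ R := NormedAlgebra.restrictScalars ℚ ℂ R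
  exp_continuous

lemma exp_neg_mul_exp_complex (x : R) : exp (-x) * exp x = 1 := by
  let : NormedAlgebra ℚ R := NormedAlgebra.restrictScalars ℚ ℂ R
  rw [← exp_add_of_commute (Commute.neg_left (Commute.refl x)), neg_add_cancel, exp_zero]

lemma map_exp_complex {S : Type*} [NormedRing S] [NormedAlgebra ℂ S] (f : R →ₐ[ℂ] S)
    (hf : Continuous f) (x : R) : f (exp x) = exp (f x) := by
  let : NormedAlgebra ℚ R := NormedAlgebra.restrictScalars ℚ ℂ R
  let : NormedAlgebra ℚ S := NormedAlgebra.restrictScalars ℚ ℂ S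
  exact map_exp f hf x

lemma continuous_expUnit : Continuous (expUnit : R → Rˣ) :=
  Units.isOpenEmbedding_val.isEmbedding.continuous_iff.2 continuous_exp_complex

lemma image_exp_mem_nhds {N : Set R} (hN : N ∈ 𝓝 (0 : R)) : exp '' N ∈ 𝓝 (1 : R) := by
  have h := (hasStrictFDerivAt_exp_zero (𝕂 := ℂ) (𝔸 := R)).map_nhds_eq_of_surj (by
    rw [LinearMap.range_eq_top]; exact fun y => ⟨y, rfl⟩)
  rw [exp_zero] at h
  rw [← h]
  exact Filter.image_mem_map hN

/-- Nearby units differ by a small exponential, along which one stays in a given open set. -/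
lemma exists_exp_chart {V : Set R} (hV : IsOpen V) {y : R} (hy : y ∈ V) (hu : IsUnit y) :
    ∃ ρ > 0, ∃ W, IsOpen W ∧ y ∈ W ∧ (∀ x ∈ W, ∀ ξ : R, ‖ξ‖ < ρ → exp ξ * x ∈ V) ∧
      ∀ x ∈ W, ∀ x' ∈ W, ∃ ξ : R, ‖ξ‖ < ρ ∧ x' = exp ξ * x := by
  obtain ⟨u, rfl⟩ := hu
  have h1 : ∀ᶠ q : R × R in 𝓝 (0, (u : R)), exp q.1 * q.2 ∈ V := by
    have hc : Continuous fun q : R × R => exp q.1 * q.2 :=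
      (continuous_exp_complex.comp continuous_fst).mul continuous_snd
    exact hc.continuousAt (hV.mem_nhds (by simpa [exp_zero] using hy))
  rw [nhds_prod_eq, Filter.eventually_prod_iff] at h1
  obtain ⟨pa, hpa, pb, hpb, hab⟩ := h1
  obtain ⟨ρ, hρ, hball⟩ := Metric.eventually_nhds_iff_ball.1 hpa
  have h2 : ∀ᶠ q : R × R in 𝓝 ((u : R), (u : R)),
      q.2 * Ring.inverse q.1 ∈ exp '' Metric.ball (0 : R) ρ := by
    have hi : ContinuousAt (fun q : R × R => Ring.inverse q.1) ((u : R), (u : R)) :=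
      ContinuousAt.comp (f := fun q : R × R => q.1) (x := ((u : R), (u : R)))
        (NormedRing.inverse_continuousAt u) continuous_fst.continuousAt
    have hc := continuous_snd.continuousAt.mul hi
    refine hc.tendsto ?_
    simpa using image_exp_mem_nhds (Metric.ball_mem_nhds (0 : R) hρ)
  rw [nhds_prod_eq] at h2
  obtain ⟨W, hW, hWp⟩ := (Filter.eventually_prod_self_iff
    (r := fun z z' : R => z' * Ring.inverse z ∈ exp '' Metric.ball (0 : R) ρ)).1 h2
  obtain ⟨W', hW', hW'o, hyW'⟩ := mem_nhds_iff.1 (Filter.inter_mem (Filter.inter_mem hW hpb)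
    (Units.nhds u))
  refine ⟨ρ, hρ, W', hW'o, hyW', fun x hx ξ hξ => ?_, fun x hx x' hx' => ?_⟩
  · exact hab (hball ξ (by simpa using hξ)) (hW' hx).1.2
  · obtain ⟨ξ, hξ, e⟩ := hWp x (hW' hx).1.1 x' (hW' hx').1.1
    refine ⟨ξ, by simpa using hξ, ?_⟩
    rw [e, mul_assoc, Ring.inverse_mul_cancel x (hW' hx).2, mul_one]

omit [CompleteSpace R] in
lemma joinedIn_expUnit_mul {P : Type*} [NormedRing P] [NormedAlgebra ℂ P] [CompleteSpace P]
    (α : P →ₐ[ℂ] R) (hα : Continuous α) {V : Set R} {ρ : ℝ} {L : Pˣ}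
    (hL : ∀ ξ : R, ‖ξ‖ < ρ → exp ξ * α L ∈ V) {ξ : P} (hξ : ‖α ξ‖ < ρ) :
    JoinedIn {L : Pˣ | α L ∈ V} L (expUnit ξ * L) := by
  refine JoinedIn.ofLine (f := fun t : ℝ => expUnit ((t : ℂ) • ξ) * L) ?_ ?_ ?_ ?_
  · refine Continuous.continuousOn ?_
    refine Continuous.mul (continuous_expUnit.comp ?_) continuous_const
    exact Complex.continuous_ofReal.smul continuous_const
  · ext; simp [exp_zero]
  · ext; simp
  · rintro _ ⟨t, ht, rfl⟩
    simp only [Set.mem_ofPred_eq, Units.val_mul, map_mul, val_expUnit, map_exp_complex α hα]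
    refine hL _ ?_
    rw [map_smul, norm_smul]
    simp only [Complex.norm_real, Real.norm_eq_abs, abs_of_nonneg ht.1]
    nlinarith [norm_nonneg (α ξ), ht.2]

/-- Factorization of an element on a path of units, with one factor close to the identity. -/
lemma exists_factorization {P M : Type*} [NormedRing P] [NormedAlgebra ℂ P] [CompleteSpace P]
    [NormedRing M] [NormedAlgebra ℂ M] [CompleteSpace M]
    (α : P →ₐ[ℂ] R) (hα : Continuous α) (β : M →ₐ[ℂ] R) (hβ : Continuous β)
    (hd : DenseRange α) (hs : ∀ e, ∃ x y, α x + β y = e)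
    {V : Set R} (hV : IsOpen V) (hu : ∀ m ∈ V, IsUnit m) {m : R} (hm : JoinedIn V 1 m)
    {N : Set M} (hN : N ∈ 𝓝 (1 : M)) :
    ∃ (L : Pˣ) (Q : Mˣ), JoinedIn {L : Pˣ | α L ∈ V} 1 L ∧ (Q : M) ∈ N ∧ α L = β Q * m := by
  have key : ∀ ε > (0 : ℝ), ∃ L : Pˣ, JoinedIn {L : Pˣ | α L ∈ V} 1 L ∧ dist (α L) m < ε := by
    refine hm.propagate (fun m => ∀ ε > (0 : ℝ), ∃ L : Pˣ,
      JoinedIn {L : Pˣ | α L ∈ V} 1 L ∧ dist (α L) m < ε) ?_ ?_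
    · intro y hy
      obtain ⟨ρ, hρ, W, hWo, hyW, h1, h2⟩ := exists_exp_chart hV hy (hu y hy)
      refine ⟨W, hWo.mem_nhds hyW, ?_⟩
      intro z hz _ z' hz' _ hp ε hε
      obtain ⟨δ, hδ, hδW⟩ := Metric.isOpen_iff.1 hWo z hz
      obtain ⟨L, hL, hLz⟩ := hp δ hδ
      have hLW : α L ∈ W := hδW hLz
      obtain ⟨ξ, hξ, rfl⟩ := h2 _ hLW _ hz'
      have hc : ∀ᶠ ζ in 𝓝 ξ, dist (exp ζ * α L) (exp ξ * α L) < ε ∧ ‖ζ‖ < ρ := by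
        refine Filter.Eventually.and ?_ (continuous_norm.continuousAt.eventually_lt
          continuousAt_const hξ)
        exact (continuous_exp_complex.mul continuous_const).continuousAt
          (Metric.ball_mem_nhds _ hε)
      obtain ⟨_, ⟨ξ', rfl⟩, hx⟩ := hd.inter_nhds_nonempty hc
      refine ⟨expUnit ξ' * L, hL.trans (joinedIn_expUnit_mul α hα (h1 _ hLW) hx.2), ?_⟩
      simpa [map_exp_complex α hα] using hx.1
    · intro ε hε
      exact ⟨1, JoinedIn.refl (by simpa using hm.source_mem), by simpa using hε⟩
  obtain ⟨ρ, hρ, W, hWo, hyW, h1, h2⟩ := exists_exp_chart hV hm.target_mem (hu m hm.target_mem)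
  let α' : P →L[ℂ] R := ⟨α.toLinearMap, hα⟩
  let β' : M →L[ℂ] R := ⟨β.toLinearMap, hβ⟩
  have hb : HasStrictFDerivAt (exp : R → R) (1 : R →L[ℂ] R) (β' (0 : P × M).2) := by
    simpa using hasStrictFDerivAt_exp_zero (𝕂 := ℂ) (𝔸 := R)
  have ha : HasStrictFDerivAt (exp : R → R) (1 : R →L[ℂ] R) (α' (0 : P × M).1) := by
    simpa using hasStrictFDerivAt_exp_zero (𝕂 := ℂ) (𝔸 := R)
  have hb' : HasStrictFDerivAt (fun q : P × M => exp (β' q.2))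
      ((1 : R →L[ℂ] R).comp (β'.comp (ContinuousLinearMap.snd ℂ P M))) (0 : P × M) :=
    hb.comp (0 : P × M) (β'.comp (ContinuousLinearMap.snd ℂ P M)).hasStrictFDerivAt
  have ha' : HasStrictFDerivAt (fun q : P × M => exp (α' q.1))
      ((1 : R →L[ℂ] R).comp (α'.comp (ContinuousLinearMap.fst ℂ P M))) (0 : P × M) :=
    ha.comp (0 : P × M) (α'.comp (ContinuousLinearMap.fst ℂ P M)).hasStrictFDerivAt
  have hD := hb'.mul' ha'
  have hnhds := hD.map_nhds_eq_of_surj (by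
    rw [LinearMap.range_eq_top]
    intro e
    obtain ⟨x, y, hxy⟩ := hs e
    refine ⟨(x, y), ?_⟩
    simp only [Prod.snd_zero, Prod.fst_zero, map_zero, exp_zero]
    simp [α', β', ← hxy])
  have h01 : exp (β' (0 : P × M).2) * exp (α' (0 : P × M).1) = 1 := by simp [exp_zero]
  rw [Pi.mul_apply, h01] at hnhds
  have hset : {q : P × M | ‖α q.1‖ < ρ ∧ exp (-q.2) ∈ N} ∈ 𝓝 (0 : P × M) := by
    refine Filter.inter_mem ?_ ?_
    · exact ((hα.comp continuous_fst).norm).continuousAt.eventually_lt continuousAt_const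
        (by simpa using hρ)
    · exact (continuous_exp_complex.comp continuous_snd.neg).continuousAt
        (by simpa [exp_zero] using hN)
  have himg := hnhds ▸ Filter.image_mem_map hset
  obtain ⟨u, hu'⟩ := hu m hm.target_mem
  have hnear : ∀ᶠ z in 𝓝 m, z ∈ W ∧ IsUnit z ∧ m * Ring.inverse z ∈
      (fun q : P × M => exp (β' q.2) * exp (α' q.1)) ''
        {q : P × M | ‖α q.1‖ < ρ ∧ exp (-q.2) ∈ N} := by
    refine (hWo.eventually_mem hyW).and (Filter.Eventually.and (hu' ▸ Units.nhds u) ?_)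
    have hc : ContinuousAt (fun z => m * Ring.inverse z) m :=
      continuousAt_const.mul (hu' ▸ NormedRing.inverse_continuousAt u)
    refine hc ?_
    beta_reduce
    rwa [Ring.mul_inverse_cancel m (hu m hm.target_mem)]
  obtain ⟨δ, hδ, hball⟩ := Metric.eventually_nhds_iff_ball.1 hnear
  obtain ⟨L, hL, hLm⟩ := key δ hδ
  obtain ⟨hLW, hLu, ⟨ξ, η⟩, ⟨hξ, hη⟩, e⟩ := hball (α L) hLm
  have e' : m = exp (β η) * (exp (α ξ) * α L) := by
    have e : exp (β η) * exp (α ξ) = m * Ring.inverse (α L) := e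
    rw [← mul_assoc, e, mul_assoc, Ring.inverse_mul_cancel _ hLu, mul_one]
  refine ⟨expUnit ξ * L, expUnit (-η), hL.trans (joinedIn_expUnit_mul α hα (h1 _ hLW) hξ),
    by simpa using hη, ?_⟩
  rw [e', ← mul_assoc]
  simp [map_exp_complex α hα, map_exp_complex β hβ, exp_neg_mul_exp_complex]

end Exponential

section Triples

open Topology

/-- The trace form on traceless `2 × 2` matrices, written in coordinates: the triple `(p, q, r)`
stands for the matrix with rows `(p, q)` and `(r, -p)`. -/
def dot3 {R : Type*} [CommRing R] (v w : R × R × R) : R :=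
  2 * v.1 * w.1 + v.2.1 * w.2.2 + v.2.2 * w.2.1

/-- Apply a map to each coordinate of a triple. -/
def map3 {R S : Type*} (f : R → S) (v : R × R × R) : S × S × S := (f v.1, f v.2.1, f v.2.2)

/-- The coordinates of `m * V * adjugate m`, where `V` is the matrix of the triple `v`. -/
def conjNum {R : Type*} [CommRing R] (m : Matrix (Fin 2) (Fin 2) R) (v : R × R × R) : R × R × R :=
  (v.1 * (m 0 0 * m 1 1 + m 0 1 * m 1 0) + m 0 1 * m 1 1 * v.2.2 - m 0 0 * m 1 0 * v.2.1,
    m 0 0 * m 0 0 * v.2.1 - 2 * m 0 0 * m 0 1 * v.1 - m 0 1 * m 0 1 * v.2.2,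
    2 * m 1 0 * m 1 1 * v.1 + m 1 1 * m 1 1 * v.2.2 - m 1 0 * m 1 0 * v.2.1)

variable {R : Type*} [CommRing R]

lemma dot3_comm (v w : R × R × R) : dot3 v w = dot3 w v := by
  simp only [dot3]; ring

lemma dot3_add_left (u v w : R × R × R) : dot3 (u + v) w = dot3 u w + dot3 v w := by
  simp only [dot3, Prod.fst_add, Prod.snd_add]; ring

lemma dot3_smul_left (c : R) (v w : R × R × R) : dot3 (c • v) w = c * dot3 v w := by
  simp only [dot3, Prod.smul_fst, Prod.smul_snd, smul_eq_mul]; ring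

lemma dot3_smul_right (c : R) (v w : R × R × R) : dot3 v (c • w) = c * dot3 v w := by
  simp only [dot3, Prod.smul_fst, Prod.smul_snd, smul_eq_mul]; ring

lemma map_dot3 {S F : Type*} [CommRing S] [FunLike F R S] [RingHomClass F R S] (f : F)
    (v w : R × R × R) : f (dot3 v w) = dot3 (map3 f v) (map3 f w) := by
  have h2 : f 2 = 2 := map_ofNat f 2
  simp [dot3, map3, h2]

lemma dot3_conjNum (m : Matrix (Fin 2) (Fin 2) R) (v w : R × R × R) :
    dot3 (conjNum m v) (conjNum m w) = m.det * m.det * dot3 v w := by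
  simp only [dot3, conjNum, Matrix.det_fin_two]; ring

lemma conjNum_mul (m n : Matrix (Fin 2) (Fin 2) R) (v : R × R × R) :
    conjNum (m * n) v = conjNum m (conjNum n v) := by
  simp only [conjNum, Matrix.mul_apply, Fin.sum_univ_two, Prod.mk.injEq]
  refine ⟨?_, ?_, ?_⟩ <;> ring

lemma conjNum_smul (m : Matrix (Fin 2) (Fin 2) R) (c : R) (v : R × R × R) :
    conjNum m (c • v) = c • conjNum m v := by
  simp only [conjNum, Prod.smul_fst, Prod.smul_snd, smul_eq_mul, Prod.smul_mk, Prod.mk.injEq]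
  refine ⟨?_, ?_, ?_⟩ <;> ring

lemma map3_conjNum {S F : Type*} [CommRing S] [FunLike F R S] [RingHomClass F R S] (f : F)
    (m : Matrix (Fin 2) (Fin 2) R) (v : R × R × R) :
    map3 f (conjNum m v) = conjNum (m.map f) (map3 f v) := by
  have h2 : f 2 = 2 := map_ofNat f 2
  simp [map3, conjNum, h2]

/-- The path of matrices `(1 - a) + a * (G * F)`. -/
def rotMat (a : R) (f g : R × R × R) : Matrix (Fin 2) (Fin 2) R :=
  !![1 - a + a * (g.1 * f.1 + g.2.1 * f.2.2), a * (g.1 * f.2.1 - g.2.1 * f.1);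
    a * (g.2.2 * f.1 - g.1 * f.2.2), 1 - a + a * (g.2.2 * f.2.1 + g.1 * f.1)]

variable {f g : R × R × R}

lemma det_rotMat (a : R) (hf : f.1 * f.1 + f.2.1 * f.2.2 = 1) (hg : g.1 * g.1 + g.2.1 * g.2.2 = 1) :
    (rotMat a f g).det = 1 - a * (1 - a) * (2 - dot3 f g) := by
  simp only [rotMat, Matrix.det_fin_two_of, dot3]
  linear_combination (a * a * (g.1 * g.1 + g.2.1 * g.2.2)) * hf + a * a * hg

lemma conjNum_rotMat (a : R) (hf : f.1 * f.1 + f.2.1 * f.2.2 = 1)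
    (hg : g.1 * g.1 + g.2.1 * g.2.2 = 1) :
    conjNum (rotMat a f g) f = ((1 - a) * (1 - a) - a * a) • f +
      (2 * a * (1 - a) + a * a * dot3 f g) • g := by
  obtain ⟨p, q, r⟩ := f
  obtain ⟨p', q', r'⟩ := g
  simp only [conjNum, rotMat, dot3, Matrix.of_apply, Matrix.cons_val', Matrix.cons_val_zero,
    Matrix.cons_val_one, Matrix.cons_val_fin_one, Prod.smul_mk, smul_eq_mul, Prod.mk_add_mk,
    Prod.mk.injEq] at hf hg ⊢
  refine ⟨?_, ?_, ?_⟩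
  · linear_combination (2 * a * (1 - a) * p' + a * a * (2 * p * p' + q * r' + r * q') * p' -
      a * a * (p' * p' + q' * r') * p) * hf - a * a * p * hg
  · linear_combination (2 * a * (1 - a) * q' + a * a * (2 * p * p' + q * r' + r * q') * q' -
      a * a * (p' * p' + q' * r') * q) * hf - a * a * q * hg
  · linear_combination (2 * a * (1 - a) * r' + a * a * (2 * p * p' + q * r' + r * q') * r' -
      a * a * (p' * p' + q' * r') * r) * hf - a * a * r * hg

lemma dot3_conjNum_rotMat (a : R) (hf : f.1 * f.1 + f.2.1 * f.2.2 = 1)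
    (hg : g.1 * g.1 + g.2.1 * g.2.2 = 1) :
    dot3 (conjNum (rotMat a f g) f) g = dot3 f g + 2 * (a * (1 - a)) * (2 - dot3 f g) := by
  rw [conjNum_rotMat a hf hg, dot3_add_left, dot3_smul_left, dot3_smul_left]
  have h : dot3 g g = 2 := by simp only [dot3]; linear_combination 2 * hg
  rw [h]; ring

lemma conjNum_rotMat_half {a : R} (ha : 2 * a = 1) (hf : f.1 * f.1 + f.2.1 * f.2.2 = 1)
    (hg : g.1 * g.1 + g.2.1 * g.2.2 = 1) :
    conjNum (rotMat a f g) f = (rotMat a f g).det • g := by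
  have h1 : (1 - a) * (1 - a) - a * a = 0 := by linear_combination -ha
  have h2 : 2 * a * (1 - a) + a * a * dot3 f g = 1 - a * (1 - a) * (2 - dot3 f g) := by
    linear_combination (a * dot3 f g - (2 * a - 1)) * ha
  rw [conjNum_rotMat a hf hg, det_rotMat a hf hg, h1, h2, zero_smul, zero_add]

end Triples

section CoreLemma

open Topology

lemma isOpen_forall_algHom_prod {E : Type*} [NormedCommRing E] [NormedAlgebra ℂ E]
    [CompleteSpace E] {O : Set (ℂ × ℂ)} (hO : IsOpen O) :
    IsOpen {q : E × E | ∀ ψ : E →ₐ[ℂ] ℂ, (ψ q.1, ψ q.2) ∈ O} := by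
  let F : (E × E) × characterSpace ℂ E → ℂ × ℂ := fun z =>
    (gelfandTransform ℂ E z.1.1 z.2, gelfandTransform ℂ E z.1.2 z.2)
  have hF : Continuous F := by
    have h : Continuous fun z : C(characterSpace ℂ E, ℂ) × characterSpace ℂ E => z.1 z.2 :=
      continuous_eval
    exact (h.comp (((continuous_gelfandTransform (E := E)).comp
        (continuous_fst.comp continuous_fst)).prodMk continuous_snd)).prodMk
      (h.comp (((continuous_gelfandTransform (E := E)).comp
        (continuous_snd.comp continuous_fst)).prodMk continuous_snd))
  have h1 : IsClosed (Prod.fst '' (F ⁻¹' Oᶜ)) :=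
    isClosedMap_fst_of_compactSpace _ (hO.isClosed_compl.preimage hF)
  convert h1.isOpen_compl using 1
  ext q
  simp only [Set.mem_compl_iff, Set.mem_image, Prod.exists, exists_and_right, exists_eq_right,
    not_exists, Set.mem_preimage, not_not]
  exact ⟨fun h x => h (CharacterSpace.toAlgHom x),
    fun h ψ => h (CharacterSpace.equivAlgHom.symm ψ)⟩

/-- Conjugation of a traceless matrix, in coordinates. -/
def conj3 {R : Type*} [CommRing R] (L : (Matrix (Fin 2) (Fin 2) R)ˣ) (v : R × R × R) : R × R × R :=
  (↑L⁻¹ : Matrix (Fin 2) (Fin 2) R).det • conjNum (L : Matrix (Fin 2) (Fin 2) R) v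

section

variable {R : Type*} [CommRing R] (L : (Matrix (Fin 2) (Fin 2) R)ˣ)

lemma det_inv_mul_det :
    (↑L⁻¹ : Matrix (Fin 2) (Fin 2) R).det * (↑L : Matrix (Fin 2) (Fin 2) R).det = 1 := by
  rw [← Matrix.det_mul, ← Units.val_mul, inv_mul_cancel, Units.val_one, Matrix.det_one]

lemma dot3_conj3 (v w : R × R × R) : dot3 (conj3 L v) (conj3 L w) = dot3 v w := by
  rw [conj3, conj3, dot3_smul_left, dot3_smul_right, dot3_conjNum]
  linear_combination (dot3 v w * (1 + (↑L⁻¹ : Matrix (Fin 2) (Fin 2) R).det *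
    (↑L : Matrix (Fin 2) (Fin 2) R).det)) *
    det_inv_mul_det L

@[simp] lemma conj3_one (v : R × R × R) : conj3 1 v = v := by
  simp [conj3, conjNum]

lemma continuous_conjNum {R X : Type*} [CommRing R] [TopologicalSpace R] [IsTopologicalRing R]
    [TopologicalSpace X] {m : X → Matrix (Fin 2) (Fin 2) R} (hm : Continuous m)
    (v : R × R × R) : Continuous fun x => conjNum (m x) v := by
  have h : ∀ i j, Continuous fun x => m x i j := fun i j => hm.matrix_elem i j
  have := h 0 0
  have := h 0 1
  have := h 1 0
  have := h 1 1
  unfold conjNum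
  fun_prop

lemma continuous_conj3 {R X : Type*} [CommRing R] [TopologicalSpace R] [IsTopologicalRing R]
    [TopologicalSpace X] {m m' : X → Matrix (Fin 2) (Fin 2) R} (hm : Continuous m)
    (hm' : Continuous m') (v : R × R × R) : Continuous fun x => (m' x).det • conjNum (m x) v :=
  (hm'.matrix_det).smul (continuous_conjNum hm v)

end

lemma half_dot3 {R : Type*} [CommRing R] [Algebra ℂ R] {f : R × R × R} (h : dot3 f f = 2) :
    f.1 * f.1 + f.2.1 * f.2.2 = 1 := by
  have h2 : algebraMap ℂ R (1 / 2) * 2 = 1 := by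
    rw [show (2 : R) = algebraMap ℂ R 2 from (map_ofNat _ 2).symm, ← map_mul]; simp
  simp only [dot3] at h
  linear_combination (algebraMap ℂ R (1 / 2)) * h - (f.1 * f.1 + f.2.1 * f.2.2 - 1) * h2

lemma exists_nhds_one_of_units {R : Type*} [NormedRing R] [CompleteSpace R] {S : Set Rˣ}
    (hS : S ∈ 𝓝 (1 : Rˣ)) : ∃ N ∈ 𝓝 (1 : R), ∀ Q : Rˣ, (Q : R) ∈ N → Q ∈ S := by
  rw [Units.isOpenEmbedding_val.isEmbedding.nhds_eq_comap, Filter.mem_comap] at hS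
  obtain ⟨N, hN, hsub⟩ := hS
  exact ⟨N, hN, fun Q hQ => hsub hQ⟩

attribute [local instance] Matrix.linftyOpNormedRing Matrix.linftyOpNormedAlgebra

lemma completeSpace_matrix (E : Type*) [NormedCommRing E] [CompleteSpace E] :
    @CompleteSpace (Matrix (Fin 2) (Fin 2) E)
      (Matrix.linftyOpNormedRing.toMetricSpace.toPseudoMetricSpace.toUniformSpace) :=
  inferInstanceAs (CompleteSpace (Fin 2 → Fin 2 → E))

attribute [local instance] completeSpace_matrix

/-- Two unit triples which are close over `E` can be moved so as to agree there. -/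
lemma exists_match_unit {P M E : Type*} [NormedCommRing P] [NormedAlgebra ℂ P] [CompleteSpace P]
    [NormedCommRing M] [NormedAlgebra ℂ M] [CompleteSpace M]
    [NormedCommRing E] [NormedAlgebra ℂ E] [CompleteSpace E]
    (α : P →ₐ[ℂ] E) (hα : Continuous α) (β : M →ₐ[ℂ] E) (hβ : Continuous β)
    (hd : DenseRange α) (hs : ∀ e, ∃ x y, α x + β y = e)
    {f : P × P × P} {g : M × M × M} (hf : dot3 f f = 2) (hg : dot3 g g = 2)
    (hfg : ∀ ψ : E →ₐ[ℂ] ℂ, ‖ψ (dot3 (map3 α f) (map3 β g)) - 2‖ < 1 / 2)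
    {N : Set (M × M × M)} (hN : N ∈ 𝓝 g) :
    ∃ f₁ g', JoinedIn {f' | dot3 f' f' = 2 ∧
        ∀ ψ : E →ₐ[ℂ] ℂ, ‖ψ (dot3 (map3 α f') (map3 β g)) - 2‖ < 1} f f₁ ∧
      g' ∈ N ∧ dot3 g' g' = 2 ∧ map3 α f₁ = map3 β g' := by
  set F := map3 α f with hFdef
  set G := map3 β g with hGdef
  have hF : F.1 * F.1 + F.2.1 * F.2.2 = 1 := half_dot3 (by rw [hFdef, ← map_dot3, hf, map_ofNat])
  have hG : G.1 * G.1 + G.2.1 * G.2.2 = 1 := half_dot3 (by rw [hGdef, ← map_dot3, hg, map_ofNat])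
  let τ : Matrix (Fin 2) (Fin 2) E → E × E := fun m => (dot3 (conjNum m F) G - 2 * m.det, m.det)
  have hτ : Continuous τ := by
    have h1 := continuous_conjNum (continuous_id (X := Matrix (Fin 2) (Fin 2) E)) F
    have h2 : Continuous fun m : Matrix (Fin 2) (Fin 2) E => m.det := continuous_id.matrix_det
    have h3 : Continuous fun m : Matrix (Fin 2) (Fin 2) E => dot3 (conjNum m F) G := by
      simp only [dot3]
      simp only [id] at h1
      fun_prop
    exact (h3.sub (continuous_const.mul h2)).prodMk h2
  let V : Set (Matrix (Fin 2) (Fin 2) E) :=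
    τ ⁻¹' {q : E × E | ∀ ψ : E →ₐ[ℂ] ℂ, (ψ q.1, ψ q.2) ∈ {z : ℂ × ℂ | ‖z.1‖ < ‖z.2‖}}
  have hV : IsOpen V :=
    (isOpen_forall_algHom_prod (isOpen_lt (by fun_prop) (by fun_prop))).preimage hτ
  have hVu : ∀ m ∈ V, IsUnit m := by
    intro m hm
    rw [Matrix.isUnit_iff_isUnit_det]
    refine isUnit_of_forall_algHom fun ψ h0 => ?_
    have := hm ψ
    simp only [Set.mem_ofPred_eq, τ, h0, norm_zero] at this
    exact absurd this (not_lt.2 (norm_nonneg _))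
  let a₀ : E := algebraMap ℂ E (1 / 2)
  have ha₀ : 2 * a₀ = 1 := by
    rw [show (2 : E) = algebraMap ℂ E 2 from (map_ofNat _ 2).symm, ← map_mul]; simp
  have hpath : JoinedIn V 1 (rotMat a₀ F G) := by
    refine JoinedIn.ofLine (f := fun t : ℝ => rotMat (algebraMap ℂ E ((t : ℂ) * (1 / 2))) F G)
      ?_ ?_ ?_ ?_
    · refine Continuous.continuousOn ?_
      have hc : Continuous fun t : ℝ => algebraMap ℂ E ((t : ℂ) * (1 / 2)) :=
        (algebraMapCLM ℂ E).continuous.comp (by fun_prop)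
      refine continuous_matrix fun i j => ?_
      fin_cases i <;> fin_cases j <;> simp [rotMat] <;> fun_prop
    · ext i j
      fin_cases i <;> fin_cases j <;> simp [rotMat]
    · simp [a₀]
    · rintro _ ⟨t, ht, rfl⟩ ψ
      have hψ := hfg ψ
      simp only [Set.mem_ofPred_eq, τ]
      rw [dot3_conjNum_rotMat _ hF hG, det_rotMat _ hF hG]
      simp only [map_sub, map_add, map_mul, map_one, map_ofNat, AlgHom.commutes,
        Algebra.algebraMap_self, RingHom.id_apply]
      set d := ψ (dot3 F G)
      have ht0 := ht.1
      have ht1 := ht.2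
      have hA : ((t : ℂ) * (1 / 2)) * (1 - (t : ℂ) * (1 / 2)) =
          ((t * (1 / 2) * (1 - t * (1 / 2)) : ℝ) : ℂ) := by
        push_cast; ring
      rw [hA]
      have hA0 : 0 ≤ t * (1 / 2) * (1 - t * (1 / 2)) := by nlinarith
      have hA1 : t * (1 / 2) * (1 - t * (1 / 2)) ≤ 1 / 4 := by nlinarith [sq_nonneg (t - 1)]
      generalize t * (1 / 2) * (1 - t * (1 / 2)) = A at hA0 hA1
      have e1 : d + 2 * (A : ℂ) * (2 - d) - 2 * (1 - A * (2 - d)) =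
          ((1 - 4 * A : ℝ) : ℂ) * (d - 2) := by
        push_cast; ring
      have e2 : (1 : ℂ) - A * (2 - d) = 1 + A * (d - 2) := by ring
      rw [e1, e2, norm_mul, Complex.norm_real, Real.norm_of_nonneg (by linarith)]
      have h3 : ‖(1 : ℂ)‖ ≤ ‖1 + (A : ℂ) * (d - 2)‖ + ‖(A : ℂ) * (d - 2)‖ := by
        simpa using norm_sub_le (1 + (A : ℂ) * (d - 2)) ((A : ℂ) * (d - 2))
      rw [norm_mul, Complex.norm_real, Real.norm_of_nonneg hA0, norm_one] at h3
      nlinarith [norm_nonneg (d - 2)]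
  let αM : Matrix (Fin 2) (Fin 2) P →ₐ[ℂ] Matrix (Fin 2) (Fin 2) E := α.mapMatrix
  let βM : Matrix (Fin 2) (Fin 2) M →ₐ[ℂ] Matrix (Fin 2) (Fin 2) E := β.mapMatrix
  have hαM : Continuous αM := continuous_id.matrix_map hα
  have hβM : Continuous βM := continuous_id.matrix_map hβ
  have hdM : DenseRange αM := DenseRange.piMap fun i => DenseRange.piMap fun j => hd
  have hsM : ∀ e, ∃ x y, αM x + βM y = e := by
    intro e
    choose x y hxy using hs
    refine ⟨e.map x, e.map y, ?_⟩
    ext i j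
    exact hxy _
  have hcR : Continuous fun Q : (Matrix (Fin 2) (Fin 2) M)ˣ => conj3 Q g :=
    continuous_conj3 Units.continuous_val (Units.continuous_val.comp continuous_inv) g
  have hNN : ∃ N' ∈ 𝓝 (1 : Matrix (Fin 2) (Fin 2) M), ∀ Q : (Matrix (Fin 2) (Fin 2) M)ˣ,
      (Q : Matrix (Fin 2) (Fin 2) M) ∈ N' → conj3 Q g ∈ N := by
    have h1 : (fun Q : (Matrix (Fin 2) (Fin 2) M)ˣ => conj3 Q g) ⁻¹' N ∈ 𝓝 1 :=
      hcR.continuousAt (by simpa using hN)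
    exact exists_nhds_one_of_units h1
  obtain ⟨N', hN', hN'N⟩ := hNN
  obtain ⟨L, Q, hL, hQ, hLQ⟩ := exists_factorization αM hαM βM hβM hdM hsM hV hVu hpath hN'
  have hmapα : ∀ L : (Matrix (Fin 2) (Fin 2) P)ˣ, map3 α (conj3 L f) =
      α ((↑L⁻¹ : Matrix (Fin 2) (Fin 2) P).det) • conjNum (αM L) F := by
    intro L
    rw [show αM L = (L : Matrix (Fin 2) (Fin 2) P).map α from rfl, hFdef, ← map3_conjNum]
    simp [conj3, map3]
  have hdetα : ∀ L : (Matrix (Fin 2) (Fin 2) P)ˣ,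
      α ((↑L⁻¹ : Matrix (Fin 2) (Fin 2) P).det) * (αM L).det = 1 := by
    intro L
    rw [show αM L = α.mapMatrix L from rfl, ← AlgHom.map_det, ← map_mul, det_inv_mul_det, map_one]
  refine ⟨conj3 L f, conj3 Q g, ?_, hN'N Q hQ, by rw [dot3_conj3, hg], ?_⟩
  · have hc : Continuous fun L : (Matrix (Fin 2) (Fin 2) P)ˣ => conj3 L f :=
      continuous_conj3 Units.continuous_val (Units.continuous_val.comp continuous_inv) f
    have := JoinedIn.map hL hc
    rw [conj3_one] at this
    refine this.mono ?_
    rintro _ ⟨L, hLV, rfl⟩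
    refine ⟨by rw [dot3_conj3, hf], fun ψ => ?_⟩
    have h1 := hLV ψ
    simp only [Set.mem_ofPred_eq, τ] at h1
    have h2 := congrArg ψ (hdetα L)
    rw [hmapα, dot3_smul_left]
    simp only [map_sub, map_mul, map_one, map_ofNat] at h1 h2 ⊢
    have h3 : ψ (α ((↑L⁻¹ : Matrix (Fin 2) (Fin 2) P).det)) ≠ 0 := left_ne_zero_of_mul_eq_one h2
    generalize ψ (α ((↑L⁻¹ : Matrix (Fin 2) (Fin 2) P).det)) = k at h2 h3 ⊢
    have e : k * ψ (dot3 (conjNum (αM L) F) G) - 2 =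
        k * (ψ (dot3 (conjNum (αM L) F) G) - 2 * ψ (αM L).det) := by
      linear_combination 2 * h2
    rw [e, norm_mul]
    calc _ < ‖k‖ * ‖ψ (αM L).det‖ := mul_lt_mul_of_pos_left h1 (norm_pos_iff.2 h3)
      _ = 1 := by rw [← norm_mul, h2, norm_one]
  · have h1 := hdetα L
    have h2 : β ((↑Q⁻¹ : Matrix (Fin 2) (Fin 2) M).det) * (βM Q).det = 1 := by
      rw [show βM Q = β.mapMatrix Q from rfl, ← AlgHom.map_det, ← map_mul, det_inv_mul_det, map_one]
    rw [hmapα, hLQ, conjNum_mul, conjNum_rotMat_half ha₀ hF hG, conjNum_smul, smul_smul]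
    have h4 : map3 β (conj3 Q g) =
        β ((↑Q⁻¹ : Matrix (Fin 2) (Fin 2) M).det) • conjNum (βM Q) G := by
      rw [show βM Q = (Q : Matrix (Fin 2) (Fin 2) M).map β from rfl, hGdef, ← map3_conjNum]
      simp [conj3, map3]
    rw [h4]
    congr 1
    rw [hLQ, Matrix.det_mul] at h1
    linear_combination β ((↑Q⁻¹ : Matrix (Fin 2) (Fin 2) M).det) * h1 -
      α ((↑L⁻¹ : Matrix (Fin 2) (Fin 2) P).det) * (rotMat a₀ F G).det * h2

end CoreLemma

section Localization

open Topology UniformSpace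

/-- The radii of a closed annulus. -/
structure Radii where
  inner : ℝ
  outer : ℝ
  inner_pos : 0 < inner
  inner_le : inner ≤ outer

namespace Radii

/-- The supremum of `|z| ^ n` over the annulus. -/
noncomputable def weight (W : Radii) (n : ℤ) : ℝ := max (W.inner ^ n) (W.outer ^ n)

variable (W : Radii)

lemma outer_pos : 0 < W.outer := W.inner_pos.trans_le W.inner_le

lemma weight_pos (n : ℤ) : 0 < W.weight n := lt_max_of_lt_left (zpow_pos W.inner_pos n)

@[simp] lemma weight_zero : W.weight 0 = 1 := by simp [weight]

lemma weight_add_le (m n : ℤ) : W.weight (m + n) ≤ W.weight m * W.weight n := by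
  have h1 := (zpow_pos W.inner_pos m).le
  have h2 := (zpow_pos W.inner_pos n).le
  have h3 := (zpow_pos W.outer_pos m).le
  have h4 := (zpow_pos W.outer_pos n).le
  refine max_le ?_ ?_
  · rw [zpow_add₀ W.inner_pos.ne']
    exact mul_le_mul (le_max_left _ _) (le_max_left _ _) h2 (W.weight_pos m).le
  · rw [zpow_add₀ W.outer_pos.ne']
    exact mul_le_mul (le_max_right _ _) (le_max_right _ _) h4 (W.weight_pos m).le

variable {W} in
lemma zpow_le_weight {ρ : ℝ} (h1 : W.inner ≤ ρ) (h2 : ρ ≤ W.outer) (n : ℤ) :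
    ρ ^ n ≤ W.weight n := by
  have hρ := W.inner_pos.trans_le h1
  rcases le_total 0 n with hn | hn
  · exact (zpow_le_zpow_left₀ hn hρ.le h2).trans (le_max_right _ _)
  · refine le_trans ?_ (le_max_left _ _)
    obtain ⟨m, rfl⟩ : ∃ m, n = -m := ⟨-n, by simp⟩
    rw [zpow_neg, zpow_neg]
    exact inv_anti₀ (zpow_pos W.inner_pos m) (zpow_le_zpow_left₀ (by omega) W.inner_pos.le h1)

lemma weight_le_weight {W W' : Radii} (h1 : W.inner ≤ W'.inner) (h2 : W'.outer ≤ W.outer) (n : ℤ) :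
    W'.weight n ≤ W.weight n :=
  max_le (zpow_le_weight h1 (W'.inner_le.trans h2) n) (zpow_le_weight (h1.trans W'.inner_le) h2 n)

end Radii

variable {A : Type*} [NormedCommRing A] [NormedAlgebra ℂ A] (b : Aˣ) (W : Radii)

/-- `x` is a Laurent polynomial in `b` of total weighted size at most `c`. -/
def LaurentRep (x : A) (c : ℝ) : Prop :=
  ∃ (ι : Type) (_ : Fintype ι) (k : ι → A) (e : ι → ℤ),
    ∑ i, k i * ↑(b ^ e i) = x ∧ ∑ i, ‖k i‖ * W.weight (e i) ≤ c

namespace LaurentRep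

variable {b W}

lemma nonneg {x : A} {c : ℝ} (h : LaurentRep b W x c) : 0 ≤ c := by
  obtain ⟨ι, _, k, e, -, h⟩ := h
  exact (Finset.sum_nonneg fun i _ => mul_nonneg (norm_nonneg _) (W.weight_pos _).le).trans h

lemma mono {W' : Radii} (hW : ∀ n, W'.weight n ≤ W.weight n) {x : A} {c c' : ℝ}
    (h : LaurentRep b W x c) (hc : c ≤ c') : LaurentRep b W' x c' := by
  obtain ⟨ι, i, k, e, h1, h2⟩ := h
  exact ⟨ι, i, k, e, h1, (Finset.sum_le_sum fun i _ =>
    mul_le_mul_of_nonneg_left (hW _) (norm_nonneg _)).trans (h2.trans hc)⟩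

lemma single (a : A) (n : ℤ) : LaurentRep b W (a * ↑(b ^ n)) (‖a‖ * W.weight n) :=
  ⟨Unit, inferInstance, fun _ => a, fun _ => n, by simp, by simp⟩

lemma const (a : A) : LaurentRep b W a ‖a‖ := by
  simpa using single (b := b) (W := W) a 0

lemma add {x y : A} {c d : ℝ} (hx : LaurentRep b W x c) (hy : LaurentRep b W y d) :
    LaurentRep b W (x + y) (c + d) := by
  obtain ⟨ι, _, k, e, rfl, h2⟩ := hx
  obtain ⟨κ, _, l, f, rfl, h4⟩ := hy
  refine ⟨ι ⊕ κ, inferInstance, Sum.elim k l, Sum.elim e f, by simp, ?_⟩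
  simpa using add_le_add h2 h4

lemma mul {x y : A} {c d : ℝ} (hx : LaurentRep b W x c) (hy : LaurentRep b W y d) :
    LaurentRep b W (x * y) (c * d) := by
  have hc := hx.nonneg
  obtain ⟨ι, _, k, e, rfl, h2⟩ := hx
  obtain ⟨κ, _, l, f, rfl, h4⟩ := hy
  refine ⟨ι × κ, inferInstance, fun z => k z.1 * l z.2, fun z => e z.1 + f z.2, ?_, ?_⟩
  · rw [Finset.sum_mul_sum, Fintype.sum_prod_type]
    refine Finset.sum_congr rfl fun i _ => Finset.sum_congr rfl fun j _ => ?_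
    rw [zpow_add, Units.val_mul]
    ring
  · refine le_trans ?_ (mul_le_mul h2 h4 (Finset.sum_nonneg fun i _ =>
      mul_nonneg (norm_nonneg _) (W.weight_pos _).le) hc)
    rw [Finset.sum_mul_sum, Fintype.sum_prod_type]
    refine Finset.sum_le_sum fun i _ => Finset.sum_le_sum fun j _ => ?_
    calc ‖k i * l j‖ * W.weight (e i + f j)
        ≤ (‖k i‖ * ‖l j‖) * (W.weight (e i) * W.weight (f j)) :=
          mul_le_mul (norm_mul_le _ _) (W.weight_add_le _ _) (W.weight_pos _).le (by positivity)
      _ = _ := by ring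

lemma smul {x : A} {c : ℝ} (z : ℂ) (hx : LaurentRep b W x c) :
    LaurentRep b W (z • x) (‖z‖ * c) := by
  obtain ⟨ι, _, k, e, rfl, h2⟩ := hx
  refine ⟨ι, inferInstance, fun i => z • k i, e, ?_, ?_⟩
  · rw [Finset.smul_sum]; simp
  · refine le_trans (le_of_eq ?_) (mul_le_mul_of_nonneg_left h2 (norm_nonneg z))
    rw [Finset.mul_sum]
    simp [norm_smul, mul_assoc]

lemma split {r t t' : ℝ} (hr : 0 < r) (hrt : r ≤ t) (htt : t ≤ t') {x : A} {c : ℝ}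
    (h : LaurentRep b ⟨t, t, hr.trans_le hrt, le_rfl⟩ x c) :
    ∃ y z, x = y + z ∧ LaurentRep b ⟨r, t, hr, hrt⟩ y c ∧
      LaurentRep b ⟨t, t', hr.trans_le hrt, htt⟩ z c := by
  have ht := hr.trans_le hrt
  obtain ⟨ι, _, k, e, rfl, h2⟩ := h
  refine ⟨∑ i, (if 0 ≤ e i then k i else 0) * ↑(b ^ e i),
    ∑ i, (if 0 ≤ e i then 0 else k i) * ↑(b ^ e i), ?_,
    ⟨ι, inferInstance, _, e, rfl, le_trans ?_ h2⟩, ⟨ι, inferInstance, _, e, rfl, le_trans ?_ h2⟩⟩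
  · rw [← Finset.sum_add_distrib]
    refine Finset.sum_congr rfl fun i _ => ?_
    split_ifs <;> simp
  · refine Finset.sum_le_sum fun i _ => ?_
    split_ifs with hi
    · refine mul_le_mul_of_nonneg_left ?_ (norm_nonneg _)
      simpa [Radii.weight] using zpow_le_zpow_left₀ hi hr.le hrt
    · simpa using mul_nonneg (norm_nonneg (k i)) (Radii.weight_pos _ _).le
  · refine Finset.sum_le_sum fun i _ => ?_
    split_ifs with hi
    · simpa using mul_nonneg (norm_nonneg (k i)) (Radii.weight_pos _ _).le
    · refine mul_le_mul_of_nonneg_left ?_ (norm_nonneg _)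
      obtain ⟨m, hm⟩ : ∃ m, e i = -m := ⟨-e i, by simp⟩
      simp only [Radii.weight, hm, zpow_neg, max_self, max_le_iff, le_refl, true_and]
      exact inv_anti₀ (zpow_pos ht m) (zpow_le_zpow_left₀ (by omega) ht.le htt)

lemma norm_apply_le {x : A} {c : ℝ} (h : LaurentRep b W x c) (φ : A →ₐ[ℂ] ℂ)
    (hφ : ∀ a, ‖φ a‖ ≤ ‖a‖) (h1 : W.inner ≤ ‖φ b‖) (h2 : ‖φ b‖ ≤ W.outer) : ‖φ x‖ ≤ c := by
  obtain ⟨ι, _, k, e, rfl, h⟩ := h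
  rw [map_sum]
  refine (norm_sum_le _ _).trans (le_trans (Finset.sum_le_sum fun i _ => ?_) h)
  rw [map_mul, norm_mul]
  refine mul_le_mul (hφ _) ?_ (norm_nonneg _) (norm_nonneg _)
  have : φ ↑(b ^ e i) = φ b ^ e i := by
    have h3 := congrArg Units.val (map_zpow (Units.map (φ : A →* ℂ)) b (e i))
    rwa [Units.val_zpow_eq_zpow_val] at h3
  rw [this, norm_zpow]
  exact Radii.zpow_le_weight h1 h2 _

end LaurentRep

/-- The algebra `A` with the seminorm that measures elements on the annulus `W` in terms of `b`. -/
@[nolint unusedArguments]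
def Loc (_ : Aˣ) (_ : Radii) : Type _ := A

namespace Loc

instance : CommRing (Loc b W) := inferInstanceAs (CommRing A)

instance : Algebra ℂ (Loc b W) := inferInstanceAs (Algebra ℂ A)

/-- The seminorm of the localization. -/
noncomputable def seminorm : AddGroupSeminorm (Loc b W) where
  toFun x := sInf {c | LaurentRep b W (x : A) c}
  map_zero' := by
    refine le_antisymm (csInf_le ⟨0, fun c hc => hc.nonneg⟩ ?_)
      (Real.sInf_nonneg fun c hc => hc.nonneg)
    have := LaurentRep.const (b := b) (W := W) (0 : A)
    rwa [norm_zero] at this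
  add_le' x y := by
    have hne : ∀ x : A, {c | LaurentRep b W x c}.Nonempty := fun x => ⟨_, LaurentRep.const x⟩
    refine le_of_forall_pos_le_add fun ε hε => ?_
    obtain ⟨c, hc, hc'⟩ := Real.lt_sInf_add_pos (hne x) (half_pos hε)
    obtain ⟨d, hd, hd'⟩ := Real.lt_sInf_add_pos (hne y) (half_pos hε)
    have hc : LaurentRep (A := A) b W x c := hc
    have hd : LaurentRep (A := A) b W y d := hd
    have := csInf_le (s := {c | LaurentRep (A := A) b W (x + y) c})
      ⟨0, fun c hc => LaurentRep.nonneg hc⟩ (hc.add hd)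
    change sInf {c | LaurentRep (A := A) b W (x + y) c} ≤ _
    exact this.trans (by linarith)
  neg' x := by
    have h1 : ∀ (x : A) c, LaurentRep b W x c → LaurentRep b W (-x) c := fun x c h => by
      simpa using h.smul (-1)
    congr 1
    ext c
    refine ⟨fun h => ?_, h1 _ _⟩
    have h2 := h1 _ _ h
    have e : ∀ y : A, - -y = y := neg_neg
    exact e x ▸ h2

lemma seminorm_le {x : A} {c : ℝ} (h : LaurentRep b W x c) : seminorm b W x ≤ c :=
  csInf_le ⟨0, fun _ hc => LaurentRep.nonneg hc⟩ h

lemma exists_rep_of_seminorm_lt {x : A} {c : ℝ} (h : seminorm b W x < c) :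
    ∃ d < c, LaurentRep b W x d := by
  obtain ⟨d, hd, hdc⟩ := exists_lt_of_csInf_lt
    (show {c | LaurentRep b W x c}.Nonempty from ⟨_, LaurentRep.const x⟩) h
  exact ⟨d, hdc, hd⟩

lemma seminorm_mul_le (x y : Loc b W) : seminorm b W (x * y) ≤ seminorm b W x * seminorm b W y := by
  refine le_of_forall_gt_imp_ge_of_dense fun c hc => ?_
  have hx : 0 ≤ seminorm b W x := apply_nonneg _ _
  have hy : 0 ≤ seminorm b W y := apply_nonneg _ _
  have hlim : Filter.Tendsto (fun ε : ℝ => (seminorm b W x + ε) * (seminorm b W y + ε)) (𝓝[>] 0)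
      (𝓝 (seminorm b W x * seminorm b W y)) := by
    have : Continuous fun ε : ℝ => (seminorm b W x + ε) * (seminorm b W y + ε) := by fun_prop
    have h0 := this.tendsto 0
    simp only [add_zero] at h0
    exact h0.mono_left nhdsWithin_le_nhds
  obtain ⟨ε, hε, hε0⟩ := ((hlim.eventually_lt_const hc).and self_mem_nhdsWithin).exists
  have hε0 : 0 < ε := hε0
  obtain ⟨d, hd, hd'⟩ := exists_rep_of_seminorm_lt b W (x := x) (lt_add_of_pos_right _ hε0)
  obtain ⟨e, he, he'⟩ := exists_rep_of_seminorm_lt b W (x := y) (lt_add_of_pos_right _ hε0)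
  have h1 := seminorm_le b W (hd'.mul he')
  exact h1.trans ((mul_le_mul hd.le he.le he'.nonneg (by linarith)).trans hε.le)

lemma seminorm_smul_le (z : ℂ) (x : Loc b W) : seminorm b W (z • x) ≤ ‖z‖ * seminorm b W x := by
  refine le_of_forall_pos_le_add fun ε hε => ?_
  have hz : 0 < ‖z‖ + 1 := by positivity
  obtain ⟨d, hd, hd'⟩ := exists_rep_of_seminorm_lt b W (x := x)
    (lt_add_of_pos_right _ (show 0 < ε / (‖z‖ + 1) by positivity))
  have h1 : seminorm b W (z • x) ≤ _ := seminorm_le b W (hd'.smul z)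
  have h2 : ‖z‖ * (ε / (‖z‖ + 1)) ≤ ε := by
    rw [← mul_div_assoc, div_le_iff₀ hz]; nlinarith
  nlinarith [norm_nonneg z]

noncomputable instance : SeminormedCommRing (Loc b W) :=
  { AddGroupSeminorm.toSeminormedAddCommGroup (seminorm b W),
    (inferInstance : CommRing (Loc b W)) with
    norm_mul_le := seminorm_mul_le b W }

noncomputable instance : NormedAlgebra ℂ (Loc b W) :=
  { (inferInstance : Algebra ℂ (Loc b W)) with norm_smul_le := seminorm_smul_le b W }

end Loc
end Localization

section Completions

open Topology UniformSpace

variable {A : Type*} [NormedCommRing A] [NormedAlgebra ℂ A] (b : Aˣ) (W : Radii)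

namespace Loc

/-- The identity map, as a homomorphism to the seminormed algebra. -/
def of : A →ₐ[ℂ] Loc b W := AlgHom.id ℂ A

/-- The natural map from an algebra to its completion on an annulus. -/
noncomputable def emb : A →ₐ[ℂ] Completion (Loc b W) where
  toFun x := (of b W x : Completion (Loc b W))
  map_one' := Completion.coe_one _
  map_mul' x y := Completion.coe_mul (α := Loc b W) x y
  map_zero' := Completion.coe_zero (α := Loc b W)
  map_add' x y := Completion.coe_add (α := Loc b W) x y
  commutes' z := (Completion.algebraMap_def (Loc b W) ℂ z).symm

lemma norm_emb (x : A) : ‖emb b W x‖ = seminorm b W x :=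
  Completion.norm_coe (of b W x)

lemma norm_emb_le (x : A) : ‖emb b W x‖ ≤ ‖x‖ :=
  (norm_emb b W x).trans_le (seminorm_le b W (LaurentRep.const x))

lemma denseRange_emb : DenseRange (emb b W) := Completion.denseRange_coe (α := Loc b W)

variable {b W} {B : Type*} [NormedRing B] [NormedAlgebra ℂ B] [CompleteSpace B]

lemma continuous_of_norm_le (φ : A →ₐ[ℂ] B) (hφ : ∀ x, ‖φ x‖ ≤ seminorm b W x) :
    Continuous (fun x : Loc b W => φ x) :=
  AddMonoidHomClass.continuous_of_bound (E := Loc b W) (φ : A →+* B) 1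
    fun x => (hφ x).trans_eq (one_mul _).symm

/-- Extension of a homomorphism that is contractive for the seminorm. -/
noncomputable def lift (φ : A →ₐ[ℂ] B) (hφ : ∀ x, ‖φ x‖ ≤ seminorm b W x) :
    Completion (Loc b W) →ₐ[ℂ] B :=
  { Completion.extensionHom (α := Loc b W) (β := B) (φ : A →+* B)
      (continuous_of_norm_le φ hφ) with
    commutes' := fun z => by
      rw [Completion.algebraMap_def]
      exact (Completion.extensionHom_coe (α := Loc b W) _ _ _).trans (φ.commutes z) }

lemma lift_emb (φ : A →ₐ[ℂ] B) (hφ : ∀ x, ‖φ x‖ ≤ seminorm b W x) (x : A) :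
    lift φ hφ (emb b W x) = φ x :=
  Completion.extensionHom_coe (α := Loc b W) (β := B) (φ : A →+* B)
    (continuous_of_norm_le φ hφ) (of b W x)

lemma continuous_lift (φ : A →ₐ[ℂ] B) (hφ : ∀ x, ‖φ x‖ ≤ seminorm b W x) :
    Continuous (lift φ hφ) :=
  Completion.continuous_extension (α := Loc b W) (β := B)

lemma norm_lift_le (φ : A →ₐ[ℂ] B) (hφ : ∀ x, ‖φ x‖ ≤ seminorm b W x)
    (x : Completion (Loc b W)) : ‖lift φ hφ x‖ ≤ ‖x‖ := by
  refine (denseRange_emb b W).induction_on x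
    (isClosed_le (continuous_lift φ hφ).norm continuous_norm) fun a => ?_
  rw [lift_emb, norm_emb]
  exact hφ a

section Restriction

variable {W' : Radii} (h1 : W.inner ≤ W'.inner) (h2 : W'.outer ≤ W.outer)

variable (b W W') in
/-- Restriction to a smaller annulus. -/
noncomputable def res : Completion (Loc b W) →ₐ[ℂ] Completion (Loc b W') :=
  lift (emb b W') fun x => by
    rw [norm_emb]
    refine le_of_forall_gt_imp_ge_of_dense fun c hc => ?_
    obtain ⟨d, hd, hd'⟩ := exists_rep_of_seminorm_lt b W hc
    exact seminorm_le b W' (hd'.mono (Radii.weight_le_weight h1 h2) hd.le)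

lemma res_emb (x : A) : res b W W' h1 h2 (emb b W x) = emb b W' x := lift_emb _ _ x

lemma norm_res_le (x : Completion (Loc b W)) : ‖res b W W' h1 h2 x‖ ≤ ‖x‖ := norm_lift_le _ _ x

lemma denseRange_res : DenseRange (res b W W' h1 h2) := by
  refine (denseRange_emb b W').mono ?_
  rintro _ ⟨x, rfl⟩
  exact ⟨emb b W x, res_emb h1 h2 x⟩

end Restriction

lemma exists_split {r t t' : ℝ} (hr : 0 < r) (hrt : r ≤ t) (htt : t ≤ t') {x : A} {c : ℝ}
    (h : ‖emb b ⟨t, t, hr.trans_le hrt, le_rfl⟩ x‖ < c) :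
    ∃ y z, x = y + z ∧ ‖emb b ⟨r, t, hr, hrt⟩ y‖ < c ∧
      ‖emb b ⟨t, t', hr.trans_le hrt, htt⟩ z‖ < c := by
  rw [norm_emb] at h
  obtain ⟨d, hd, hd'⟩ := exists_rep_of_seminorm_lt _ _ h
  obtain ⟨y, z, e, hy, hz⟩ := hd'.split hr hrt htt
  refine ⟨y, z, e, ?_, ?_⟩ <;> rw [norm_emb]
  · exact (seminorm_le _ _ hy).trans_lt hd
  · exact (seminorm_le _ _ hz).trans_lt hd

lemma exists_glue {r t t' : ℝ} (hr : 0 < r) (hrt : r ≤ t) (htt : t ≤ t') {f g : A} {c : ℝ}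
    (h : ‖emb b ⟨t, t, hr.trans_le hrt, le_rfl⟩ (f - g)‖ < c) :
    ∃ k, ‖emb b ⟨r, t, hr, hrt⟩ (k - f)‖ < c ∧
      ‖emb b ⟨t, t', hr.trans_le hrt, htt⟩ (k - g)‖ < c := by
  obtain ⟨y, z, e, hy, hz⟩ := exists_split hr hrt htt h
  refine ⟨f - y, ?_, ?_⟩
  · rwa [sub_sub_cancel_left, map_neg, norm_neg]
  · rwa [show f - y - g = z by linear_combination e]

lemma exists_res_add_res {r t t' : ℝ} (hr : 0 < r) (hrt : r ≤ t) (htt : t ≤ t')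
    (e : Completion (Loc b ⟨t, t, hr.trans_le hrt, le_rfl⟩)) :
    ∃ x y, res b ⟨r, t, hr, hrt⟩ ⟨t, t, hr.trans_le hrt, le_rfl⟩ hrt le_rfl x +
      res b ⟨t, t', hr.trans_le hrt, htt⟩ ⟨t, t, hr.trans_le hrt, le_rfl⟩ le_rfl htt y = e := by
  let P := Completion (Loc b ⟨r, t, hr, hrt⟩)
  let M := Completion (Loc b ⟨t, t', hr.trans_le hrt, htt⟩)
  let Wt : Radii := ⟨t, t, hr.trans_le hrt, le_rfl⟩
  let S : P × M →+ Completion (Loc b Wt) :=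
    ((res b ⟨r, t, hr, hrt⟩ Wt hrt le_rfl : P →+ _)).coprod
      (res b ⟨t, t', hr.trans_le hrt, htt⟩ Wt le_rfl htt : M →+ _)
  let F : NormedAddGroupHom (P × M) (Completion (Loc b Wt)) :=
    S.mkNormedAddGroupHom 2 fun v => by
      refine (norm_add_le _ _).trans ?_
      have h1 := norm_res_le (b := b) (W := ⟨r, t, hr, hrt⟩) (W' := Wt) hrt le_rfl v.1
      have h2 := norm_res_le (b := b) (W := ⟨t, t', hr.trans_le hrt, htt⟩) (W' := Wt) le_rfl htt v.2
      have := norm_fst_le v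
      have := norm_snd_le v
      exact (add_le_add h1 h2).trans (by linarith)
  have key : F.SurjectiveOnWith (emb b Wt : A →+ Completion (Loc b Wt)).range 2 := by
    rintro _ ⟨x, rfl⟩
    rcases eq_or_ne (emb b Wt x) 0 with h0 | h0
    · exact ⟨0, by simpa using h0.symm, by simp⟩
    · have hx : ‖emb b Wt x‖ < 2 * ‖emb b Wt x‖ := by linarith [norm_pos_iff.2 h0]
      obtain ⟨y, z, e, hy, hz⟩ := exists_split hr hrt htt hx
      refine ⟨(emb b _ y, emb b _ z), ?_, max_le hy.le hz.le⟩
      rw [e, map_add]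
      exact congrArg₂ (· + ·) (res_emb (W := ⟨r, t, hr, hrt⟩) (W' := Wt) hrt le_rfl y)
        (res_emb (W := ⟨t, t', hr.trans_le hrt, htt⟩) (W' := Wt) le_rfl htt z)
  have h3 := controlled_closure_of_complete two_pos one_pos key
  obtain ⟨g, hg, -⟩ := h3 e (denseRange_emb b Wt e)
  exact ⟨g.1, g.2, hg⟩

lemma norm_unit_zpow_le (n : ℤ) (h1 : ‖(1 : A)‖ ≤ 1) :
    ‖emb b W ↑(b ^ n)‖ ≤ W.weight n := by
  rw [norm_emb]
  have := LaurentRep.single (b := b) (W := W) 1 n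
  rw [one_mul] at this
  exact (seminorm_le _ _ this).trans (mul_le_of_le_one_left (W.weight_pos n).le h1)

lemma norm_character_le (h1 : ‖(1 : A)‖ ≤ 1) (ψ : Completion (Loc b W) →ₐ[ℂ] ℂ)
    (x : Completion (Loc b W)) : ‖ψ x‖ ≤ ‖x‖ := by
  refine (AlgHom.norm_apply_le_self_mul_norm_one ψ x).trans
    (mul_le_of_le_one_right (norm_nonneg _) ?_)
  rw [← map_one (emb b W)]
  exact (norm_emb_le b W 1).trans h1

lemma character_mem (h1 : ‖(1 : A)‖ ≤ 1) (ψ : Completion (Loc b W) →ₐ[ℂ] ℂ) :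
    W.inner ≤ ‖ψ (emb b W b)‖ ∧ ‖ψ (emb b W b)‖ ≤ W.outer := by
  have h2 := (norm_character_le h1 ψ _).trans (norm_unit_zpow_le (b := b) (W := W) 1 h1)
  have h3 := (norm_character_le h1 ψ _).trans (norm_unit_zpow_le (b := b) (W := W) (-1) h1)
  have h4 : ψ (emb b W b) * ψ (emb b W ↑b⁻¹) = 1 := by
    rw [← map_mul, ← map_mul, Units.mul_inv, map_one, map_one]
  have h5 := congrArg norm h4
  rw [norm_mul, norm_one] at h5
  simp only [zpow_one, zpow_neg_one, Radii.weight] at h2 h3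
  have hpos : 0 < ‖ψ (emb b W ↑b⁻¹)‖ :=
    (norm_nonneg _).lt_of_ne' (right_ne_zero_of_mul_eq_one h5)
  rw [max_eq_right W.inner_le] at h2
  rw [max_eq_left (inv_anti₀ W.inner_pos W.inner_le), le_inv_comm₀ hpos W.inner_pos] at h3
  refine ⟨?_, h2⟩
  rwa [← eq_inv_of_mul_eq_one_left h5] at h3

lemma exists_character (h1 : ‖(1 : A)‖ ≤ 1) [CompleteSpace A] (φ : A →ₐ[ℂ] ℂ)
    (h2 : W.inner ≤ ‖φ b‖) (h3 : ‖φ b‖ ≤ W.outer) :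
    ∃ ψ : Completion (Loc b W) →ₐ[ℂ] ℂ, ∀ x, ψ (emb b W x) = φ x := by
  have hφ : ∀ a, ‖φ a‖ ≤ ‖a‖ := fun a =>
    (AlgHom.norm_apply_le_self_mul_norm_one φ a).trans (mul_le_of_le_one_right (norm_nonneg _) h1)
  refine ⟨lift φ fun x => ?_, lift_emb φ _⟩
  refine le_of_forall_gt_imp_ge_of_dense fun c hc => ?_
  obtain ⟨d, hd, hd'⟩ := exists_rep_of_seminorm_lt b W hc
  exact (hd'.norm_apply_le φ hφ h2 h3).trans hd.le

end Loc
end Completions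

section Estimates

lemma norm_sub_one_lt_of_sq {p : ℂ} (hp : 0 < p.re) (h : ‖2 * (p * p) - 2‖ < 1 / 10) :
    ‖p - 1‖ < 1 / 20 := by
  have h1 : 1 ≤ ‖p + 1‖ := by
    have := Complex.re_le_norm (p + 1)
    simp only [Complex.add_re, Complex.one_re] at this
    linarith
  have h2 : 2 * (p * p) - 2 = 2 * ((p - 1) * (p + 1)) := by ring
  rw [h2, norm_mul, norm_mul, Complex.norm_ofNat] at h
  nlinarith [norm_nonneg (p - 1)]

lemma norm_inv_sub_one_lt {p p' : ℂ} (hp : ‖p - 1‖ < 1 / 20) (hpp : p * p' = 1) :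
    ‖p' - 1‖ < 1 / 19 := by
  have h1 : p' - 1 = -(p' * (p - 1)) := by linear_combination hpp
  have h2 : ‖p'‖ ≤ ‖p' - 1‖ + 1 := by
    simpa using norm_add_le (p' - 1) 1
  have h3 : ‖p' - 1‖ = ‖p'‖ * ‖p - 1‖ := by rw [← norm_mul, ← norm_neg, h1, neg_neg]
  nlinarith [norm_nonneg p', norm_nonneg (p - 1)]

lemma norm_mul_sub_one_le {a c : ℂ} {x y : ℝ} (ha : ‖a - 1‖ ≤ x) (hc : ‖c - 1‖ ≤ y) :
    ‖a * c - 1‖ ≤ x + y + x * y := by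
  have h1 : a * c - 1 = (a - 1) + (c - 1) + (a - 1) * (c - 1) := by ring
  rw [h1]
  refine (norm_add_le _ _).trans (add_le_add ((norm_add_le _ _).trans (add_le_add ha hc)) ?_)
  rw [norm_mul]
  exact mul_le_mul ha hc (norm_nonneg _) ((norm_nonneg _).trans ha)

lemma norm_mul_mul_sub_two_lt {p' m' d : ℂ} (hp : ‖p' - 1‖ < 1 / 19) (hm : ‖m' - 1‖ < 1 / 19)
    (hd : ‖d - 2‖ < 1 / 10) : ‖p' * (m' * d) - 2‖ < 1 / 2 := by
  have h1 := norm_mul_sub_one_le hp.le hm.le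
  have h2 : p' * (m' * d) - 2 = (p' * m') * (d - 2) + 2 * (p' * m' - 1) := by ring
  have h3 : ‖p' * m'‖ ≤ ‖p' * m' - 1‖ + 1 := by simpa using norm_add_le (p' * m' - 1) 1
  rw [h2]
  refine (norm_add_le _ _).trans_lt ?_
  rw [norm_mul (p' * m'), norm_mul 2, Complex.norm_ofNat]
  nlinarith [norm_nonneg (p' * m'), norm_nonneg (d - 2)]

lemma re_pos_of_norm_sub_two_lt {z : ℂ} (h : ‖z - 2‖ < 2) : 0 < z.re := by
  have := (abs_le.1 (Complex.abs_re_le_norm (z - 2))).1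
  simp only [Complex.sub_re, Complex.re_ofNat] at this
  linarith

lemma re_mul_pos_of_near {m z : ℂ} (hm : ‖m - 1‖ < 1 / 4) (hz : ‖z - 2‖ < 1) : 0 < (m * z).re := by
  refine re_pos_of_norm_sub_two_lt ?_
  have h2 : m * z - 2 = (m - 1) * z + (z - 2) := by ring
  have h3 : ‖z‖ ≤ ‖z - 2‖ + 2 := by simpa using norm_add_le (z - 2) 2
  rw [h2]
  refine (norm_add_le _ _).trans_lt ?_
  rw [norm_mul]
  nlinarith [norm_nonneg (m - 1), norm_nonneg z]

lemma norm_segment_sub_one_lt {p' : ℂ} {u r : ℝ} (hu : u ∈ Set.Icc (0 : ℝ) 1) (hp : ‖p' - 1‖ < r) :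
    ‖((1 - u) + u * p' : ℂ) - 1‖ < r := by
  have h1 : ((1 - u) + u * p' : ℂ) - 1 = u * (p' - 1) := by ring
  rw [h1, norm_mul, Complex.norm_real, Real.norm_of_nonneg hu.1]
  nlinarith [hu.2, norm_nonneg (p' - 1)]

lemma re_segment_sq_pos {p p' : ℂ} {u : ℝ} (hu : u ∈ Set.Icc (0 : ℝ) 1) (hp : 0 < p.re)
    (hpp : 0 < (p * p).re) (h : p * p' = 1) :
    0 < (((1 - u) + u * p' : ℂ) * (((1 - u) + u * p') * (2 * (p * p)))).re := by
  have h1 : ((1 - u) + u * p' : ℂ) * (((1 - u) + u * p') * (2 * (p * p))) =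
      2 * (((1 - u) * p + u) * ((1 - u) * p + u)) := by
    linear_combination (2 * u * (1 - u) * p * 2 + 2 * u * u * (p * p' + 1)) * h
  rw [h1]
  obtain ⟨h0, h2⟩ := hu
  simp only [Complex.mul_re, Complex.add_re, Complex.sub_re, Complex.one_re,
    Complex.ofReal_re, Complex.add_im, Complex.mul_im, Complex.sub_im, Complex.one_im,
    Complex.ofReal_im, Complex.re_ofNat, Complex.im_ofNat] at hpp ⊢
  have h3 : 0 ≤ u * (1 - u) * p.re := mul_nonneg (mul_nonneg h0 (by linarith)) hp.le
  rcases eq_or_lt_of_le h2 with rfl | h4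
  · norm_num
  · have h5 : 0 < (1 - u) * (1 - u) := by nlinarith
    nlinarith [mul_pos h5 hpp]

end Estimates

section AlgebraicStep

open Topology

variable {A P M E : Type*} [NormedCommRing A] [NormedAlgebra ℂ A]
  [NormedCommRing P] [NormedAlgebra ℂ P] [CompleteSpace P]
  [NormedCommRing M] [NormedAlgebra ℂ M] [CompleteSpace M]
  [NormedCommRing E] [NormedAlgebra ℂ E] [CompleteSpace E]

lemma continuous_dot3 {X R : Type*} [TopologicalSpace X] [CommRing R] [TopologicalSpace R]
    [IsTopologicalRing R] {f g : X → R × R × R} (hf : Continuous f) (hg : Continuous g) :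
    Continuous fun x => dot3 (f x) (g x) := by
  unfold dot3; fun_prop

lemma continuous_map3 {R S : Type*} [TopologicalSpace R] [TopologicalSpace S] {f : R → S}
    (hf : Continuous f) : Continuous (map3 f) := by
  unfold map3; fun_prop

/-- The coordinatewise extension of an algebra homomorphism, as a real linear map. -/
def map3Linear {R S : Type*} [NormedCommRing R] [NormedAlgebra ℂ R] [NormedCommRing S]
    [NormedAlgebra ℂ S] (f : R →ₐ[ℂ] S) : R × R × R →ₗ[ℝ] S × S × S where
  toFun := map3 f
  map_add' v w := by simp [map3]
  map_smul' u v := by simp only [← Complex.coe_smul, map3, Prod.smul_fst, Prod.smul_snd, map_smul,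
    RingHom.id_apply, Prod.smul_mk]

@[simp] lemma map3Linear_apply {R S : Type*} [NormedCommRing R] [NormedAlgebra ℂ R]
    [NormedCommRing S] [NormedAlgebra ℂ S] (f : R →ₐ[ℂ] S) (v : R × R × R) :
    map3Linear f v = map3 f v := rfl

lemma exists_sqrt_inverse {R : Type*} [NormedCommRing R] [NormedAlgebra ℂ R] [CompleteSpace R]
    {y : R} (hy : y ∈ posPart R) :
    ∃ s ∈ posPart R, 2 * (s * s) = y ∧ ∃ s', s * s' = 1 := by
  have h2 : (1 / 2 : ℂ) • y ∈ posPart R := fun ψ => by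
    have := hy ψ
    simp only [map_smul, smul_eq_mul, Complex.mul_re]
    norm_num
    exact this
  obtain ⟨s, hs, e⟩ := exists_sqrt h2
  refine ⟨s, hs, ?_, (isUnit_of_mem_posPart hs).exists_right_inv⟩
  rw [e, ← smul_eq_mul, ← Nat.cast_ofNat (R := R), ← map_natCast (algebraMap ℂ R),
    algebraMap_smul, smul_smul]
  norm_num

lemma exists_path_to_matched (ιP : A →ₐ[ℂ] P) (ιM : A →ₐ[ℂ] M) (α : P →ₐ[ℂ] E) (β : M →ₐ[ℂ] E)
    (hαβ : ∀ x, α (ιP x) = β (ιM x)) (hα : ∀ x, ‖α x‖ ≤ ‖x‖) (hβ : ∀ x, ‖β x‖ ≤ ‖x‖)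
    (dP : DenseRange ιP) (dM : DenseRange ιM) (dα : DenseRange α)
    (hs : ∀ e, ∃ x y, α x + β y = e)
    (hglue : ∀ (f g : A) (r : ℝ), ‖α (ιP (f - g))‖ < r → ∃ k, ‖ιP (k - f)‖ < r ∧ ‖ιM (k - g)‖ < r)
    {c g : A × A × A} (h1 : ιP (dot3 c c) ∈ posPart P)
    (h2 : ∀ ψ : M →ₐ[ℂ] ℂ, ‖ψ (ιM (dot3 g g)) - 2‖ < 1 / 10)
    (h3 : ∀ ψ : E →ₐ[ℂ] ℂ, ‖ψ (α (ιP (dot3 c c))) - 2‖ < 1 / 10)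
    (h4 : ∀ ψ : E →ₐ[ℂ] ℂ, ‖ψ (α (ιP (dot3 c g))) - 2‖ < 1 / 10) {δ : ℝ} (hδ : 0 < δ) :
    ∃ c', JoinedIn {a | ιP (dot3 a a) ∈ posPart P ∧
        ∀ ψ : E →ₐ[ℂ] ℂ, 0 < (ψ (α (ιP (dot3 a g)))).re} c c' ∧
      ∃ s ∈ posPart M, 2 * (s * s) = ιM (dot3 g g) ∧ ∃ s', s * s' = 1 ∧
        ‖map3 ιM c' - s' • map3 ιM g‖ < δ := by
  have hαc : Continuous α := AddMonoidHomClass.continuous_of_bound α 1 fun x => by simpa using hα x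
  have hβc : Continuous β := AddMonoidHomClass.continuous_of_bound β 1 fun x => by simpa using hβ x
  obtain ⟨p, hp, hp2, p', hpp⟩ := exists_sqrt_inverse h1
  have h2' : ιM (dot3 g g) ∈ posPart M := fun ψ =>
    re_pos_of_norm_sub_two_lt ((h2 ψ).trans (by norm_num))
  obtain ⟨m, hm, hm2, m', hmm⟩ := exists_sqrt_inverse h2'
  set f := p' • map3 ιP c with hf
  set G := m' • map3 ιM g with hG
  have hff : dot3 f f = 2 := by
    rw [hf, dot3_smul_left, dot3_smul_right, ← map_dot3, ← hp2]
    linear_combination 2 * (p * p' + 1) * hpp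
  have hGG : dot3 G G = 2 := by
    rw [hG, dot3_smul_left, dot3_smul_right, ← map_dot3, ← hm2]
    linear_combination 2 * (m * m' + 1) * hmm
  have hmap : ∀ (ρ : P →ₐ[ℂ] E) (x : P) v, map3 ρ (x • v) = ρ x • map3 ρ v := fun ρ x v => by
    simp [map3]
  have hmapM : ∀ (ρ : M →ₐ[ℂ] E) (x : M) v, map3 ρ (x • v) = ρ x • map3 ρ v := fun ρ x v => by
    simp [map3]
  have hg3 : map3 β (map3 ιM g) = map3 α (map3 ιP g) := by simp [map3, hαβ]
  have hpE : ∀ ψ : E →ₐ[ℂ] ℂ, ‖ψ (α p) - 1‖ < 1 / 20 := fun ψ => by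
    refine norm_sub_one_lt_of_sq (hp (ψ.comp α)) ?_
    have := h3 ψ
    rw [← hp2] at this
    simpa only [map_mul, map_ofNat] using this
  have hmE : ∀ ψ : E →ₐ[ℂ] ℂ, ‖ψ (β m) - 1‖ < 1 / 20 := fun ψ => by
    refine norm_sub_one_lt_of_sq (hm (ψ.comp β)) ?_
    have := h2 (ψ.comp β)
    rw [← hm2] at this
    simpa only [map_mul, map_ofNat, AlgHom.comp_apply] using this
  have hppE : ∀ ψ : E →ₐ[ℂ] ℂ, ψ (α p) * ψ (α p') = 1 := fun ψ => by
    rw [← map_mul, ← map_mul, hpp, map_one, map_one]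
  have hmmE : ∀ ψ : E →ₐ[ℂ] ℂ, ψ (β m) * ψ (β m') = 1 := fun ψ => by
    rw [← map_mul, ← map_mul, hmm, map_one, map_one]
  have hfG : ∀ ψ : E →ₐ[ℂ] ℂ, ‖ψ (dot3 (map3 α f) (map3 β G)) - 2‖ < 1 / 2 := fun ψ => by
    rw [hf, hG, hmap, hmapM, dot3_smul_left, dot3_smul_right, hg3, ← map_dot3, ← map_dot3,
      map_mul, map_mul]
    exact norm_mul_mul_sub_two_lt (norm_inv_sub_one_lt (hpE ψ) (hppE ψ))
      (norm_inv_sub_one_lt (hmE ψ) (hmmE ψ)) (h4 ψ)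
  obtain ⟨f₁, g', hJ, hgN, -, hfg⟩ := exists_match_unit α hαc β hβc dα hs hff hGG hfG
    (Metric.ball_mem_nhds G (half_pos hδ))
  let O : Set (P × P × P) := {a | dot3 a a ∈ posPart P ∧
    ∀ ψ : E →ₐ[ℂ] ℂ, ψ (dot3 (map3 α a) (map3 α (map3 ιP g))) ∈ {z : ℂ | 0 < z.re}}
  have hO : IsOpen O := by
    refine IsOpen.inter (isOpen_posPart.preimage (continuous_dot3 continuous_id continuous_id)) ?_
    exact (isOpen_forall_algHom (isOpen_lt continuous_const Complex.continuous_re)).preimage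
      (continuous_dot3 (continuous_map3 hαc) continuous_const)
  have hJ1 : JoinedIn O f f₁ := by
    refine hJ.mono ?_
    rintro a ⟨ha, ha'⟩
    refine ⟨?_, fun ψ => ?_⟩
    · rw [ha]
      intro ψ
      rw [map_ofNat]
      norm_num
    · have e : ψ (dot3 (map3 α a) (map3 α (map3 ιP g))) =
          ψ (β m) * ψ (dot3 (map3 α a) (map3 β G)) := by
        rw [hG, hmapM, dot3_smul_right, map_mul, ← mul_assoc, hmmE, one_mul, hg3]
      rw [e]
      exact re_mul_pos_of_near ((hmE ψ).trans (by norm_num)) (ha' ψ)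
  have hJ0 : JoinedIn O (map3 ιP c) f := by
    refine JoinedIn.ofLine
      (f := fun u : ℝ => ((1 - (u : ℂ)) • (1 : P) + (u : ℂ) • p') • map3 ιP c) ?_ ?_ ?_ ?_
    · fun_prop
    · simp
    · simp [hf]
    · rintro _ ⟨u, hu, rfl⟩
      refine ⟨fun ψ => ?_, fun ψ => ?_⟩
      · rw [dot3_smul_left, dot3_smul_right, ← map_dot3, ← hp2]
        have h5 : ψ p * ψ p' = 1 := by rw [← map_mul, hpp, map_one]
        have h6 : 0 < (ψ p * ψ p).re := by
          have := h1 ψ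
          rw [← hp2, map_mul, map_ofNat, map_mul] at this
          rw [← Complex.ofReal_ofNat, Complex.re_ofReal_mul] at this
          linarith
        simpa only [map_mul, map_add, map_smul, map_one, smul_eq_mul, mul_one, map_ofNat] using
          re_segment_sq_pos hu (hp ψ) h6 h5
      · rw [hmap, dot3_smul_left, ← map_dot3, ← map_dot3, map_mul]
        have := re_mul_pos_of_near ((norm_segment_sub_one_lt hu
          (norm_inv_sub_one_lt (hpE ψ) (hppE ψ))).trans (by norm_num))
          ((h4 ψ).trans (by norm_num))
        simpa only [map_mul, map_add, map_smul, map_one, smul_eq_mul, mul_one, map_ofNat,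
          Set.mem_ofPred_eq] using this
  obtain ⟨ε₀, hε₀, hball⟩ := Metric.isOpen_iff.1 hO f₁ hJ1.target_mem
  set ε := min (ε₀ / 3) (δ / 6) with hε
  have hε0 : 0 < ε := lt_min (by positivity) (by positivity)
  have hε1 : 3 * ε ≤ ε₀ := by have := min_le_left (ε₀ / 3) (δ / 6); linarith
  have hε2 : 3 * ε ≤ δ / 2 := by have := min_le_right (ε₀ / 3) (δ / 6); linarith
  obtain ⟨a, haJ, ha⟩ := exists_joinedIn_of_denseRange (map3Linear ιP)
    (dP.prodMap (dP.prodMap dP)) hO (v₀ := c) (hJ0.trans hJ1) hε0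
  obtain ⟨b, hb⟩ := (dM.prodMap (dM.prodMap dM)).exists_dist_lt g' hε0
  have key : ∀ (x y : A) (x' : P) (y' : M), α x' = β y' → dist (ιP x) x' < ε →
      dist y' (ιM y) < ε → ∃ k, dist (ιP k) (ιP x) < 2 * ε ∧ dist (ιM k) (ιM y) < 2 * ε := by
    intro x y x' y' he hx hy
    obtain ⟨k, hk1, hk2⟩ := hglue x y (2 * ε) (by
      have e : α (ιP (x - y)) = α (ιP x - x') + β (y' - ιM y) := by
        rw [map_sub, map_sub, map_sub, map_sub, hαβ y, he]; ring
      rw [e]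
      refine (norm_add_le _ _).trans_lt ?_
      rw [dist_eq_norm] at hx hy
      linarith [hα (ιP x - x'), hβ (y' - ιM y)])
    refine ⟨k, ?_, ?_⟩
    · rwa [dist_eq_norm, ← map_sub]
    · rwa [dist_eq_norm, ← map_sub]
  have ha1 : dist (ιP a.1) f₁.1 < ε ∧ dist (ιP a.2.1) f₁.2.1 < ε ∧ dist (ιP a.2.2) f₁.2.2 < ε := by
    have := ha
    rw [map3Linear_apply] at this
    rw [Prod.dist_eq, Prod.dist_eq, max_lt_iff, max_lt_iff] at this
    exact this
  have hb1 : dist g'.1 (ιM b.1) < ε ∧ dist g'.2.1 (ιM b.2.1) < ε ∧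
      dist g'.2.2 (ιM b.2.2) < ε := by
    have := hb
    rw [Prod.dist_eq, Prod.dist_eq, max_lt_iff, max_lt_iff] at this
    exact this
  have hfg1 : α f₁.1 = β g'.1 ∧ α f₁.2.1 = β g'.2.1 ∧ α f₁.2.2 = β g'.2.2 := by
    simpa [map3] using hfg
  obtain ⟨k₁, hk₁, hl₁⟩ := key _ _ _ _ hfg1.1 ha1.1 hb1.1
  obtain ⟨k₂, hk₂, hl₂⟩ := key _ _ _ _ hfg1.2.1 ha1.2.1 hb1.2.1
  obtain ⟨k₃, hk₃, hl₃⟩ := key _ _ _ _ hfg1.2.2 ha1.2.2 hb1.2.2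
  have hkP : dist (map3 ιP (k₁, k₂, k₃)) (map3 ιP a) < 2 * ε :=
    max_lt hk₁ (max_lt hk₂ hk₃)
  have hkM : dist (map3 ιM (k₁, k₂, k₃)) (map3 ιM b) < 2 * ε :=
    max_lt hl₁ (max_lt hl₂ hl₃)
  refine ⟨(k₁, k₂, k₃), ?_, m, hm, hm2, m', hmm, ?_⟩
  · have hsub : JoinedIn (map3Linear ιP ⁻¹' O) a (k₁, k₂, k₃) := by
      refine JoinedIn.of_segment_subset ?_
      have hconv : Convex ℝ (map3Linear ιP ⁻¹' Metric.ball f₁ ε₀) :=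
        (convex_ball f₁ ε₀).linear_preimage _
      refine (hconv.segment_subset ?_ ?_).trans (Set.preimage_mono hball)
      · exact Metric.mem_ball.2 (ha.trans_le (by linarith))
      · refine Metric.mem_ball.2 ?_
        have h5 := dist_triangle (map3 ιP (k₁, k₂, k₃)) (map3 ιP a) f₁
        rw [map3Linear_apply] at ha ⊢
        linarith
    refine (haJ.trans hsub).mono ?_
    rintro v ⟨hv, hv'⟩
    rw [map3Linear_apply, ← map_dot3] at hv
    refine ⟨hv, fun ψ => ?_⟩
    have := hv' ψ
    change 0 < (ψ (dot3 (map3 α (map3 ιP v)) (map3 α (map3 ιP g)))).re at this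
    rwa [← map_dot3, ← map_dot3] at this
  · rw [← dist_eq_norm]
    have hb' : dist g' (map3 ιM b) < ε := hb
    have h8 := Metric.mem_ball.1 hgN
    have h9 := dist_triangle (map3 ιM (k₁, k₂, k₃)) (map3 ιM b) G
    have h10 := dist_triangle (map3 ιM b) g' G
    rw [dist_comm (map3 ιM b) g'] at h10
    linarith

/-- Enlarging the annulus on which a triple is close to a given one. -/
lemma exists_annulus_step [CompleteSpace A] (hone : ‖(1 : A)‖ ≤ 1) (b : Aˣ) {r t t' : ℝ}
    (hr : 0 < r) (hrt : r ≤ t) (htt : t ≤ t') {c g : A × A × A}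
    (h1 : ∀ φ : A →ₐ[ℂ] ℂ, r ≤ ‖φ b‖ → ‖φ b‖ ≤ t → 0 < (φ (dot3 c c)).re)
    (h2 : ∀ φ : A →ₐ[ℂ] ℂ, t ≤ ‖φ b‖ → ‖φ b‖ ≤ t' → ‖φ (dot3 g g) - 2‖ < 1 / 10)
    (h3 : ∀ φ : A →ₐ[ℂ] ℂ, ‖φ b‖ = t → ‖φ (dot3 c c) - 2‖ < 1 / 10)
    (h4 : ∀ φ : A →ₐ[ℂ] ℂ, ‖φ b‖ = t → ‖φ (dot3 c g) - 2‖ < 1 / 10) {δ : ℝ} (hδ : 0 < δ) :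
    ∃ c', JoinedIn {a | (∀ φ : A →ₐ[ℂ] ℂ, r ≤ ‖φ b‖ → ‖φ b‖ ≤ t → 0 < (φ (dot3 a a)).re) ∧
        ∀ φ : A →ₐ[ℂ] ℂ, ‖φ b‖ = t → 0 < (φ (dot3 a g)).re} c c' ∧
      ∀ φ : A →ₐ[ℂ] ℂ, t ≤ ‖φ b‖ → ‖φ b‖ ≤ t' → ∃ s s' : ℂ, 0 < s.re ∧
        2 * (s * s) = φ (dot3 g g) ∧ s * s' = 1 ∧ ‖map3 φ c' - s' • map3 φ g‖ < δ := by
  let WP : Radii := ⟨r, t, hr, hrt⟩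
  let WM : Radii := ⟨t, t', hr.trans_le hrt, htt⟩
  let WE : Radii := ⟨t, t, hr.trans_le hrt, le_rfl⟩
  have eP : ∀ x, Loc.res b WP WE hrt le_rfl (Loc.emb b WP x) = Loc.emb b WE x :=
    Loc.res_emb (W := WP) (W' := WE) hrt le_rfl
  have eM : ∀ x, Loc.res b WM WE le_rfl htt (Loc.emb b WM x) = Loc.emb b WE x :=
    Loc.res_emb (W := WM) (W' := WE) le_rfl htt
  have hE : ∀ ψ : UniformSpace.Completion (Loc b WE) →ₐ[ℂ] ℂ,
      ‖(ψ.comp (Loc.emb b WE)) b‖ = t := fun ψ => by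
    obtain ⟨h5, h6⟩ := Loc.character_mem hone ψ
    exact le_antisymm h6 h5
  obtain ⟨c', hJ, s, hs, hs2, s', hss, hc'⟩ := exists_path_to_matched (Loc.emb b WP) (Loc.emb b WM)
    (Loc.res b WP WE hrt le_rfl) (Loc.res b WM WE le_rfl htt) (fun x => by rw [eP, eM])
    (Loc.norm_res_le (W := WP) (W' := WE) hrt le_rfl)
    (Loc.norm_res_le (W := WM) (W' := WE) le_rfl htt)
    (Loc.denseRange_emb b WP) (Loc.denseRange_emb b WM)
    (Loc.denseRange_res (W := WP) (W' := WE) hrt le_rfl)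
    (Loc.exists_res_add_res hr hrt htt) (fun f g ρ h => by
      rw [eP] at h
      exact Loc.exists_glue hr hrt htt h) (c := c) (g := g)
    (fun ψ => h1 (ψ.comp (Loc.emb b WP)) (Loc.character_mem hone ψ).1 (Loc.character_mem hone ψ).2)
    (fun ψ => h2 (ψ.comp (Loc.emb b WM)) (Loc.character_mem hone ψ).1 (Loc.character_mem hone ψ).2)
    (fun ψ => by rw [eP]; exact h3 (ψ.comp (Loc.emb b WE)) (hE ψ))
    (fun ψ => by rw [eP]; exact h4 (ψ.comp (Loc.emb b WE)) (hE ψ)) hδ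
  refine ⟨c', hJ.mono ?_, ?_⟩
  · rintro a ⟨ha1, ha2⟩
    refine ⟨fun φ h5 h6 => ?_, fun φ h5 => ?_⟩
    · obtain ⟨ψ, hψ⟩ := Loc.exists_character (W := WP) hone φ h5 h6
      rw [← hψ]
      exact ha1 ψ
    · obtain ⟨ψ, hψ⟩ := Loc.exists_character (W := WE) hone φ h5.ge h5.le
      have := ha2 ψ
      rwa [eP, hψ] at this
  · intro φ h5 h6
    obtain ⟨ψ, hψ⟩ := Loc.exists_character (W := WM) hone φ h5 h6
    have hm : ∀ v : A × A × A, map3 φ v = map3 ψ (map3 (Loc.emb b WM) v) := fun v => by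
      simp only [map3, hψ]
    refine ⟨ψ s, ψ s', hs ψ, ?_, ?_, ?_⟩
    · rw [← hψ, ← hs2, map_mul, map_mul, map_ofNat]
    · rw [← map_mul, hss, map_one]
    · refine lt_of_le_of_lt ?_ hc'
      have e : map3 φ c' - ψ s' • map3 φ g =
          map3 ψ (map3 (Loc.emb b WM) c' - s' • map3 (Loc.emb b WM) g) := by
        rw [hm, hm]
        simp [map3]
      rw [e]
      exact max_le_max (Loc.norm_character_le hone ψ _)
        (max_le_max (Loc.norm_character_le hone ψ _) (Loc.norm_character_le hone ψ _))

end AlgebraicStep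

section LocalAlgebra

open Topology

variable {X : Type*} [TopologicalSpace X] [CompactSpace X]

/-- Every character of the function algebra is an evaluation. -/
def IsFull (A : Subalgebra ℂ C(X, ℂ)) : Prop :=
  ∀ ψ : A →ₐ[ℂ] ℂ, ∃ x, ∀ f : A, ψ f = (f : C(X, ℂ)) x

lemma norm_one_subalgebra_le (A : Subalgebra ℂ C(X, ℂ)) : ‖(1 : A)‖ ≤ 1 :=
  (ContinuousMap.norm_le _ zero_le_one).2 fun x => by simp

lemma norm_algHom_le {A : Subalgebra ℂ C(X, ℂ)} (hA : IsClosed (A : Set C(X, ℂ)))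
    (ψ : A →ₐ[ℂ] ℂ) (f : A) : ‖ψ f‖ ≤ ‖f‖ := by
  have : CompleteSpace A := hA.completeSpace_coe
  exact (AlgHom.norm_apply_le_self_mul_norm_one ψ f).trans
    (mul_le_of_le_one_right (norm_nonneg _) (norm_one_subalgebra_le A))

/-- The evaluation at a point, as a character of a function algebra. -/
noncomputable def evalHom (A : Subalgebra ℂ C(X, ℂ)) (x : X) : A →ₐ[ℂ] ℂ :=
  (ContinuousMap.evalAlgHom ℂ ℂ x).comp A.val

@[simp] lemma evalHom_apply (A : Subalgebra ℂ C(X, ℂ)) (x : X) (f : A) :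
    evalHom A x f = (f : C(X, ℂ)) x := rfl

lemma IsFull.isUnit {A : Subalgebra ℂ C(X, ℂ)} (hA : IsFull A) (hc : IsClosed (A : Set C(X, ℂ)))
    {b : A} (hb : ∀ x, (b : C(X, ℂ)) x ≠ 0) : IsUnit b := by
  have : CompleteSpace A := hc.completeSpace_coe
  refine isUnit_of_forall_algHom fun ψ => ?_
  obtain ⟨x, hx⟩ := hA ψ
  rw [hx]
  exact hb x

/-- Functions that near every level set of `h` can be approximated by elements of `A`. -/
def locAlg (A : Subalgebra ℂ C(X, ℂ)) (h : C(X, ℝ)) : Subalgebra ℂ C(X, ℂ) where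
  carrier := {f | ∀ δ > (0 : ℝ), ∀ t : ℝ, ∃ η > (0 : ℝ), ∃ g ∈ A, ∀ x, |h x - t| < η →
    ‖f x - g x‖ < δ}
  algebraMap_mem' z δ hδ t := ⟨1, one_pos, _, A.algebraMap_mem z, fun x _ => by simpa using hδ⟩
  add_mem' {f f'} hf hf' δ hδ t := by
    obtain ⟨η, hη, g, hg, H⟩ := hf (δ / 2) (half_pos hδ) t
    obtain ⟨η', hη', g', hg', H'⟩ := hf' (δ / 2) (half_pos hδ) t
    refine ⟨min η η', lt_min hη hη', g + g', A.add_mem hg hg', fun x hx => ?_⟩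
    have h1 := H x (hx.trans_le (min_le_left _ _))
    have h2 := H' x (hx.trans_le (min_le_right _ _))
    have e : (f + f') x - (g + g') x = (f x - g x) + (f' x - g' x) := by
      simp only [ContinuousMap.add_apply]; ring
    rw [e]
    linarith [norm_add_le (f x - g x) (f' x - g' x)]
  mul_mem' {f f'} hf hf' δ hδ t := by
    set C := ‖f‖ + ‖f'‖ + 1 with hC
    have hC0 : 0 < C := by positivity
    set ε := min 1 (δ / (2 * C)) with hε
    have hε0 : 0 < ε := lt_min one_pos (by positivity)
    have hε1 : ε ≤ 1 := min_le_left _ _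
    have hε2 : 2 * C * ε ≤ δ := by
      have : ε ≤ δ / (2 * C) := min_le_right _ _
      rwa [le_div_iff₀ (by positivity), mul_comm] at this
    obtain ⟨η, hη, g, hg, H⟩ := hf ε hε0 t
    obtain ⟨η', hη', g', hg', H'⟩ := hf' ε hε0 t
    refine ⟨min η η', lt_min hη hη', g * g', A.mul_mem hg hg', fun x hx => ?_⟩
    have h1 := H x (hx.trans_le (min_le_left _ _))
    have h2 := H' x (hx.trans_le (min_le_right _ _))
    have e : (f * f') x - (g * g') x =
        (f x - g x) * f' x + (f x - (f x - g x)) * (f' x - g' x) := by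
      simp only [ContinuousMap.mul_apply]; ring
    have h3 := f.norm_coe_le_norm x
    have h4 := f'.norm_coe_le_norm x
    have h5 := norm_sub_le (f x) (f x - g x)
    rw [e]
    refine (norm_add_le _ _).trans_lt ?_
    rw [norm_mul, norm_mul]
    have h6 : ‖f x - g x‖ * ‖f' x‖ ≤ ε * ‖f'‖ :=
      mul_le_mul h1.le h4 (norm_nonneg _) hε0.le
    have h7 : ‖f x - (f x - g x)‖ * ‖f' x - g' x‖ ≤ (‖f‖ + 1) * ε :=
      mul_le_mul (by linarith) h2.le (norm_nonneg _) (by positivity)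
    nlinarith [norm_nonneg f, norm_nonneg f']

lemma le_locAlg (A : Subalgebra ℂ C(X, ℂ)) (h : C(X, ℝ)) : A ≤ locAlg A h :=
  fun f hf _ hδ _ => ⟨1, one_pos, f, hf, fun x _ => by simpa using hδ⟩

lemma comp_mem_locAlg (A : Subalgebra ℂ C(X, ℂ)) (h : C(X, ℝ)) (k : C(ℝ, ℂ)) :
    k.comp h ∈ locAlg A h := fun δ hδ t => by
  obtain ⟨η, hη, H⟩ := Metric.continuous_iff.1 k.continuous t δ hδ
  refine ⟨η, hη, algebraMap ℂ _ (k t), A.algebraMap_mem _, fun x hx => ?_⟩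
  simpa [dist_eq_norm] using H (h x) hx

lemma isClosed_locAlg (A : Subalgebra ℂ C(X, ℂ)) (h : C(X, ℝ)) :
    IsClosed (locAlg A h : Set C(X, ℂ)) := by
  refine isClosed_of_closure_subset fun f hf δ hδ t => ?_
  obtain ⟨f', hf', hd⟩ := Metric.mem_closure_iff.1 hf (δ / 2) (half_pos hδ)
  obtain ⟨η, hη, g, hg, H⟩ := hf' (δ / 2) (half_pos hδ) t
  refine ⟨η, hη, g, hg, fun x hx => ?_⟩
  have h1 := H x hx
  have h2 := ContinuousMap.dist_apply_le_dist (f := f) (g := f') x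
  rw [dist_eq_norm] at h2
  have h3 := norm_add_le (f x - f' x) (f' x - g x)
  rw [sub_add_sub_cancel] at h3
  linarith

/-- The absolute value of a function. -/
noncomputable def absMap (b : C(X, ℂ)) : C(X, ℝ) := ⟨fun x => ‖b x‖, by fun_prop⟩

@[simp] lemma absMap_apply (b : C(X, ℂ)) (x : X) : absMap b x = ‖b x‖ := rfl

/-- A real function, as a complex function. -/
noncomputable def realMap (h : C(X, ℝ)) : C(X, ℂ) := ⟨fun x => (h x : ℂ), by fun_prop⟩

@[simp] lemma realMap_apply (h : C(X, ℝ)) (x : X) : realMap h x = (h x : ℂ) := rfl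

lemma realMap_mem_locAlg (A : Subalgebra ℂ C(X, ℂ)) (h : C(X, ℝ)) : realMap h ∈ locAlg A h :=
  comp_mem_locAlg A h ⟨fun y => (y : ℂ), by fun_prop⟩

lemma exists_bounds (b : C(X, ℂ)) (hb : ∀ x, b x ≠ 0) :
    ∃ r R : ℝ, 0 < r ∧ r ≤ R ∧ ∀ x, r < ‖b x‖ ∧ ‖b x‖ < R := by
  obtain ⟨r, hr, hr'⟩ : ∃ r > (0 : ℝ), ∀ x, r < ‖b x‖ := by
    rcases isEmpty_or_nonempty X with hX | hX
    · exact ⟨1, one_pos, fun x => isEmptyElim x⟩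
    · obtain ⟨x, -, hx⟩ := isCompact_univ.exists_isMinOn Set.univ_nonempty
        (absMap b).continuous.continuousOn
      refine ⟨‖b x‖ / 2, half_pos (norm_pos_iff.2 (hb x)), fun y => ?_⟩
      have h1 : ‖b x‖ ≤ ‖b y‖ := hx (Set.mem_univ y)
      linarith [norm_pos_iff.2 (hb x)]
  refine ⟨r, max r (‖b‖ + 1), hr, le_max_left _ _, fun x => ⟨hr' x, ?_⟩⟩
  exact lt_max_of_lt_right ((b.norm_coe_le_norm x).trans_lt (lt_add_one _))

lemma exists_eval_level {A : Subalgebra ℂ C(X, ℂ)} {h : C(X, ℝ)} {r R : ℝ} (hrR : r ≤ R)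
    (hh : ∀ x, h x ∈ Set.Icc r R) (ψ : locAlg A h →ₐ[ℂ] ℂ) :
    ∃ ρ ∈ Set.Icc r R, ∀ k : C(ℝ, ℂ), ψ ⟨k.comp h, comp_mem_locAlg A h k⟩ = k ρ := by
  let hK : C(X, Set.Icc r R) := ⟨fun x => ⟨h x, hh x⟩, by fun_prop⟩
  have hmem : ∀ k : C(Set.Icc r R, ℂ), k.comp hK ∈ locAlg A h := fun k => by
    have := comp_mem_locAlg A h (ContinuousMap.IccExtend hrR k)
    convert this using 1
    ext x
    simp [hK, Set.IccExtend_of_mem _ _ (hh x)]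
  let χ : C(Set.Icc r R, ℂ) →ₐ[ℂ] ℂ :=
    ψ.comp ((ContinuousMap.compRightAlgHom ℂ ℂ hK).codRestrict (locAlg A h) hmem)
  obtain ⟨ρ, hρ⟩ := (CharacterSpace.homeoEval (Set.Icc r R) ℂ).surjective
    (CharacterSpace.equivAlgHom.symm χ)
  refine ⟨ρ, ρ.2, fun k => ?_⟩
  have h1 := DFunLike.congr_fun hρ (k.comp ⟨Subtype.val, continuous_subtype_val⟩)
  refine Eq.trans ?_ h1.symm
  rfl

lemma isFull_locAlg {A : Subalgebra ℂ C(X, ℂ)} (hA : IsFull A) (hc : IsClosed (A : Set C(X, ℂ)))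
    {b : C(X, ℂ)} (hbA : b ∈ A) (hb : ∀ x, b x ≠ 0) : IsFull (locAlg A (absMap b)) := by
  obtain ⟨h, hh⟩ : ∃ h, h = absMap b := ⟨_, rfl⟩
  rw [← hh]
  intro ψ
  obtain ⟨r, R, hr, hrR, hb'⟩ := exists_bounds b hb
  obtain ⟨ρ, hρ, hψ⟩ := exists_eval_level (A := A) (h := h) hrR
    (fun x => by rw [hh]; exact ⟨(hb' x).1.le, (hb' x).2.le⟩) ψ
  obtain ⟨x₀, hx₀⟩ := hA (ψ.comp (Subalgebra.inclusion (le_locAlg A h)))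
  have hρ0 : 0 < ρ := hr.trans_le hρ.1
  have hcl := isClosed_locAlg A h
  obtain ⟨b', hb'1⟩ := (hA.isUnit hc (b := ⟨b, hbA⟩) hb).exists_right_inv
  have hbx : ∀ x, b x * (b' : C(X, ℂ)) x = 1 := fun x =>
    congrArg (fun f : A => (f : C(X, ℂ)) x) hb'1
  have hlevel : h x₀ = ρ := by
    have hle : ∀ (f : C(X, ℂ)) (hf : f ∈ A) (k : C(ℝ, ℂ)), (∀ x, ‖f x * k (h x)‖ ≤ 1) →
        ‖f x₀‖ * ‖k ρ‖ ≤ 1 := fun f hf k hk => by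
      have h1 := norm_algHom_le hcl ψ
        (⟨f, le_locAlg A h hf⟩ * ⟨k.comp h, comp_mem_locAlg A h k⟩)
      rw [map_mul, hψ, norm_mul] at h1
      have h2 : ψ ⟨f, le_locAlg A h hf⟩ = f x₀ := hx₀ ⟨f, hf⟩
      rw [h2] at h1
      exact h1.trans ((ContinuousMap.norm_le _ zero_le_one).2 hk)
    have h1 := hle b hbA ⟨fun y => ((max r y : ℝ) : ℂ)⁻¹, by
      refine Continuous.inv₀ (by fun_prop) fun y => ?_
      exact_mod_cast (hr.trans_le (le_max_left r y)).ne'⟩ fun x => by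
        have h3 : max r ‖b x‖ = ‖b x‖ := max_eq_right (hb' x).1.le
        simp [hh, h3, hb x]
    have h2 := hle b' b'.2 ⟨fun y => (y : ℂ), by fun_prop⟩ fun x => by
      have := congrArg norm (hbx x)
      rw [norm_mul, norm_one, mul_comm] at this
      simp [hh, this]
    have h3 := congrArg norm (hbx x₀)
    rw [norm_mul, norm_one] at h3
    simp only [ContinuousMap.coe_mk, norm_inv, Complex.norm_real, Real.norm_eq_abs,
      abs_of_pos hρ0, max_eq_right hρ.1] at h1 h2
    rw [← div_eq_mul_inv, div_le_one hρ0] at h1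
    rw [hh, absMap_apply]
    refine le_antisymm h1 ?_
    have h4 : 0 < ‖b x₀‖ := norm_pos_iff.2 (hb x₀)
    nlinarith
  refine ⟨x₀, fun f => ?_⟩
  refine eq_of_forall_dist_le fun ε hε => ?_
  obtain ⟨η, hη, g, hg, H⟩ := f.2 (ε / 2) (half_pos hε) ρ
  let k : C(ℝ, ℂ) := ⟨fun y => ((max 0 (1 - |y - ρ| / η) : ℝ) : ℂ), by fun_prop⟩
  have hkρ : k ρ = 1 := by simp [k]
  have h1 := norm_algHom_le hcl ψ
    ((f - ⟨g, le_locAlg A h hg⟩) * ⟨k.comp h, comp_mem_locAlg A h k⟩)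
  have h2 : ψ ⟨g, le_locAlg A h hg⟩ = g x₀ := hx₀ ⟨g, hg⟩
  rw [map_mul, hψ, hkρ, mul_one, map_sub, h2] at h1
  have h3 := H x₀ (by rw [hlevel]; simpa using hη)
  have h4 : ‖(f - ⟨g, le_locAlg A h hg⟩) * ⟨k.comp h, comp_mem_locAlg A h k⟩‖ ≤ ε / 2 := by
    refine (ContinuousMap.norm_le _ (half_pos hε).le).2 fun x => ?_
    change ‖((f : C(X, ℂ)) x - g x) * ((max 0 (1 - |h x - ρ| / η) : ℝ) : ℂ)‖ ≤ _
    rw [norm_mul, Complex.norm_real, Real.norm_of_nonneg (le_max_left _ _)]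
    rcases lt_or_ge (|h x - ρ|) η with hx | hx
    · have h5 : max 0 (1 - |h x - ρ| / η) ≤ 1 :=
        max_le zero_le_one (sub_le_self _ (by positivity))
      calc _ ≤ ε / 2 * 1 := mul_le_mul (H x hx).le h5 (le_max_left _ _) (half_pos hε).le
        _ = _ := mul_one _
    · rw [max_eq_left (sub_nonpos.2 ((one_le_div hη).2 hx)), mul_zero]
      exact (half_pos hε).le
  rw [dist_eq_norm]
  have h5 := norm_sub_le (ψ f - g x₀) ((f : C(X, ℂ)) x₀ - g x₀)
  rw [sub_sub_sub_cancel_right] at h5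
  linarith

end LocalAlgebra

section ReDot

/-- The real part of the trace form. -/
noncomputable def reDot (a b : ℂ × ℂ × ℂ) : ℝ := (dot3 a b).re

/-- The convex combination of two complex triples. -/
noncomputable def mix (u : ℝ) (a b : ℂ × ℂ × ℂ) : ℂ × ℂ × ℂ := (1 - (u : ℂ)) • a + (u : ℂ) • b

lemma reDot_comm (a b : ℂ × ℂ × ℂ) : reDot a b = reDot b a := by
  rw [reDot, dot3_comm, reDot]

lemma reDot_mix_left (u : ℝ) (a b c : ℂ × ℂ × ℂ) :
    reDot (mix u a b) c = (1 - u) * reDot a c + u * reDot b c := by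
  simp only [reDot, mix, dot3_add_left, dot3_smul_left, Complex.add_re, Complex.mul_re,
    Complex.sub_re, Complex.sub_im, Complex.one_re, Complex.one_im, Complex.ofReal_re,
    Complex.ofReal_im]
  ring

@[simp] lemma mix_zero (a b : ℂ × ℂ × ℂ) : mix 0 a b = a := by simp [mix]

@[simp] lemma mix_one (a b : ℂ × ℂ × ℂ) : mix 1 a b = b := by simp [mix]

lemma reDot_mix_pos {u : ℝ} (hu : u ∈ Set.Icc (0 : ℝ) 1) {a b c : ℂ × ℂ × ℂ}
    (ha : 0 < reDot a c) (hb : u ≠ 0 → 0 < reDot b c) : 0 < reDot (mix u a b) c := by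
  rw [reDot_mix_left]
  rcases eq_or_ne u 0 with rfl | h0
  · simpa using ha
  · have h1 : 0 < u := lt_of_le_of_ne hu.1 h0.symm
    have := mul_pos h1 (hb h0)
    have h2 := mul_nonneg (sub_nonneg.2 hu.2) ha.le
    linarith

lemma reDot_mix_self_pos {u : ℝ} (hu : u ∈ Set.Icc (0 : ℝ) 1) {a b : ℂ × ℂ × ℂ}
    (ha : 0 < reDot a a) (hb : u ≠ 0 → 0 < reDot b b) (hab : u ≠ 0 → 0 < reDot a b) :
    0 < reDot (mix u a b) (mix u a b) := by
  refine reDot_mix_pos hu ?_ fun h => ?_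
  · rw [reDot_comm]
    exact reDot_mix_pos hu ha fun h => by rw [reDot_comm]; exact hab h
  · rw [reDot_comm]
    exact reDot_mix_pos hu (hab h) fun _ => hb h

lemma norm_dot3_le (a b : ℂ × ℂ × ℂ) : ‖dot3 a b‖ ≤ 4 * ‖a‖ * ‖b‖ := by
  have h1 : ∀ c : ℂ × ℂ × ℂ, ‖c.1‖ ≤ ‖c‖ ∧ ‖c.2.1‖ ≤ ‖c‖ ∧ ‖c.2.2‖ ≤ ‖c‖ := fun c =>
    ⟨norm_fst_le c, (norm_fst_le c.2).trans (norm_snd_le c),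
      (norm_snd_le c.2).trans (norm_snd_le c)⟩
  obtain ⟨a1, a2, a3⟩ := h1 a
  obtain ⟨b1, b2, b3⟩ := h1 b
  unfold dot3
  refine (norm_add₃_le).trans ?_
  simp only [norm_mul, Complex.norm_ofNat]
  have e1 := mul_le_mul a1 b1 (norm_nonneg _) (norm_nonneg _)
  have e2 := mul_le_mul a2 b3 (norm_nonneg _) (norm_nonneg _)
  have e3 := mul_le_mul a3 b2 (norm_nonneg _) (norm_nonneg _)
  linarith

lemma norm_dot3_sub_two_le {v a b : ℂ × ℂ × ℂ} {C η : ℝ} (hv : dot3 v v = 2) (hC : ‖v‖ ≤ C)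
    (hη : η ≤ 1) (ha : ‖a - v‖ ≤ η) (hb : ‖b - v‖ ≤ η) :
    ‖dot3 a b - 2‖ ≤ 8 * (C + 1) * η := by
  have e : dot3 a b - 2 = dot3 (a - v) b + dot3 v (b - v) := by
    rw [← hv]; simp only [dot3, Prod.fst_sub, Prod.snd_sub]; ring
  have hη0 : 0 ≤ η := (norm_nonneg _).trans ha
  have hb' : ‖b‖ ≤ C + 1 := by
    have := norm_add_le (b - v) v
    rw [sub_add_cancel] at this
    linarith
  rw [e]
  refine (norm_add_le _ _).trans ((add_le_add (norm_dot3_le _ _) (norm_dot3_le _ _)).trans ?_)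
  have h1 := mul_le_mul ha hb' (norm_nonneg _) hη0
  have h2 := mul_le_mul hC hb (norm_nonneg _) ((norm_nonneg _).trans hC)
  nlinarith

lemma norm_mix_sub_le {u : ℝ} (hu : u ∈ Set.Icc (0 : ℝ) 1) {a b v : ℂ × ℂ × ℂ} {η : ℝ}
    (ha : ‖a - v‖ ≤ η) (hb : ‖b - v‖ ≤ η) : ‖mix u a b - v‖ ≤ η := by
  have e : mix u a b - v = (1 - (u : ℂ)) • (a - v) + (u : ℂ) • (b - v) := by
    rw [mix]; module
  rw [e]
  refine (norm_add_le _ _).trans ?_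
  rw [norm_smul, norm_smul, ← Complex.ofReal_one, ← Complex.ofReal_sub, Complex.norm_real,
    Complex.norm_real, Real.norm_of_nonneg hu.1, Real.norm_of_nonneg (sub_nonneg.2 hu.2)]
  have h1 := mul_le_mul_of_nonneg_left ha (sub_nonneg.2 hu.2)
  have h2 := mul_le_mul_of_nonneg_left hb hu.1
  linarith

lemma reDot_pos_of_near {v a b : ℂ × ℂ × ℂ} {C δ : ℝ} (hv : dot3 v v = 2) (hC : ‖v‖ ≤ C)
    (hδ : 160 * (C + 1) * δ = 1) (ha : ‖a - v‖ ≤ δ) (hb : ‖b - v‖ ≤ δ) :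
    ‖dot3 a b - 2‖ < 1 / 10 ∧ 0 < reDot a b := by
  have hδ0 : 0 ≤ δ := (norm_nonneg _).trans ha
  have hC0 : 0 ≤ C := (norm_nonneg _).trans hC
  have h1 := norm_dot3_sub_two_le hv hC (by nlinarith) ha hb
  have h2 : ‖dot3 a b - 2‖ < 1 / 10 := by linarith
  exact ⟨h2, re_pos_of_norm_sub_two_lt (by linarith)⟩

/-- A triple close to a normalised `g` is close to a reference triple close to `g`. -/
lemma norm_sub_lt_of_normalised {v g c : ℂ × ℂ × ℂ} {C δ₁ δ : ℝ} (hv : dot3 v v = 2)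
    (hC : ‖v‖ ≤ C) (hδ : 160 * (C + 1) * δ = 1) (hδ₁ : 12 * (C + 1) ^ 2 * δ₁ = δ)
    (hg : ‖g - v‖ ≤ δ₁) {s s' : ℂ} (hs : 0 < s.re) (hsg : 2 * (s * s) = dot3 g g)
    (hss : s * s' = 1) (hc : ‖c - s' • g‖ < δ / 2) : ‖c - v‖ < δ := by
  have hδ0 : 0 ≤ δ₁ := (norm_nonneg _).trans hg
  have hC0 : 0 ≤ C := (norm_nonneg _).trans hC
  have hδδ : δ₁ ≤ δ := by
    nlinarith [mul_nonneg hC0 hδ0, mul_nonneg (mul_nonneg hC0 hC0) hδ0]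
  have hδ1 : δ ≤ 1 := by nlinarith
  have h1 := norm_dot3_sub_two_le hv hC (hδδ.trans hδ1) hg hg
  rw [← hsg] at h1
  have h1' : ‖2 * (s * s) - 2‖ < 1 / 10 := by nlinarith
  have h2 := norm_sub_one_lt_of_sq hs h1'
  have h3 := norm_inv_sub_one_lt h2 hss
  have h4 : 1 ≤ ‖s + 1‖ := by
    have := Complex.re_le_norm (s + 1)
    rw [Complex.add_re, Complex.one_re] at this
    linarith
  have h5 : ‖s - 1‖ ≤ 4 * (C + 1) * δ₁ := by
    have e : 2 * (s * s) - 2 = 2 * ((s - 1) * (s + 1)) := by ring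
    rw [e, norm_mul, norm_mul, Complex.norm_ofNat] at h1
    nlinarith [norm_nonneg (s - 1)]
  have h6 : ‖s' - 1‖ ≤ 5 * (C + 1) * δ₁ := by
    have e : s' - 1 = -(s' * (s - 1)) := by linear_combination hss
    have h7 : ‖s'‖ ≤ 5 / 4 := by
      have := norm_add_le (s' - 1) 1
      rw [sub_add_cancel, norm_one] at this
      linarith
    rw [e, norm_neg, norm_mul]
    have := mul_le_mul h7 h5 (norm_nonneg _) (by norm_num)
    linarith
  have h8 : ‖g‖ ≤ C + 1 := by
    have := norm_add_le (g - v) v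
    rw [sub_add_cancel] at this
    linarith
  have e : c - v = (c - s' • g) + ((s' - 1) • g + (g - v)) := by module
  rw [e]
  have h9 := norm_add_le (c - s' • g) ((s' - 1) • g + (g - v))
  have h10 := norm_add_le ((s' - 1) • g) (g - v)
  rw [norm_smul] at h10
  have h11 := mul_le_mul h6 h8 (norm_nonneg _) (by positivity)
  nlinarith [mul_nonneg hC0 hδ0, mul_nonneg (mul_nonneg hC0 hC0) hδ0]

end ReDot

section Fields

lemma exists_normalised_triple {R : Type*} [NormedCommRing R] [NormedAlgebra ℂ R]
    [CompleteSpace R] {v : R × R × R} (hy : dot3 v v ∈ posPart R) :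
    ∃ w, ∃ s ∈ posPart R, dot3 w w = 2 ∧ dot3 v w = 2 * s := by
  obtain ⟨s, hs, hss, s', hss'⟩ := exists_sqrt_inverse hy
  refine ⟨s' • v, s, hs, ?_, ?_⟩
  · rw [dot3_smul_left, dot3_smul_right, ← hss]
    linear_combination 2 * (s * s' + 1) * hss'
  · rw [dot3_smul_right, ← hss]
    linear_combination 2 * s * hss'

open Topology

variable {X : Type*} [TopologicalSpace X] [CompactSpace X]

/-- The value of a triple of functions at a point. -/
noncomputable def at3 (v : C(X, ℂ) × C(X, ℂ) × C(X, ℂ)) (x : X) : ℂ × ℂ × ℂ :=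
  (v.1 x, v.2.1 x, v.2.2 x)

/-- Triples with coordinates in a function algebra. -/
def triples (D : Subalgebra ℂ C(X, ℂ)) : Set (C(X, ℂ) × C(X, ℂ) × C(X, ℂ)) :=
  {v | v.1 ∈ D ∧ v.2.1 ∈ D ∧ v.2.2 ∈ D}

/-- Triples over a function algebra whose trace form has positive real part everywhere. -/
def nondeg (D : Subalgebra ℂ C(X, ℂ)) : Set (C(X, ℂ) × C(X, ℂ) × C(X, ℂ)) :=
  {v | v ∈ triples D ∧ ∀ x, 0 < reDot (at3 v x) (at3 v x)}

/-- The convex combination of two triples of functions. -/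
noncomputable def mixMap (k : C(X, ℝ)) (v w : C(X, ℂ) × C(X, ℂ) × C(X, ℂ)) :
    C(X, ℂ) × C(X, ℂ) × C(X, ℂ) := (1 - realMap k) • v + realMap k • w

variable {v w : C(X, ℂ) × C(X, ℂ) × C(X, ℂ)} {D : Subalgebra ℂ C(X, ℂ)}

@[simp] lemma at3_mixMap (k : C(X, ℝ)) (v w : C(X, ℂ) × C(X, ℂ) × C(X, ℂ)) (x : X) :
    at3 (mixMap k v w) x = mix (k x) (at3 v x) (at3 w x) := rfl

lemma continuous_at3 : Continuous fun p : (C(X, ℂ) × C(X, ℂ) × C(X, ℂ)) × X => at3 p.1 p.2 := by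
  have h : Continuous fun p : C(X, ℂ) × X => p.1 p.2 := ContinuousEval.continuous_eval
  unfold at3
  exact (h.comp (by fun_prop : Continuous fun p : (C(X, ℂ) × C(X, ℂ) × C(X, ℂ)) × X =>
    (p.1.1, p.2))).prodMk ((h.comp (by fun_prop : Continuous fun p :
      (C(X, ℂ) × C(X, ℂ) × C(X, ℂ)) × X => (p.1.2.1, p.2))).prodMk (h.comp (by fun_prop :
      Continuous fun p : (C(X, ℂ) × C(X, ℂ) × C(X, ℂ)) × X => (p.1.2.2, p.2))))

lemma continuous_reDot {Y : Type*} [TopologicalSpace Y] {f g : Y → ℂ × ℂ × ℂ} (hf : Continuous f)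
    (hg : Continuous g) : Continuous fun y => reDot (f y) (g y) :=
  Complex.continuous_re.comp (continuous_dot3 hf hg)

lemma norm_at3_le (v : C(X, ℂ) × C(X, ℂ) × C(X, ℂ)) (x : X) : ‖at3 v x‖ ≤ ‖v‖ := by
  refine norm_prod_le_iff.2 ⟨?_, norm_prod_le_iff.2 ⟨?_, ?_⟩⟩
  · exact (v.1.norm_coe_le_norm x).trans (norm_fst_le v)
  · exact (v.2.1.norm_coe_le_norm x).trans ((norm_fst_le v.2).trans (norm_snd_le v))
  · exact (v.2.2.norm_coe_le_norm x).trans ((norm_snd_le v.2).trans (norm_snd_le v))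

lemma continuous_mixMap (k : C(X, ℝ)) (w : C(X, ℂ) × C(X, ℂ) × C(X, ℂ)) :
    Continuous fun v => mixMap k v w := by
  unfold mixMap; fun_prop

lemma triples_mono {D D' : Subalgebra ℂ C(X, ℂ)} (h : D ≤ D') : triples D ⊆ triples D' :=
  fun _ hv => ⟨h hv.1, h hv.2.1, h hv.2.2⟩

lemma nondeg_mono {D D' : Subalgebra ℂ C(X, ℂ)} (h : D ≤ D') : nondeg D ⊆ nondeg D' :=
  fun _ hv => ⟨triples_mono h hv.1, hv.2⟩

lemma mixMap_mem {k : C(X, ℝ)} (hk : realMap k ∈ D) (hv : v ∈ triples D) (hw : w ∈ triples D) :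
    mixMap k v w ∈ triples D := by
  have h1 := D.sub_mem D.one_mem hk
  exact ⟨D.add_mem (D.mul_mem h1 hv.1) (D.mul_mem hk hw.1),
    D.add_mem (D.mul_mem h1 hv.2.1) (D.mul_mem hk hw.2.1),
    D.add_mem (D.mul_mem h1 hv.2.2) (D.mul_mem hk hw.2.2)⟩

lemma joinedIn_nondeg_of_reDot_pos (hv : v ∈ nondeg D) (hw : w ∈ nondeg D)
    (h : ∀ x, 0 < reDot (at3 v x) (at3 w x)) : JoinedIn (nondeg D) v w := by
  refine JoinedIn.of_segment_subset ?_
  rintro _ ⟨a, u, ha, hu, hau, rfl⟩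
  have e : a • v + u • w = mixMap (.const X u) v w := by
    obtain rfl : a = 1 - u := by linarith
    ext x <;> simp [mixMap]
  rw [e]
  have hu' : u ∈ Set.Icc (0 : ℝ) 1 := ⟨hu, by linarith⟩
  refine ⟨mixMap_mem ?_ hv.1 hw.1, fun x => ?_⟩
  · have h0 : realMap (.const X u) = algebraMap ℂ C(X, ℂ) (u : ℂ) := by
      ext x; simp
    rw [h0]
    exact D.algebraMap_mem _
  · rw [at3_mixMap, ContinuousMap.const_apply]
    exact reDot_mix_self_pos hu' (hv.2 x) (fun _ => hw.2 x) fun _ => h x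

/-- The triple of functions underlying a triple over a function algebra. -/
def incl3 (D : Subalgebra ℂ C(X, ℂ)) (v : D × D × D) : C(X, ℂ) × C(X, ℂ) × C(X, ℂ) :=
  map3 Subtype.val v

lemma incl3_mem (v : D × D × D) : incl3 D v ∈ triples D := ⟨v.1.2, v.2.1.2, v.2.2.2⟩

lemma exists_incl3 (hv : v ∈ triples D) : ∃ v', incl3 D v' = v :=
  ⟨(⟨_, hv.1⟩, ⟨_, hv.2.1⟩, ⟨_, hv.2.2⟩), rfl⟩

lemma continuous_incl3 : Continuous (incl3 D) := continuous_map3 continuous_subtype_val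

lemma dot3_incl3 (v w : D × D × D) (x : X) :
    dot3 (at3 (incl3 D v) x) (at3 (incl3 D w) x) = (dot3 v w : D).1 x := rfl

/-- Normalisation of a nondegenerate triple. -/
lemma exists_normalised (hD : IsFull D) (hc : IsClosed (D : Set C(X, ℂ))) (hv : v ∈ nondeg D) :
    ∃ w ∈ nondeg D, (∀ x, dot3 (at3 w x) (at3 w x) = 2) ∧ JoinedIn (nondeg D) v w := by
  have : CompleteSpace D := hc.completeSpace_coe
  obtain ⟨v', rfl⟩ := exists_incl3 hv.1
  have hy : dot3 v' v' ∈ posPart D := fun ψ => by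
    obtain ⟨x, hx⟩ := hD ψ
    rw [hx]
    exact hv.2 x
  obtain ⟨w, s, hs, hw2, hvw⟩ := exists_normalised_triple hy
  have h2 : ∀ x, dot3 (at3 (incl3 D w) x) (at3 (incl3 D w) x) = 2 := fun x => by
    rw [dot3_incl3, hw2]; rfl
  have hw : incl3 D w ∈ nondeg D := ⟨incl3_mem _, fun x => by rw [reDot, h2]; norm_num⟩
  refine ⟨_, hw, h2, joinedIn_nondeg_of_reDot_pos hv hw fun x => ?_⟩
  rw [reDot, dot3_incl3, hvw]
  have := hs (evalHom D x)
  rw [evalHom_apply] at this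
  change 0 < ((2 : ℂ) * (s : C(X, ℂ)) x).re
  simpa using this

lemma exists_annulus_step_of_isFull {A : Subalgebra ℂ C(X, ℂ)} (hA : IsFull A)
    (hc : IsClosed (A : Set C(X, ℂ))) {b : C(X, ℂ)} (hbA : b ∈ A) (hb : ∀ x, b x ≠ 0) {r t t' : ℝ}
    (hr : 0 < r) (hrt : r ≤ t) (htt : t ≤ t') {c g : C(X, ℂ) × C(X, ℂ) × C(X, ℂ)}
    (hcA : c ∈ triples A) (hgA : g ∈ triples A)
    (h1 : ∀ x, r ≤ ‖b x‖ → ‖b x‖ ≤ t → 0 < reDot (at3 c x) (at3 c x))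
    (h2 : ∀ x, t ≤ ‖b x‖ → ‖b x‖ ≤ t' → ‖dot3 (at3 g x) (at3 g x) - 2‖ < 1 / 10)
    (h3 : ∀ x, ‖b x‖ = t → ‖dot3 (at3 c x) (at3 c x) - 2‖ < 1 / 10)
    (h4 : ∀ x, ‖b x‖ = t → ‖dot3 (at3 c x) (at3 g x) - 2‖ < 1 / 10) {δ : ℝ} (hδ : 0 < δ) :
    ∃ c', JoinedIn {a | a ∈ triples A ∧
        (∀ x, r ≤ ‖b x‖ → ‖b x‖ ≤ t → 0 < reDot (at3 a x) (at3 a x)) ∧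
        ∀ x, ‖b x‖ = t → 0 < reDot (at3 a x) (at3 g x)} c c' ∧
      ∀ x, t ≤ ‖b x‖ → ‖b x‖ ≤ t' → ∃ s s' : ℂ, 0 < s.re ∧
        2 * (s * s) = dot3 (at3 g x) (at3 g x) ∧ s * s' = 1 ∧
        ‖at3 c' x - s' • at3 g x‖ < δ := by
  have : CompleteSpace A := hc.completeSpace_coe
  obtain ⟨c, rfl⟩ := exists_incl3 hcA
  obtain ⟨g, rfl⟩ := exists_incl3 hgA
  obtain ⟨b', hb'⟩ := hA.isUnit hc (b := ⟨b, hbA⟩) hb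
  have hbb : ∀ x, ((b' : A) : C(X, ℂ)) x = b x := fun x => by rw [hb']
  obtain ⟨c', hJ, H⟩ := exists_annulus_step (norm_one_subalgebra_le A) b' hr hrt htt
    (c := c) (g := g)
    (fun φ => by obtain ⟨x, hx⟩ := hA φ; simp only [hx, hbb]; exact h1 x)
    (fun φ => by obtain ⟨x, hx⟩ := hA φ; simp only [hx, hbb]; exact h2 x)
    (fun φ => by obtain ⟨x, hx⟩ := hA φ; simp only [hx, hbb]; exact h3 x)
    (fun φ => by obtain ⟨x, hx⟩ := hA φ; simp only [hx, hbb]; exact h4 x) hδ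
  refine ⟨incl3 A c', (hJ.map continuous_incl3).mono ?_, fun x hx hx' => ?_⟩
  · rintro _ ⟨a, ⟨ha, ha'⟩, rfl⟩
    refine ⟨incl3_mem a, fun x hx hx' => ?_, fun x hx => ?_⟩
    · exact ha (evalHom A x) (by rwa [evalHom_apply, hbb]) (by rwa [evalHom_apply, hbb])
    · exact ha' (evalHom A x) (by rwa [evalHom_apply, hbb])
  · exact H (evalHom A x) (by rwa [evalHom_apply, hbb]) (by rwa [evalHom_apply, hbb])

end Fields

section Steps

open Topology

lemma exists_lt_forall_pos {Y : Type*} [TopologicalSpace Y] [CompactSpace Y] {h F : Y → ℝ}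
    (hh : Continuous h) (hF : Continuous F) {t : ℝ} (ht : ∀ y, h y = t → 0 < F y) :
    ∃ s < t, ∀ y, s ≤ h y → h y ≤ t → 0 < F y := by
  have hK : IsCompact {y | F y ≤ 0 ∧ h y ≤ t} :=
    ((isClosed_le hF continuous_const).inter (isClosed_le hh continuous_const)).isCompact
  rcases Set.eq_empty_or_nonempty {y | F y ≤ 0 ∧ h y ≤ t} with h0 | h0
  · refine ⟨t - 1, by linarith, fun y _ hy => ?_⟩
    by_contra hy'
    exact Set.eq_empty_iff_forall_notMem.1 h0 y ⟨not_lt.1 hy', hy⟩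
  · obtain ⟨y₀, hy₀, hm⟩ := hK.exists_isMaxOn h0 hh.continuousOn
    have hlt : h y₀ < t := lt_of_le_of_ne hy₀.2 fun e => (ht y₀ e).not_ge hy₀.1
    refine ⟨(h y₀ + t) / 2, by linarith, fun y hy hy' => ?_⟩
    by_contra hF'
    have h1 : h y ≤ h y₀ := hm (⟨not_lt.1 hF', hy'⟩ : F y ≤ 0 ∧ h y ≤ t)
    linarith

lemma induction_Icc {P : ℝ → Prop} {a b : ℝ} (hab : a ≤ b)
    (H : ∀ τ ∈ Set.Icc a b, ∃ η > 0, ∀ t t', a ≤ t → t ≤ t' → |t - τ| < η → |t' - τ| < η →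
      P t → P t') (ha : P a) : P b := by
  set S := {t | t ∈ Set.Icc a b ∧ P t} with hS
  have haS : a ∈ S := ⟨⟨le_rfl, hab⟩, ha⟩
  have hbdd : BddAbove S := ⟨b, fun t ht => ht.1.2⟩
  set τ := sSup S with hτ
  have hτab : τ ∈ Set.Icc a b := ⟨le_csSup hbdd haS, csSup_le ⟨a, haS⟩ fun t ht => ht.1.2⟩
  obtain ⟨η, hη, hP⟩ := H τ hτab
  obtain ⟨t, htS, ht⟩ := exists_lt_of_lt_csSup ⟨a, haS⟩ (sub_lt_self τ hη)
  have htτ : t ≤ τ := le_csSup hbdd htS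
  have ht' : |t - τ| < η := by rw [abs_lt]; constructor <;> linarith
  have hmin : P (min b (τ + η / 2)) := by
    refine hP t _ htS.1.1 (le_min htS.1.2 (by linarith)) ht' ?_ htS.2
    rw [abs_lt]
    constructor
    · linarith [le_min hτab.2 (by linarith : τ ≤ τ + η / 2)]
    · linarith [min_le_right b (τ + η / 2)]
  rcases le_total b (τ + η / 2) with h | h
  · rwa [min_eq_left h] at hmin
  · rw [min_eq_right h] at hmin
    have : τ + η / 2 ≤ τ := le_csSup hbdd ⟨⟨by linarith [hτab.1], h⟩, hmin⟩
    linarith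

/-- The piecewise linear function going from `0` at `s` to `1` at `t`. -/
noncomputable def ramp (s t : ℝ) : C(ℝ, ℝ) :=
  ⟨fun y => max 0 (min 1 ((y - s) / (t - s))), by fun_prop⟩

lemma ramp_mem (s t y : ℝ) : ramp s t y ∈ Set.Icc (0 : ℝ) 1 :=
  ⟨le_max_left _ _, max_le zero_le_one (min_le_left _ _)⟩

lemma ramp_of_le {s t y : ℝ} (hst : s < t) (hy : y ≤ s) : ramp s t y = 0 :=
  max_eq_left ((min_le_right _ _).trans
    (div_nonpos_of_nonpos_of_nonneg (sub_nonpos.2 hy) (sub_nonneg.2 hst.le)))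

lemma ramp_of_ge {s t y : ℝ} (hst : s < t) (hy : t ≤ y) : ramp s t y = 1 := by
  have h1 : 1 ≤ (y - s) / (t - s) := by
    rw [one_le_div (sub_pos.2 hst)]; linarith
  change max 0 (min 1 ((y - s) / (t - s))) = 1
  rw [min_eq_left h1, max_eq_right zero_le_one]

variable {X : Type*} [TopologicalSpace X] [CompactSpace X]

lemma realMap_comp_mem_locAlg (A : Subalgebra ℂ C(X, ℂ)) (h : C(X, ℝ)) (k : C(ℝ, ℝ)) :
    realMap (k.comp h) ∈ locAlg A h :=
  comp_mem_locAlg A h ⟨fun y => (k y : ℂ), by fun_prop⟩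

lemma exists_near_of_mem_triples_locAlg {A : Subalgebra ℂ C(X, ℂ)} {h : C(X, ℝ)}
    {v : C(X, ℂ) × C(X, ℂ) × C(X, ℂ)} (hv : v ∈ triples (locAlg A h)) {δ : ℝ} (hδ : 0 < δ)
    (t : ℝ) : ∃ η > 0, ∃ g ∈ triples A, ∀ x, |h x - t| < η → ‖at3 g x - at3 v x‖ < δ := by
  obtain ⟨η₁, h₁, g₁, hg₁, H₁⟩ := hv.1 δ hδ t
  obtain ⟨η₂, h₂, g₂, hg₂, H₂⟩ := hv.2.1 δ hδ t
  obtain ⟨η₃, h₃, g₃, hg₃, H₃⟩ := hv.2.2 δ hδ t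
  refine ⟨min η₁ (min η₂ η₃), by positivity, (g₁, g₂, g₃), ⟨hg₁, hg₂, hg₃⟩, fun x hx => ?_⟩
  simp only [lt_min_iff] at hx
  rw [norm_sub_rev]
  exact max_lt (H₁ x hx.1) (max_lt (H₂ x hx.2.1) (H₃ x hx.2.2))

/-- Replacement, up to homotopy, of a triple over a localised algebra by a triple over the original
algebra on a sublevel set of the modulus of `b`. -/
def Replaced (A : Subalgebra ℂ C(X, ℂ)) (b : C(X, ℂ)) (v : C(X, ℂ) × C(X, ℂ) × C(X, ℂ))
    (δ t : ℝ) : Prop :=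
  ∃ c ∈ triples A, ∃ w, JoinedIn (nondeg (locAlg A (absMap b))) v w ∧
    (∀ x, ‖b x‖ ≤ t → 0 < reDot (at3 c x) (at3 c x) ∧ 0 < reDot (at3 w x) (at3 c x)) ∧
    (∀ x, t ≤ ‖b x‖ → at3 w x = at3 v x) ∧ ∀ x, ‖b x‖ = t → ‖at3 c x - at3 v x‖ < δ

variable {A : Subalgebra ℂ C(X, ℂ)} {b : C(X, ℂ)} {v : C(X, ℂ) × C(X, ℂ) × C(X, ℂ)}
  {C δ δ₁ : ℝ}

set_option maxHeartbeats 1000000 in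
lemma Replaced.step (hA : IsFull A) (hc : IsClosed (A : Set C(X, ℂ))) (hbA : b ∈ A)
    (hb : ∀ x, b x ≠ 0) (hv : v ∈ nondeg (locAlg A (absMap b)))
    (hv2 : ∀ x, dot3 (at3 v x) (at3 v x) = 2) (hC : ‖v‖ ≤ C) (hδ : 160 * (C + 1) * δ = 1)
    (hδ₁ : 12 * (C + 1) ^ 2 * δ₁ = δ) {r t t' : ℝ} (hr : 0 < r) (hrb : ∀ x, r < ‖b x‖)
    (hrt : r ≤ t) (htt : t < t') {g : C(X, ℂ) × C(X, ℂ) × C(X, ℂ)} (hg : g ∈ triples A)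
    (hgv : ∀ x, t ≤ ‖b x‖ → ‖b x‖ ≤ t' → ‖at3 g x - at3 v x‖ < δ₁)
    (h : Replaced A b v δ t) : Replaced A b v δ t' := by
  obtain ⟨c, hcA, w, hJ, hcw, hwv, hcv⟩ := h
  have hC0 : 0 ≤ C := (norm_nonneg _).trans hC
  have hCx : ∀ x, ‖at3 v x‖ ≤ C := fun x => (norm_at3_le v x).trans hC
  have hδ0 : 0 < δ := by
    by_contra hh
    nlinarith
  have hδ₁0 : 0 < δ₁ := by
    by_contra hh
    nlinarith [sq_nonneg (C + 1)]
  have hδδ : δ₁ ≤ δ := by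
    nlinarith [mul_nonneg hC0 hδ₁0.le, mul_nonneg (mul_nonneg hC0 hC0) hδ₁0.le]
  have hgv' : ∀ x, t ≤ ‖b x‖ → ‖b x‖ ≤ t' → ‖at3 g x - at3 v x‖ ≤ δ := fun x hx hx' =>
    (hgv x hx hx').le.trans hδδ
  have near : ∀ {x a a'}, ‖a - at3 v x‖ ≤ δ → ‖a' - at3 v x‖ ≤ δ →
      ‖dot3 a a' - 2‖ < 1 / 10 ∧ 0 < reDot a a' := fun ha ha' =>
    reDot_pos_of_near (hv2 _) (hCx _) hδ ha ha'
  have hself : ∀ x, ‖at3 v x - at3 v x‖ ≤ δ := fun x => by simpa using hδ0.le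
  obtain ⟨c', hJc, hc'⟩ := exists_annulus_step_of_isFull hA hc hbA hb hr hrt htt.le hcA hg
    (fun x _ hx => (hcw x hx).1) (fun x hx hx' => (near (hgv' x hx hx') (hgv' x hx hx')).1)
    (fun x hx => (near (hcv x hx).le (hcv x hx).le).1)
    (fun x hx => (near (hcv x hx).le (hgv' x hx.ge (hx.trans_le htt.le))).1) (half_pos hδ0)
  have hc'v : ∀ x, t ≤ ‖b x‖ → ‖b x‖ ≤ t' → ‖at3 c' x - at3 v x‖ < δ := fun x hx hx' => by
    obtain ⟨s, s', hs, hsg, hss, hd⟩ := hc' x hx hx'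
    exact norm_sub_lt_of_normalised (hv2 x) (hCx x) hδ hδ₁ (hgv x hx hx').le hs hsg hss hd
  obtain ⟨γ, hγ⟩ := hJc
  obtain ⟨s, hst, hs⟩ := exists_lt_forall_pos (Y := unitInterval × X) (h := fun y => ‖b y.2‖)
    (F := fun y => min (reDot (at3 (γ y.1) y.2) (at3 g y.2)) (min (reDot (at3 w y.2) (at3 g y.2))
      (reDot (at3 g y.2) (at3 g y.2)))) (t := t) (by fun_prop) (by
      have hcont : ∀ v : C(X, ℂ) × C(X, ℂ) × C(X, ℂ),
          Continuous fun y : unitInterval × X => at3 v y.2 := fun v =>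
        continuous_at3.comp (continuous_const.prodMk continuous_snd)
      exact (continuous_reDot (continuous_at3.comp ((γ.continuous.comp continuous_fst).prodMk
        continuous_snd)) (hcont g)).min ((continuous_reDot (hcont w) (hcont g)).min
        (continuous_reDot (hcont g) (hcont g)))) (by
      rintro ⟨u, x⟩ hx
      change ‖b x‖ = t at hx
      have hgx := hgv' x hx.ge (hx.trans_le htt.le)
      refine lt_min ((hγ u).2.2 x hx) (lt_min ?_ (near hgx hgx).2)
      change 0 < reDot (at3 w x) _
      rw [hwv x hx.ge]
      exact (near (hself x) hgx).2)
  simp only [lt_min_iff] at hs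
  set B := locAlg A (absMap b)
  have hAB : A ≤ B := le_locAlg A _
  set v₁ := mixMap ((ramp t t').comp (absMap b)) g v with hv₁
  have hv₁B : v₁ ∈ triples B :=
    mixMap_mem (realMap_comp_mem_locAlg A _ _) (triples_mono hAB hg) hv.1
  have hv₁g : ∀ x, ‖b x‖ ≤ t → at3 v₁ x = at3 g x := fun x hx => by
    rw [hv₁, at3_mixMap, ContinuousMap.comp_apply, absMap_apply, ramp_of_le htt hx, mix_zero]
  have hv₁v : ∀ x, t' ≤ ‖b x‖ → at3 v₁ x = at3 v x := fun x hx => by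
    rw [hv₁, at3_mixMap, ContinuousMap.comp_apply, absMap_apply, ramp_of_ge htt hx, mix_one]
  have hv₁n : ∀ x, t ≤ ‖b x‖ → ‖at3 v₁ x - at3 v x‖ ≤ δ := fun x hx => by
    rcases le_total (‖b x‖) t' with hx' | hx'
    · rw [hv₁, at3_mixMap, ContinuousMap.comp_apply]
      exact norm_mix_sub_le (ramp_mem _ _ _) (hgv' x hx hx') (hself x)
    · rw [hv₁v x hx']; exact hself x
  set ζ := fun a => mixMap ((ramp s t).comp (absMap b)) a v₁ with hζ
  have hζB : ∀ {a}, a ∈ triples A → ζ a ∈ triples B := fun ha =>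
    mixMap_mem (realMap_comp_mem_locAlg A _ _) (triples_mono hAB ha) hv₁B
  have hζt : ∀ a x, t ≤ ‖b x‖ → at3 (ζ a) x = at3 v₁ x := fun a x hx => by
    simp only [hζ, at3_mixMap, ContinuousMap.comp_apply, absMap_apply, ramp_of_ge hst hx, mix_one]
  have hζs : ∀ a x, ‖b x‖ ≤ t → at3 (ζ a) x = mix (ramp s t ‖b x‖) (at3 a x) (at3 g x) :=
    fun a x hx => by
      simp only [hζ, at3_mixMap, ContinuousMap.comp_apply, absMap_apply, hv₁g x hx]
  have hramp : ∀ {x}, ramp s t ‖b x‖ ≠ 0 → s ≤ ‖b x‖ := fun hx => by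
    by_contra hx'
    exact hx (ramp_of_le hst (not_le.1 hx').le)
  have hζγ : ∀ u, ζ (γ u) ∈ nondeg B := fun u => by
    refine ⟨hζB (hγ u).1, fun x => ?_⟩
    rcases le_total (‖b x‖) t with hx | hx
    · rw [hζs _ x hx]
      exact reDot_mix_self_pos (ramp_mem _ _ _) ((hγ u).2.1 x (hrb x).le hx)
        (fun h0 => (hs (u, x) (hramp h0) hx).2.2) fun h0 => (hs (u, x) (hramp h0) hx).1
    · rw [hζt _ x hx]
      exact (near (hv₁n x hx) (hv₁n x hx)).2
  have hζc : ζ c ∈ nondeg B := by simpa using hζγ 0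
  have hζc' : ζ c' ∈ nondeg B := by simpa using hζγ 1
  have hJ1 : JoinedIn (nondeg B) w (ζ c) :=
    joinedIn_nondeg_of_reDot_pos hJ.target_mem hζc fun x => by
      rcases le_total (‖b x‖) t with hx | hx
      · rw [hζs _ x hx, reDot_comm]
        refine reDot_mix_pos (ramp_mem _ _ _) ?_ fun h0 => ?_
        · rw [reDot_comm]; exact (hcw x hx).2
        · rw [reDot_comm]; exact (hs (0, x) (hramp h0) hx).2.1
      · rw [hζt _ x hx, hwv x hx]
        exact (near (hself x) (hv₁n x hx)).2
  have hJ2 : JoinedIn (nondeg B) (ζ c) (ζ c') :=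
    ⟨γ.map (continuous_mixMap _ _), hζγ⟩
  have hγ1 := hγ 1
  rw [γ.target] at hγ1
  refine ⟨c', hγ1.1, ζ c', (hJ.trans hJ1).trans hJ2, fun x hx' => ?_, fun x hx => ?_,
    fun x hx => hc'v x (htt.le.trans hx.ge) hx.le⟩
  · rcases le_total (‖b x‖) t with hx | hx
    · have h0 := hγ1.2.1 x (hrb x).le hx
      refine ⟨h0, ?_⟩
      rw [hζs _ x hx]
      refine reDot_mix_pos (ramp_mem _ _ _) h0 fun h1 => ?_
      have := (hs (1, x) (hramp h1) hx).1
      rwa [γ.target, reDot_comm] at this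
    · have h0 := (hc'v x hx hx').le
      rw [hζt _ x hx]
      exact ⟨(near h0 h0).2, (near (hv₁n x hx) h0).2⟩
  · rw [hζt _ x (htt.le.trans hx), hv₁v x hx]

/-- Every nondegenerate triple over the localised algebra can be moved to the original algebra. -/
lemma exists_joinedIn_nondeg_locAlg (hA : IsFull A) (hc : IsClosed (A : Set C(X, ℂ)))
    (hbA : b ∈ A) (hb : ∀ x, b x ≠ 0) (hv : v ∈ nondeg (locAlg A (absMap b))) :
    ∃ w ∈ nondeg A, JoinedIn (nondeg (locAlg A (absMap b))) v w := by
  obtain ⟨v', hv', hv2, hJ⟩ :=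
    exists_normalised (isFull_locAlg hA hc hbA hb) (isClosed_locAlg A _) hv
  suffices ∃ w ∈ nondeg A, JoinedIn (nondeg (locAlg A (absMap b))) v' w by
    obtain ⟨w, hw, hJ'⟩ := this
    exact ⟨w, hw, hJ.trans hJ'⟩
  obtain ⟨r, R, hr, hrR, hbr⟩ := exists_bounds b hb
  have hC1 : (0 : ℝ) < ‖v'‖ + 1 := by positivity
  set δ := 1 / (160 * (‖v'‖ + 1)) with hδ
  set δ₁ := δ / (12 * (‖v'‖ + 1) ^ 2) with hδ₁
  have hδ₁0 : 0 < δ₁ := by positivity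
  have hR : Replaced A b v' δ R := by
    refine induction_Icc hrR (fun τ _ => ?_) (P := Replaced A b v' δ)
      ⟨0, ⟨A.zero_mem, A.zero_mem, A.zero_mem⟩, v', JoinedIn.refl hv',
        fun x hx => ((hbr x).1.not_ge hx).elim, fun _ _ => rfl,
        fun x hx => ((hbr x).1.ne' hx).elim⟩
    obtain ⟨η, hη, g, hg, H⟩ := exists_near_of_mem_triples_locAlg hv'.1 hδ₁0 τ
    refine ⟨η, hη, fun t t' hrt htt ht ht' hP => ?_⟩
    rcases htt.eq_or_lt with rfl | htt
    · exact hP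
    refine hP.step hA hc hbA hb hv' hv2 le_rfl (by rw [hδ]; field_simp)
      (by rw [hδ₁]; field_simp) hr (fun x => (hbr x).1) hrt htt hg fun x hx hx' => H x ?_
    rw [absMap_apply]
    rw [abs_lt] at *
    constructor <;> linarith
  obtain ⟨c, hcA, w, hJw, hcw, -, -⟩ := hR
  have hcA' : c ∈ nondeg A := ⟨hcA, fun x => (hcw x (hbr x).2.le).1⟩
  exact ⟨c, hcA', hJw.trans (joinedIn_nondeg_of_reDot_pos hJw.target_mem
    (nondeg_mono (le_locAlg A _) hcA') fun x => (hcw x (hbr x).2.le).2)⟩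

/-- Adjoining the moduli of invertible elements does not change the nondegenerate triples up to
homotopy. -/
theorem exists_joinedIn_nondeg_of_mem_adjoin (hA : IsFull A) (hc : IsClosed (A : Set C(X, ℂ)))
    {S : Set C(X, ℂ)} (hSA : S ⊆ A) (hS : ∀ b ∈ S, ∀ x, b x ≠ 0) {D : Subalgebra ℂ C(X, ℂ)}
    (hAD : A ≤ D) (hD : ∀ A', A ≤ A' → A' ≤ D → ∀ b ∈ S, locAlg A' (absMap b) ≤ D)
    (hv : v ∈ nondeg (Algebra.adjoin ℂ ((A : Set C(X, ℂ)) ∪ (fun b => realMap (absMap b)) '' S))) :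
    ∃ w ∈ nondeg A, JoinedIn (nondeg D) v w := by
  let Good : Subalgebra ℂ C(X, ℂ) → Prop := fun A' => A ≤ A' ∧ A' ≤ D ∧ IsFull A' ∧
    IsClosed (A' : Set C(X, ℂ)) ∧ ∀ v ∈ nondeg A', ∃ w ∈ nondeg A, JoinedIn (nondeg D) v w
  have hfin : ∀ F : Finset C(X, ℂ), (F : Set C(X, ℂ)) ⊆ S →
      ∃ A', Good A' ∧ ∀ b ∈ F, realMap (absMap b) ∈ A' := by
    classical
    intro F
    induction F using Finset.induction_on with
    | empty =>
      exact fun _ => ⟨A, ⟨le_rfl, hAD, hA, hc, fun v hv =>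
        ⟨v, hv, JoinedIn.refl (nondeg_mono hAD hv)⟩⟩, by simp⟩
    | insert b F _ ih =>
      intro hF
      rw [Finset.coe_insert, Set.insert_subset_iff] at hF
      obtain ⟨A', ⟨h1, h2, h3, h4, h5⟩, h6⟩ := ih hF.2
      have hbA' := h1 (hSA hF.1)
      have h7 := hD A' h1 h2 b hF.1
      have h8 := le_locAlg A' (absMap b)
      refine ⟨locAlg A' (absMap b), ⟨h1.trans h8, h7, isFull_locAlg h3 h4 hbA' (hS b hF.1),
        isClosed_locAlg _ _, fun v hv => ?_⟩, fun b' hb' => ?_⟩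
      · obtain ⟨w, hw, hJ⟩ := exists_joinedIn_nondeg_locAlg h3 h4 hbA' (hS b hF.1) hv
        obtain ⟨w', hw', hJ'⟩ := h5 w hw
        exact ⟨w', hw', (hJ.mono (nondeg_mono h7)).trans hJ'⟩
      · rcases Finset.mem_insert.1 hb' with rfl | hb'
        · exact realMap_mem_locAlg _ _
        · exact h8 (h6 b' hb')
  have hone : ∀ f ∈ Algebra.adjoin ℂ ((A : Set C(X, ℂ)) ∪ (fun b => realMap (absMap b)) '' S),
      ∃ F : Finset C(X, ℂ), (F : Set C(X, ℂ)) ⊆ S ∧ ∀ A' : Subalgebra ℂ C(X, ℂ), A ≤ A' →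
        (∀ b ∈ F, realMap (absMap b) ∈ A') → f ∈ A' := by
    classical
    intro f hf
    induction hf using Algebra.adjoin_induction with
    | mem f hf =>
      rcases hf with hf | ⟨b, hb, rfl⟩
      · exact ⟨∅, by simp, fun A' h _ => h hf⟩
      · exact ⟨{b}, by simpa using hb, fun A' _ h => h b (by simp)⟩
    | algebraMap z => exact ⟨∅, by simp, fun A' _ _ => A'.algebraMap_mem z⟩
    | add f g _ _ hf hg =>
      obtain ⟨F, h1, h2⟩ := hf
      obtain ⟨G, h3, h4⟩ := hg
      exact ⟨F ∪ G, by simp [h1, h3], fun A' h h' => A'.add_mem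
        (h2 A' h fun b hb => h' b (Finset.mem_union_left _ hb))
        (h4 A' h fun b hb => h' b (Finset.mem_union_right _ hb))⟩
    | mul f g _ _ hf hg =>
      obtain ⟨F, h1, h2⟩ := hf
      obtain ⟨G, h3, h4⟩ := hg
      exact ⟨F ∪ G, by simp [h1, h3], fun A' h h' => A'.mul_mem
        (h2 A' h fun b hb => h' b (Finset.mem_union_left _ hb))
        (h4 A' h fun b hb => h' b (Finset.mem_union_right _ hb))⟩
  classical
  obtain ⟨F₁, hF₁, H₁⟩ := hone _ hv.1.1
  obtain ⟨F₂, hF₂, H₂⟩ := hone _ hv.1.2.1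
  obtain ⟨F₃, hF₃, H₃⟩ := hone _ hv.1.2.2
  obtain ⟨A', ⟨h1, h2, h3, h4, h5⟩, h6⟩ := hfin (F₁ ∪ F₂ ∪ F₃) (by simp [hF₁, hF₂, hF₃])
  refine h5 v ⟨⟨H₁ A' h1 fun b hb => h6 b ?_, H₂ A' h1 fun b hb => h6 b ?_,
    H₃ A' h1 fun b hb => h6 b ?_⟩, hv.2⟩ <;> simp [hb]

end Steps

section Approximation

open Topology

variable {X : Type*} [TopologicalSpace X] [CompactSpace X]

lemma exists_approx_of_separates (E : Subalgebra ℂ C(X, ℂ)) {Y : Type*} [TopologicalSpace Y]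
    [CompactSpace Y] (j : C(Y, X))
    (hsep : ∀ y y', y ≠ y' → ∃ p : C(X, ℝ), realMap p ∈ E ∧ p (j y) ≠ p (j y')) (f : C(Y, ℂ))
    {ε : ℝ} (hε : 0 < ε) : ∃ h ∈ E, ∀ y, ‖h (j y) - f y‖ < ε := by
  let R : Subalgebra ℝ C(Y, ℝ) :=
    { carrier := {g | ∃ p : C(X, ℝ), realMap p ∈ E ∧ g = p.comp j}
      algebraMap_mem' := fun u => ⟨.const X u, by
        have : realMap (.const X u) = algebraMap ℂ C(X, ℂ) (u : ℂ) := by ext x; simp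
        rw [this]
        exact E.algebraMap_mem _, rfl⟩
      add_mem' := by
        rintro _ _ ⟨p, hp, rfl⟩ ⟨q, hq, rfl⟩
        refine ⟨p + q, ?_, rfl⟩
        have : realMap (p + q) = realMap p + realMap q := by ext x; simp
        rw [this]
        exact E.add_mem hp hq
      mul_mem' := by
        rintro _ _ ⟨p, hp, rfl⟩ ⟨q, hq, rfl⟩
        refine ⟨p * q, ?_, rfl⟩
        have : realMap (p * q) = realMap p * realMap q := by ext x; simp
        rw [this]
        exact E.mul_mem hp hq }
  have hR : R.SeparatesPoints := fun y y' hy => by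
    obtain ⟨p, hp, hpy⟩ := hsep y y' hy
    exact ⟨_, ⟨p.comp j, ⟨p, hp, rfl⟩, rfl⟩, hpy⟩
  obtain ⟨⟨_, p, hp, rfl⟩, hp'⟩ :=
    ContinuousMap.exists_mem_subalgebra_near_continuousMap_of_separatesPoints R hR
      ⟨fun y => (f y).re, by fun_prop⟩ (ε / 2) (half_pos hε)
  obtain ⟨⟨_, q, hq, rfl⟩, hq'⟩ :=
    ContinuousMap.exists_mem_subalgebra_near_continuousMap_of_separatesPoints R hR
      ⟨fun y => (f y).im, by fun_prop⟩ (ε / 2) (half_pos hε)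
  refine ⟨realMap p + Complex.I • realMap q, E.add_mem hp (E.smul_mem hq _), fun y => ?_⟩
  have e1 := (ContinuousMap.norm_coe_le_norm _ y).trans_lt hp'
  have e2 := (ContinuousMap.norm_coe_le_norm _ y).trans_lt hq'
  have e : (realMap p + Complex.I • realMap q) (j y) - f y =
      ((p (j y) - (f y).re : ℝ) : ℂ) + Complex.I * ((q (j y) - (f y).im : ℝ) : ℂ) := by
    conv_lhs => rw [← Complex.re_add_im (f y)]
    simp only [ContinuousMap.add_apply, ContinuousMap.smul_apply, realMap_apply, smul_eq_mul,
      Complex.ofReal_sub]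
    ring
  rw [e]
  refine (norm_add_le _ _).trans_lt ?_
  rw [norm_mul, Complex.norm_I, one_mul, Complex.norm_real, Complex.norm_real]
  exact (add_lt_add e1 e2).trans_eq (add_halves ε)

lemma mem_posPart_continuousMap {f : C(X, ℂ)} (hf : ∀ x, 0 < (f x).re) : f ∈ posPart C(X, ℂ) := by
  intro ψ
  by_contra hψ
  have h : IsUnit (f - algebraMap ℂ C(X, ℂ) (ψ f)) := by
    refine ContinuousMap.isUnit_iff_forall_ne_zero _ |>.2 fun x hx => hψ ?_
    have e : f x = ψ f := sub_eq_zero.1 hx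
    rw [← e]
    exact hf x
  have h2 := h.map ψ
  rw [map_sub, AlgHomClass.commutes, Algebra.algebraMap_self_apply, sub_self] at h2
  exact not_isUnit_zero h2

lemma exists_forall_near_pos {v : C(X, ℂ) × C(X, ℂ) × C(X, ℂ)}
    (hv : ∀ x, 0 < reDot (at3 v x) (at3 v x)) : ∃ ε > 0, ∀ w : C(X, ℂ) × C(X, ℂ) × C(X, ℂ),
      (∀ x, ‖at3 w x - at3 v x‖ < ε) →
        ∀ x, 0 < reDot (at3 w x) (at3 w x) ∧ 0 < reDot (at3 v x) (at3 w x) := by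
  have hO : IsOpen {w : C(X, ℂ) × C(X, ℂ) × C(X, ℂ) |
      dot3 w w ∈ posPart C(X, ℂ) ∧ dot3 v w ∈ posPart C(X, ℂ)} :=
    (isOpen_posPart.preimage (continuous_dot3 continuous_id continuous_id)).inter
      (isOpen_posPart.preimage (continuous_dot3 continuous_const continuous_id))
  obtain ⟨ε, hε, hb⟩ := Metric.isOpen_iff.1 hO v
    ⟨mem_posPart_continuousMap hv, mem_posPart_continuousMap hv⟩
  refine ⟨ε / 2, half_pos hε, fun w hw x => ?_⟩
  have hwv : ‖w - v‖ ≤ ε / 2 := by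
    refine norm_prod_le_iff.2 ⟨?_, norm_prod_le_iff.2 ⟨?_, ?_⟩⟩
    · exact (ContinuousMap.norm_le _ (half_pos hε).le).2 fun x => (norm_fst_le _).trans (hw x).le
    · exact (ContinuousMap.norm_le _ (half_pos hε).le).2 fun x =>
        ((norm_fst_le _).trans (norm_snd_le _)).trans (hw x).le
    · exact (ContinuousMap.norm_le _ (half_pos hε).le).2 fun x =>
        ((norm_snd_le _).trans (norm_snd_le _)).trans (hw x).le
  have hw' := hb (show w ∈ Metric.ball v ε by
    rw [Metric.mem_ball, dist_eq_norm]
    linarith)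
  exact ⟨hw'.1 (ContinuousMap.evalAlgHom ℂ ℂ x), hw'.2 (ContinuousMap.evalAlgHom ℂ ℂ x)⟩

lemma exists_norm_one_add_smul_ne {f : C(X, ℂ)} {x y : X} (hxy : f x ≠ f y) :
    ∃ z : ℂ, ‖z‖ * ‖f‖ < 1 ∧ ‖1 + z * f x‖ ≠ ‖1 + z * f y‖ := by
  set M := ‖f‖ with hM
  have hM0 : 0 ≤ M := norm_nonneg f
  have hx : ‖f x‖ ≤ M := f.norm_coe_le_norm x
  have hy : ‖f y‖ ≤ M := f.norm_coe_le_norm y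
  set d := f x - f y with hd
  have hd0 : 0 < ‖d‖ := norm_pos_iff.2 (sub_ne_zero.2 hxy)
  have hdM : ‖d‖ ≤ 2 * M := (norm_sub_le _ _).trans (by linarith)
  set ε : ℝ := 1 / (2 * M ^ 2 + 1) with hε
  have hε0 : 0 < ε := by positivity
  have hεM : ε * (2 * M ^ 2) < 1 := by
    rw [hε, one_div, inv_mul_lt_iff₀ (by positivity)]; linarith
  refine ⟨ε * (starRingEnd ℂ) d, ?_, fun h => ?_⟩
  · rw [norm_mul, Complex.norm_real, Real.norm_of_nonneg hε0.le, RCLike.norm_conj]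
    have := mul_le_mul_of_nonneg_left (mul_le_mul_of_nonneg_right hdM hM0) hε0.le
    nlinarith
  · have h2 : Complex.normSq (1 + ε * (starRingEnd ℂ) d * f x) =
        Complex.normSq (1 + ε * (starRingEnd ℂ) d * f y) := by
      rw [Complex.normSq_eq_norm_sq, Complex.normSq_eq_norm_sq, h]
    have h3 : ‖d‖ ^ 2 * (2 + ε * (‖f x‖ ^ 2 - ‖f y‖ ^ 2)) = 0 := by
      have h4 : ε * (‖d‖ ^ 2 * (2 + ε * (‖f x‖ ^ 2 - ‖f y‖ ^ 2))) = 0 := by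
        rw [← sub_eq_zero] at h2
        rw [← h2, ← Complex.normSq_eq_norm_sq, ← Complex.normSq_eq_norm_sq,
          ← Complex.normSq_eq_norm_sq, hd]
        simp only [Complex.normSq_apply, Complex.add_re, Complex.add_im, Complex.mul_re,
          Complex.mul_im, Complex.conj_re, Complex.conj_im, Complex.sub_re, Complex.sub_im,
          Complex.ofReal_re, Complex.ofReal_im, Complex.one_re, Complex.one_im]
        ring
      exact (mul_eq_zero.1 h4).resolve_left hε0.ne'
    have h5 : 0 < 2 + ε * (‖f x‖ ^ 2 - ‖f y‖ ^ 2) := by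
      have h6 : ‖f y‖ ^ 2 ≤ M ^ 2 := pow_le_pow_left₀ (norm_nonneg _) hy 2
      nlinarith [sq_nonneg ‖f x‖]
    exact (mul_pos (pow_pos hd0 2) h5).ne' h3

lemma one_add_ne_zero_of_norm_lt {z : ℂ} (hz : ‖z‖ < 1) : 1 + z ≠ 0 := fun h => by
  have : z = -1 := by linear_combination h
  rw [this, norm_neg, norm_one] at hz
  exact lt_irrefl _ hz

/-- Every homotopy class of nondegenerate fields is realised over a separating algebra. -/
theorem exists_joinedIn_nondeg_top {A : Subalgebra ℂ C(X, ℂ)} (hA : IsFull A)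
    (hc : IsClosed (A : Set C(X, ℂ))) (hsep : ∀ x y, x ≠ y → ∃ f ∈ A, f x ≠ f y)
    {v : C(X, ℂ) × C(X, ℂ) × C(X, ℂ)} (hv : ∀ x, 0 < reDot (at3 v x) (at3 v x)) :
    ∃ w ∈ nondeg A, JoinedIn (nondeg ⊤) v w := by
  set S : Set C(X, ℂ) := {b | b ∈ A ∧ ∀ x, b x ≠ 0} with hS
  set E := Algebra.adjoin ℂ ((A : Set C(X, ℂ)) ∪ (fun b => realMap (absMap b)) '' S) with hE
  have hEsep : ∀ x y, x ≠ y → ∃ p : C(X, ℝ), realMap p ∈ E ∧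
      p (ContinuousMap.id X x) ≠ p (ContinuousMap.id X y) := fun x y hxy => by
    obtain ⟨f, hf, hfxy⟩ := hsep x y hxy
    obtain ⟨z, hz, hzxy⟩ := exists_norm_one_add_smul_ne hfxy
    refine ⟨absMap (1 + z • f), Algebra.subset_adjoin (Or.inr ⟨1 + z • f, ⟨?_, fun x => ?_⟩, rfl⟩),
      hzxy⟩
    · exact A.add_mem A.one_mem (A.smul_mem hf z)
    · refine one_add_ne_zero_of_norm_lt (lt_of_le_of_lt ?_ hz)
      change ‖z * f x‖ ≤ _
      rw [norm_mul]
      exact mul_le_mul_of_nonneg_left (f.norm_coe_le_norm x) (norm_nonneg z)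
  obtain ⟨ε, hε, H⟩ := exists_forall_near_pos hv
  obtain ⟨h₁, hh₁, H₁⟩ := exists_approx_of_separates E (ContinuousMap.id X) hEsep v.1 hε
  obtain ⟨h₂, hh₂, H₂⟩ := exists_approx_of_separates E (ContinuousMap.id X) hEsep v.2.1 hε
  obtain ⟨h₃, hh₃, H₃⟩ := exists_approx_of_separates E (ContinuousMap.id X) hEsep v.2.2 hε
  have H' := H (h₁, h₂, h₃) fun x => max_lt (H₁ x) (max_lt (H₂ x) (H₃ x))
  obtain ⟨w, hw, hJ⟩ := exists_joinedIn_nondeg_of_mem_adjoin (v := (h₁, h₂, h₃)) hA hc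
    (S := S) (fun b hb => hb.1) (fun b hb => hb.2) (D := ⊤) le_top (fun _ _ _ _ _ => le_top)
    ⟨⟨hh₁, hh₂, hh₃⟩, fun x => (H' x).1⟩
  refine ⟨w, hw, (joinedIn_nondeg_of_reDot_pos (D := ⊤) ⟨⟨trivial, trivial, trivial⟩, hv⟩
    ⟨⟨trivial, trivial, trivial⟩, fun x => (H' x).1⟩ fun x => (H' x).2).trans hJ⟩

end Approximation

section Paths

open Topology

variable {X : Type*} [TopologicalSpace X] [CompactSpace X]

/-- The restriction of a function on `I × X` to a slice. -/
noncomputable def slice (τ : unitInterval) : C(unitInterval × X, ℂ) →ₐ[ℂ] C(X, ℂ) :=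
  ContinuousMap.compRightAlgHom ℂ ℂ ⟨fun x => (τ, x), by fun_prop⟩

@[simp] lemma slice_apply (τ : unitInterval) (f : C(unitInterval × X, ℂ)) (x : X) :
    slice τ f x = f (τ, x) := rfl

lemma continuous_slice (τ : unitInterval) : Continuous (slice (X := X) τ) :=
  ContinuousMap.continuous_precomp _

lemma continuous_slice_left (f : C(unitInterval × X, ℂ)) : Continuous fun τ => slice τ f :=
  f.curry.continuous

/-- The algebra of paths in a function algebra. -/
noncomputable def pathAlg (A : Subalgebra ℂ C(X, ℂ)) : Subalgebra ℂ C(unitInterval × X, ℂ) :=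
  ⨅ τ, A.comap (slice τ)

/-- The functions on `I × X` whose restrictions to the two ends belong to a function algebra. -/
noncomputable def endAlg (A : Subalgebra ℂ C(X, ℂ)) : Subalgebra ℂ C(unitInterval × X, ℂ) :=
  A.comap (slice 0) ⊓ A.comap (slice 1)

variable {A : Subalgebra ℂ C(X, ℂ)}

lemma mem_pathAlg {f : C(unitInterval × X, ℂ)} : f ∈ pathAlg A ↔ ∀ τ, slice τ f ∈ A := by
  simp [pathAlg, Algebra.mem_iInf]

lemma pathAlg_le_endAlg : pathAlg A ≤ endAlg A := fun _ hf =>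
  ⟨mem_pathAlg.1 hf 0, mem_pathAlg.1 hf 1⟩

lemma isClosed_pathAlg (hc : IsClosed (A : Set C(X, ℂ))) :
    IsClosed (pathAlg A : Set C(unitInterval × X, ℂ)) := by
  have : (pathAlg A : Set C(unitInterval × X, ℂ)) = ⋂ τ, slice τ ⁻¹' A := by
    ext f; simp [mem_pathAlg]
  rw [this]
  exact isClosed_iInter fun τ => hc.preimage (continuous_slice τ)

/-- A function of the parameter, as a function on `I × X`. -/
noncomputable def ofParam (k : C(unitInterval, ℂ)) : C(unitInterval × X, ℂ) := k.comp .fst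

/-- A function on `X`, as a function on `I × X`. -/
noncomputable def ofSpace (f : C(X, ℂ)) : C(unitInterval × X, ℂ) := f.comp .snd

lemma ofParam_mem (k : C(unitInterval, ℂ)) : ofParam k ∈ pathAlg A :=
  mem_pathAlg.2 fun τ => A.algebraMap_mem (k τ)

lemma ofSpace_mem {f : C(X, ℂ)} (hf : f ∈ A) : ofSpace f ∈ pathAlg A :=
  mem_pathAlg.2 fun _ => hf

lemma isFull_pathAlg (hA : IsFull A) (hc : IsClosed (A : Set C(X, ℂ))) : IsFull (pathAlg A) := by
  intro ψ
  let χ : C(unitInterval, ℂ) →ₐ[ℂ] ℂ := ψ.comp ((ContinuousMap.compRightAlgHom ℂ ℂ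
    (ContinuousMap.fst : C(unitInterval × X, unitInterval))).codRestrict (pathAlg A) ofParam_mem)
  obtain ⟨τ, hτ⟩ := (CharacterSpace.homeoEval unitInterval ℂ).surjective
    (CharacterSpace.equivAlgHom.symm χ)
  have hψ : ∀ k : C(unitInterval, ℂ), ψ ⟨ofParam k, ofParam_mem k⟩ = k τ := fun k =>
    (DFunLike.congr_fun hτ k).symm
  let θ : A →ₐ[ℂ] ℂ := ψ.comp (((ContinuousMap.compRightAlgHom ℂ ℂ
    (ContinuousMap.snd : C(unitInterval × X, X))).comp A.val).codRestrict (pathAlg A)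
      fun f => ofSpace_mem f.2)
  obtain ⟨x, hx⟩ := hA θ
  have hθ : ∀ f (hf : f ∈ A), ψ ⟨ofSpace f, ofSpace_mem hf⟩ = f x := fun f hf => hx ⟨f, hf⟩
  refine ⟨(τ, x), fun f => eq_of_forall_dist_le fun ε hε => ?_⟩
  obtain ⟨η, hη, H⟩ := Metric.continuous_iff.1 (continuous_slice_left f.1) τ ε hε
  have hfτ := mem_pathAlg.1 f.2 τ
  let k : C(unitInterval, ℂ) := ⟨fun y => ((max 0 (1 - dist y τ / η) : ℝ) : ℂ), by fun_prop⟩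
  have hkτ : k τ = 1 := by simp [k]
  have h1 := norm_algHom_le (isClosed_pathAlg hc) ψ
    ((f - ⟨_, ofSpace_mem hfτ⟩) * ⟨ofParam k, ofParam_mem k⟩)
  rw [map_mul, hψ, hkτ, mul_one, map_sub ψ f, hθ _ hfτ] at h1
  rw [dist_eq_norm]
  refine h1.trans ((ContinuousMap.norm_le _ hε.le).2 fun y => ?_)
  change ‖((f : C(unitInterval × X, ℂ)) (y.1, y.2) - (f : C(unitInterval × X, ℂ)) (τ, y.2)) *
    ((max 0 (1 - dist y.1 τ / η) : ℝ) : ℂ)‖ ≤ _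
  rw [norm_mul, Complex.norm_real, Real.norm_of_nonneg (le_max_left _ _)]
  rcases lt_or_ge (dist y.1 τ) η with hy | hy
  · have h5 : max 0 (1 - dist y.1 τ / η) ≤ 1 :=
      max_le zero_le_one (sub_le_self _ (by positivity))
    have h6 := (ContinuousMap.dist_apply_le_dist y.2).trans (H y.1 hy).le
    rw [dist_eq_norm] at h6
    calc _ ≤ ε * 1 := mul_le_mul h6 h5 (le_max_left _ _) hε.le
      _ = _ := mul_one _
  · rw [max_eq_left (sub_nonpos.2 ((one_le_div hη).2 hy)), mul_zero]
    exact hε.le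

/-- The restriction of a triple of functions on `I × X` to a slice. -/
noncomputable def slice3 (τ : unitInterval)
    (v : C(unitInterval × X, ℂ) × C(unitInterval × X, ℂ) × C(unitInterval × X, ℂ)) :
    C(X, ℂ) × C(X, ℂ) × C(X, ℂ) := map3 (slice τ) v

lemma at3_slice3 (τ : unitInterval)
    (v : C(unitInterval × X, ℂ) × C(unitInterval × X, ℂ) × C(unitInterval × X, ℂ)) (x : X) :
    at3 (slice3 τ v) x = at3 v (τ, x) := rfl

lemma continuous_slice3 (τ : unitInterval) : Continuous (slice3 (X := X) τ) :=
  continuous_map3 (continuous_slice τ)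

lemma joinedIn_slice3 {w : C(unitInterval × X, ℂ) × C(unitInterval × X, ℂ) ×
    C(unitInterval × X, ℂ)} (hw : w ∈ nondeg (pathAlg A)) :
    JoinedIn (nondeg A) (slice3 0 w) (slice3 1 w) := by
  have hcont : Continuous fun τ => slice3 τ w :=
    (continuous_slice_left w.1).prodMk ((continuous_slice_left w.2.1).prodMk
      (continuous_slice_left w.2.2))
  refine ⟨⟨⟨fun τ => slice3 τ w, hcont⟩, rfl, rfl⟩, fun τ => ⟨⟨?_, ?_, ?_⟩, fun x => hw.2 (τ, x)⟩⟩
  · exact mem_pathAlg.1 hw.1.1 τ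
  · exact mem_pathAlg.1 hw.1.2.1 τ
  · exact mem_pathAlg.1 hw.1.2.2 τ

lemma slice3_mem_nondeg {w : C(unitInterval × X, ℂ) × C(unitInterval × X, ℂ) ×
    C(unitInterval × X, ℂ)} (hw : w ∈ nondeg (endAlg A)) :
    slice3 0 w ∈ nondeg A ∧ slice3 1 w ∈ nondeg A :=
  ⟨⟨⟨hw.1.1.1, hw.1.2.1.1, hw.1.2.2.1⟩, fun x => hw.2 (0, x)⟩,
    ⟨⟨hw.1.1.2, hw.1.2.1.2, hw.1.2.2.2⟩, fun x => hw.2 (1, x)⟩⟩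

/-- The invertible paths which are trivial at both ends. -/
def trivialEnds (A : Subalgebra ℂ C(X, ℂ)) : Set C(unitInterval × X, ℂ) :=
  {b | b ∈ pathAlg A ∧ (∀ y, b y ≠ 0) ∧ ∀ x, b (0, x) = 1 ∧ b (1, x) = 1}

lemma locAlg_le_endAlg (hc : IsClosed (A : Set C(X, ℂ)))
    {A' : Subalgebra ℂ C(unitInterval × X, ℂ)} (hA' : A' ≤ endAlg A)
    {b : C(unitInterval × X, ℂ)} (hb : b ∈ trivialEnds A) : locAlg A' (absMap b) ≤ endAlg A := by
  intro f hf
  have key : ∀ τ : unitInterval, (∀ x, b (τ, x) = 1) → (∀ g ∈ A', slice τ g ∈ A) →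
      slice τ f ∈ A := fun τ hτ hg => by
    refine hc.closure_subset (Metric.mem_closure_iff.2 fun ε hε => ?_)
    obtain ⟨η, hη, g, hgA, H⟩ := hf (ε / 2) (half_pos hε) 1
    refine ⟨_, hg g hgA, ?_⟩
    rw [dist_eq_norm]
    refine lt_of_le_of_lt ((ContinuousMap.norm_le _ (half_pos hε).le).2 fun x => ?_)
      (half_lt_self hε)
    exact (H (τ, x) (by rw [absMap_apply, hτ]; simpa using hη)).le
  exact ⟨key 0 (fun x => (hb.2.2 x).1) fun g hg => (hA' hg).1,
    key 1 (fun x => (hb.2.2 x).2) fun g hg => (hA' hg).2⟩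

lemma exists_separating_function (hsep : ∀ x y, x ≠ y → ∃ f ∈ A, f x ≠ f y)
    {y y' : unitInterval × X} (hy : 1 / 3 ≤ (y.1 : ℝ) ∧ (y.1 : ℝ) ≤ 2 / 3) (hne : y ≠ y') :
    ∃ p : C(unitInterval × X, ℝ), realMap p ∈ Algebra.adjoin ℂ
      ((pathAlg A : Set C(unitInterval × X, ℂ)) ∪ (fun b => realMap (absMap b)) '' trivialEnds A) ∧
      p y ≠ p y' := by
  obtain ⟨τ, x⟩ := y
  obtain ⟨τ', x'⟩ := y'
  rcases eq_or_ne τ τ' with rfl | hτ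
  · have hx : x ≠ x' := fun h => hne (by rw [h])
    obtain ⟨f, hf, hfx⟩ := hsep x x' hx
    obtain ⟨z, hz, hzx⟩ := exists_norm_one_add_smul_ne hfx
    let κ : C(unitInterval, ℂ) :=
      ⟨fun τ => ((ramp 0 (1 / 3) τ - ramp (2 / 3) 1 τ : ℝ) : ℂ), by fun_prop⟩
    have hκ : ∀ τ, ‖κ τ‖ ≤ 1 := fun τ => by
      change ‖((ramp 0 (1 / 3) τ - ramp (2 / 3) 1 τ : ℝ) : ℂ)‖ ≤ 1
      rw [Complex.norm_real, Real.norm_eq_abs, abs_le]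
      have h1 := ramp_mem 0 (1 / 3) τ
      have h2 := ramp_mem (2 / 3) 1 τ
      constructor <;> linarith [h1.1, h1.2, h2.1, h2.2]
    have hκτ : κ τ = 1 := by
      change ((ramp 0 (1 / 3) τ - ramp (2 / 3) 1 τ : ℝ) : ℂ) = 1
      rw [ramp_of_ge (by norm_num) hy.1, ramp_of_le (by norm_num) hy.2]
      simp
    have hκ0 : κ 0 = 0 := by
      change ((ramp 0 (1 / 3) (0 : ℝ) - ramp (2 / 3) 1 (0 : ℝ) : ℝ) : ℂ) = 0
      rw [ramp_of_le (by norm_num) le_rfl, ramp_of_le (by norm_num) (by norm_num)]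
      simp
    have hκ1 : κ 1 = 0 := by
      change ((ramp 0 (1 / 3) (1 : ℝ) - ramp (2 / 3) 1 (1 : ℝ) : ℝ) : ℂ) = 0
      rw [ramp_of_ge (by norm_num) (by norm_num), ramp_of_ge (by norm_num) le_rfl]
      simp
    set b : C(unitInterval × X, ℂ) := 1 + ofParam κ * ofSpace (z • f) with hb
    have hby : ∀ y, b y = 1 + κ y.1 * (z * f y.2) := fun y => rfl
    have hbS : b ∈ trivialEnds A := by
      refine ⟨(pathAlg A).add_mem (pathAlg A).one_mem ((pathAlg A).mul_mem (ofParam_mem κ)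
        (ofSpace_mem (A.smul_mem hf z))), fun y => ?_, fun x => ?_⟩
      · rw [hby]
        refine one_add_ne_zero_of_norm_lt (lt_of_le_of_lt ?_ hz)
        rw [norm_mul, norm_mul, ← one_mul (‖z‖ * ‖f‖)]
        exact mul_le_mul (hκ _) (mul_le_mul_of_nonneg_left (f.norm_coe_le_norm _) (norm_nonneg z))
          (by positivity) zero_le_one
      · rw [hby, hby, hκ0, hκ1]; simp
    refine ⟨absMap b, Algebra.subset_adjoin (Or.inr ⟨b, hbS, rfl⟩), ?_⟩
    rw [absMap_apply, absMap_apply, hby, hby, hκτ, one_mul, one_mul]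
    exact hzx
  · refine ⟨⟨fun y => (y.1 : ℝ), by fun_prop⟩, Algebra.subset_adjoin (Or.inl ?_), fun h =>
      hτ (Subtype.ext h)⟩
    exact ofParam_mem ⟨fun τ => ((τ : ℝ) : ℂ), by fun_prop⟩

/-- Homotopic nondegenerate fields over a separating algebra are homotopic over that algebra. -/
theorem joinedIn_nondeg_of_top (hA : IsFull A) (hc : IsClosed (A : Set C(X, ℂ)))
    (hsep : ∀ x y, x ≠ y → ∃ f ∈ A, f x ≠ f y) {v₀ v₁ : C(X, ℂ) × C(X, ℂ) × C(X, ℂ)}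
    (h₀ : v₀ ∈ nondeg A) (h₁ : v₁ ∈ nondeg A) (h : JoinedIn (nondeg ⊤) v₀ v₁) :
    JoinedIn (nondeg A) v₀ v₁ := by
  obtain ⟨γ, hγ⟩ := h
  set E := Algebra.adjoin ℂ ((pathAlg A : Set C(unitInterval × X, ℂ)) ∪
    (fun b => realMap (absMap b)) '' trivialEnds A) with hE
  have hAE : pathAlg A ≤ E := fun f hf => Algebra.subset_adjoin (Or.inl hf)
  let G : unitInterval → C(X, ℂ) × C(X, ℂ) × C(X, ℂ) := fun τ => γ.extend (ramp (2 / 5) (3 / 5) τ)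
  have hG : Continuous G := by fun_prop
  have hGn : ∀ τ x, 0 < reDot (at3 (G τ) x) (at3 (G τ) x) := fun τ x =>
    (hγ (Set.projIcc 0 1 zero_le_one _)).2 x
  have hG0 : ∀ τ : unitInterval, (τ : ℝ) ≤ 2 / 5 → G τ = v₀ := fun τ hτ => by
    simp only [G]
    rw [ramp_of_le (by norm_num) hτ, γ.extend_zero]
  have hG1 : ∀ τ : unitInterval, 3 / 5 ≤ (τ : ℝ) → G τ = v₁ := fun τ hτ => by
    simp only [G]
    rw [ramp_of_ge (by norm_num) hτ, γ.extend_one]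
  have hGc : Continuous fun y : unitInterval × X => at3 (G y.1) y.2 :=
    continuous_at3.comp ((hG.comp continuous_fst).prodMk continuous_snd)
  let H : C(unitInterval × X, ℂ) × C(unitInterval × X, ℂ) × C(unitInterval × X, ℂ) :=
    (⟨_, hGc.fst⟩, ⟨_, hGc.snd.fst⟩, ⟨_, hGc.snd.snd⟩)
  have hH : ∀ y, at3 H y = at3 (G y.1) y.2 := fun y => rfl
  obtain ⟨ε, hε, hnear⟩ := exists_forall_near_pos (v := H) fun y => hGn y.1 y.2
  let Y := {y : unitInterval × X // 1 / 3 ≤ (y.1 : ℝ) ∧ (y.1 : ℝ) ≤ 2 / 3}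
  have hfst : Continuous fun y : unitInterval × X => (y.1 : ℝ) := by fun_prop
  have hYc : IsClosed {y : unitInterval × X | 1 / 3 ≤ (y.1 : ℝ) ∧ (y.1 : ℝ) ≤ 2 / 3} :=
    (isClosed_le continuous_const hfst).inter (isClosed_le hfst continuous_const)
  have : CompactSpace Y := isCompact_iff_compactSpace.1 hYc.isCompact
  let j : C(Y, unitInterval × X) := ⟨Subtype.val, continuous_subtype_val⟩
  have hjsep : ∀ y y' : Y, y ≠ y' → ∃ p : C(unitInterval × X, ℝ), realMap p ∈ E ∧
      p (j y) ≠ p (j y') := fun y y' hy =>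
    exists_separating_function hsep y.2 fun h => hy (Subtype.ext h)
  obtain ⟨f₁, hf₁, F₁⟩ := exists_approx_of_separates E j hjsep (H.1.comp j) hε
  obtain ⟨f₂, hf₂, F₂⟩ := exists_approx_of_separates E j hjsep (H.2.1.comp j) hε
  obtain ⟨f₃, hf₃, F₃⟩ := exists_approx_of_separates E j hjsep (H.2.2.comp j) hε
  let χL : C(unitInterval, ℂ) := ⟨fun τ => ((1 - ramp (1 / 3) (2 / 5) τ : ℝ) : ℂ), by fun_prop⟩
  let χR : C(unitInterval, ℂ) := ⟨fun τ => ((ramp (3 / 5) (2 / 3) τ : ℝ) : ℂ), by fun_prop⟩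
  let χ : C(unitInterval, ℂ) :=
    ⟨fun τ => ((ramp (1 / 3) (2 / 5) τ - ramp (3 / 5) (2 / 3) τ : ℝ) : ℂ), by fun_prop⟩
  let comb : C(unitInterval × X, ℂ) → C(X, ℂ) → C(X, ℂ) → C(unitInterval × X, ℂ) := fun f g g' =>
    ofParam χ * f + (ofParam χL * ofSpace g + ofParam χR * ofSpace g')
  have hcomb : ∀ {f g g'}, f ∈ E → g ∈ A → g' ∈ A → comb f g g' ∈ E := fun hf hg hg' =>
    E.add_mem (E.mul_mem (hAE (ofParam_mem _)) hf) (hAE ((pathAlg A).add_mem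
      ((pathAlg A).mul_mem (ofParam_mem _) (ofSpace_mem hg))
      ((pathAlg A).mul_mem (ofParam_mem _) (ofSpace_mem hg'))))
  let H₁ : C(unitInterval × X, ℂ) × C(unitInterval × X, ℂ) × C(unitInterval × X, ℂ) :=
    (comb f₁ v₀.1 v₁.1, comb f₂ v₀.2.1 v₁.2.1, comb f₃ v₀.2.2 v₁.2.2)
  have hH₁ : ∀ y, at3 H₁ y = χ y.1 • at3 (f₁, f₂, f₃) y +
      (χL y.1 • at3 v₀ y.2 + χR y.1 • at3 v₁ y.2) := fun y => rfl
  have hL : ∀ τ, χL τ = ((1 - ramp (1 / 3) (2 / 5) τ : ℝ) : ℂ) := fun τ => rfl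
  have hR : ∀ τ, χR τ = ((ramp (3 / 5) (2 / 3) τ : ℝ) : ℂ) := fun τ => rfl
  have hM : ∀ τ, χ τ = ((ramp (1 / 3) (2 / 5) τ - ramp (3 / 5) (2 / 3) τ : ℝ) : ℂ) := fun τ => rfl
  have hHdec : ∀ y, at3 H y = χ y.1 • at3 H y +
      (χL y.1 • at3 v₀ y.2 + χR y.1 • at3 v₁ y.2) := fun y => by
    rw [hH]
    have e1 : χL y.1 • at3 v₀ y.2 = χL y.1 • at3 (G y.1) y.2 := by
      rcases le_total (y.1 : ℝ) (2 / 5) with hy | hy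
      · rw [hG0 _ hy]
      · rw [hL, ramp_of_ge (by norm_num) hy, sub_self, Complex.ofReal_zero, zero_smul, zero_smul]
    have e2 : χR y.1 • at3 v₁ y.2 = χR y.1 • at3 (G y.1) y.2 := by
      rcases le_total (3 / 5) (y.1 : ℝ) with hy | hy
      · rw [hG1 _ hy]
      · rw [hR, ramp_of_le (by norm_num) hy, Complex.ofReal_zero, zero_smul, zero_smul]
    have e3 : χ y.1 + (χL y.1 + χR y.1) = 1 := by
      rw [hL, hR, hM]; push_cast; ring
    rw [e1, e2, ← add_smul, ← add_smul, e3, one_smul]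
  have hχ : ∀ τ, ‖χ τ‖ ≤ 1 := fun τ => by
    rw [hM, Complex.norm_real, Real.norm_eq_abs, abs_le]
    have h1 := ramp_mem (1 / 3) (2 / 5) τ
    have h2 := ramp_mem (3 / 5) (2 / 3) τ
    constructor <;> linarith [h1.1, h1.2, h2.1, h2.2]
  have hχ0 : ∀ τ : unitInterval, (τ : ℝ) ≤ 1 / 3 → χ τ = 0 := fun τ hτ => by
    rw [hM, ramp_of_le (by norm_num) hτ, ramp_of_le (by norm_num) (by linarith)]
    simp
  have hχ1 : ∀ τ : unitInterval, 2 / 3 ≤ (τ : ℝ) → χ τ = 0 := fun τ hτ => by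
    rw [hM, ramp_of_ge (by norm_num) (by linarith), ramp_of_ge (by norm_num) hτ]
    simp
  have hclose : ∀ y, ‖at3 H₁ y - at3 H y‖ < ε := fun y => by
    have e : at3 H₁ y - at3 H y = χ y.1 • (at3 (f₁, f₂, f₃) y - at3 H y) := by
      rw [hHdec y, hH₁, add_sub_add_right_eq_sub, ← smul_sub, ← hHdec y]
    rw [e, norm_smul]
    rcases le_total (y.1 : ℝ) (1 / 3) with hy | hy
    · rw [hχ0 _ hy, norm_zero, zero_mul]; exact hε
    rcases le_total (2 / 3) (y.1 : ℝ) with hy' | hy'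
    · rw [hχ1 _ hy', norm_zero, zero_mul]; exact hε
    · refine (mul_le_of_le_one_left (norm_nonneg _) (hχ _)).trans_lt ?_
      exact max_lt (F₁ ⟨y, hy, hy'⟩) (max_lt (F₂ ⟨y, hy, hy'⟩) (F₃ ⟨y, hy, hy'⟩))
  have hH₁E : H₁ ∈ nondeg E := ⟨⟨hcomb hf₁ h₀.1.1 h₁.1.1, hcomb hf₂ h₀.1.2.1 h₁.1.2.1,
    hcomb hf₃ h₀.1.2.2 h₁.1.2.2⟩, fun y => (hnear H₁ hclose y).1⟩
  obtain ⟨w, hw, hJ⟩ := exists_joinedIn_nondeg_of_mem_adjoin (isFull_pathAlg hA hc)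
    (isClosed_pathAlg hc) (S := trivialEnds A) (fun b hb => hb.1) (fun b hb => hb.2.1)
    pathAlg_le_endAlg (fun A' _ hA' b hb => locAlg_le_endAlg hc hA' hb) hH₁E
  have ext3 : ∀ {a a' : C(X, ℂ) × C(X, ℂ) × C(X, ℂ)}, (∀ x, at3 a x = at3 a' x) → a = a' :=
    fun ha => by
      refine Prod.ext ?_ (Prod.ext ?_ ?_) <;> ext x
      · exact congrArg Prod.fst (ha x)
      · exact congrArg (fun z => z.2.1) (ha x)
      · exact congrArg (fun z => z.2.2) (ha x)
  have e0 : slice3 0 H₁ = v₀ := ext3 fun x => by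
    rw [at3_slice3, hH₁, hL, hR, hχ0 _ (by norm_num)]
    rw [ramp_of_le (by norm_num) (by norm_num), ramp_of_le (by norm_num) (by norm_num)]
    simp
  have e1 : slice3 1 H₁ = v₁ := ext3 fun x => by
    rw [at3_slice3, hH₁, hL, hR, hχ1 _ (by norm_num)]
    rw [ramp_of_ge (by norm_num) (by norm_num), ramp_of_ge (by norm_num) (by norm_num)]
    simp
  have hJ0 : JoinedIn (nondeg A) v₀ (slice3 0 w) := by
    have := (hJ.map (continuous_slice3 0)).mono (V := nondeg A)
      (by rintro _ ⟨a, ha, rfl⟩; exact (slice3_mem_nondeg ha).1)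
    rwa [e0] at this
  have hJ1 : JoinedIn (nondeg A) v₁ (slice3 1 w) := by
    have := (hJ.map (continuous_slice3 1)).mono (V := nondeg A)
      (by rintro _ ⟨a, ha, rfl⟩; exact (slice3_mem_nondeg ha).2)
    rwa [e1] at this
  exact (hJ0.trans (joinedIn_slice3 hw)).trans hJ1.symm

end Paths

section GelfandAlgebra

variable (𝒜 : Type*) [NormedCommRing 𝒜] [NormedAlgebra ℂ 𝒜] [CompleteSpace 𝒜]

/-- The uniform closure of the algebra of Gelfand transforms. -/
noncomputable def gelfandAlg : Subalgebra ℂ C(characterSpace ℂ 𝒜, ℂ) :=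
  (gelfandTransform ℂ 𝒜).range.topologicalClosure

/-- The Gelfand transform, with values in the uniform closure of its range. -/
noncomputable def toGelfandAlg : 𝒜 →ₐ[ℂ] gelfandAlg 𝒜 :=
  (gelfandTransform ℂ 𝒜).codRestrict _ fun a => Subalgebra.le_topologicalClosure _ ⟨a, rfl⟩

lemma isClosed_gelfandAlg : IsClosed (gelfandAlg 𝒜 : Set C(characterSpace ℂ 𝒜, ℂ)) :=
  Subalgebra.isClosed_topologicalClosure _

instance : CompleteSpace (gelfandAlg 𝒜) := (isClosed_gelfandAlg 𝒜).completeSpace_coe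

lemma denseRange_toGelfandAlg : DenseRange (toGelfandAlg 𝒜) := by
  intro y
  refine Metric.mem_closure_iff.2 fun ε hε => ?_
  have hy : y.1 ∈ closure ((gelfandTransform ℂ 𝒜).range : Set C(characterSpace ℂ 𝒜, ℂ)) := y.2
  obtain ⟨_, ⟨a, rfl⟩, ha⟩ := Metric.mem_closure_iff.1 hy ε hε
  exact ⟨_, ⟨a, rfl⟩, ha⟩

lemma isFull_gelfandAlg : IsFull (gelfandAlg 𝒜) := by
  intro ψ
  refine ⟨CharacterSpace.equivAlgHom.symm (ψ.comp (toGelfandAlg 𝒜)), fun f => ?_⟩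
  have h : (ψ : gelfandAlg 𝒜 → ℂ) = fun f => f.1 (CharacterSpace.equivAlgHom.symm
      (ψ.comp (toGelfandAlg 𝒜))) := by
    refine (denseRange_toGelfandAlg 𝒜).equalizer (map_continuous ψ) ?_ rfl
    exact (continuous_eval_const _).comp continuous_subtype_val
  exact congrFun h f

lemma separates_gelfandAlg (x y : characterSpace ℂ 𝒜) (h : x ≠ y) :
    ∃ f ∈ gelfandAlg 𝒜, f x ≠ f y := by
  by_contra! H
  exact h (CharacterSpace.ext fun a => H _ (toGelfandAlg 𝒜 a).2)

end GelfandAlgebra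

section Lift

variable {X : Type*} [TopologicalSpace X] [CompactSpace X] {D : Subalgebra ℂ C(X, ℂ)}

lemma joinedIn_preimage_incl3 {v w : D × D × D}
    (h : JoinedIn (nondeg D) (incl3 D v) (incl3 D w)) :
    JoinedIn (incl3 D ⁻¹' nondeg D) v w := by
  obtain ⟨γ, hγ⟩ := h
  let δ : unitInterval → D × D × D := fun t =>
    (⟨(γ t).1, (hγ t).1.1⟩, ⟨(γ t).2.1, (hγ t).1.2.1⟩, ⟨(γ t).2.2, (hγ t).1.2.2⟩)
  have hδ : Continuous δ := by
    refine Continuous.prodMk ?_ (Continuous.prodMk ?_ ?_) <;>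
      exact Continuous.subtype_mk (by fun_prop) _
  refine ⟨⟨⟨δ, hδ⟩, ?_, ?_⟩, fun t => hγ t⟩
  · have h := γ.source
    exact Prod.ext (Subtype.ext congr($h.1)) (Prod.ext (Subtype.ext congr($h.2.1))
      (Subtype.ext congr($h.2.2)))
  · have h := γ.target
    exact Prod.ext (Subtype.ext congr($h.1)) (Prod.ext (Subtype.ext congr($h.2.1))
      (Subtype.ext congr($h.2.2)))

lemma incl3_mem_nondeg_iff (hD : IsFull D) {v : D × D × D} :
    incl3 D v ∈ nondeg D ↔ dot3 v v ∈ _root_.posPart D := by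
  constructor
  · intro h ψ
    obtain ⟨x, hx⟩ := hD ψ
    rw [hx, ← dot3_incl3]
    exact h.2 x
  · intro h
    refine ⟨incl3_mem v, fun x => ?_⟩
    rw [reDot, dot3_incl3]
    exact h (evalHom D x)

lemma isOpen_preimage_incl3 [CompleteSpace D] (hD : IsFull D) :
    IsOpen (incl3 D ⁻¹' nondeg D) := by
  have : incl3 D ⁻¹' nondeg D = (fun v => dot3 v v) ⁻¹' _root_.posPart D :=
    Set.ext fun v => incl3_mem_nondeg_iff hD
  rw [this]
  exact isOpen_posPart.preimage (continuous_dot3 continuous_id continuous_id)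

lemma joinedIn_preimage_of_joinedIn_incl3 {V : Type*} [AddCommGroup V] [Module ℝ V]
    [TopologicalSpace V] [ContinuousAdd V] [ContinuousSMul ℝ V] [CompleteSpace D]
    (hD : IsFull D) (T : V →ₗ[ℝ] D × D × D) (hT : DenseRange T) {a b : V}
    (h : JoinedIn (nondeg D) (incl3 D (T a)) (incl3 D (T b))) :
    JoinedIn (T ⁻¹' (incl3 D ⁻¹' nondeg D)) a b :=
  joinedIn_preimage_of_denseRange T hT (isOpen_preimage_incl3 hD) (joinedIn_preimage_incl3 h)

lemma exists_joinedIn_incl3 {V : Type*} [CompleteSpace D] (hD : IsFull D) {T : V → D × D × D}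
    (hT : DenseRange T) {w : C(X, ℂ) × C(X, ℂ) × C(X, ℂ)} (hw : w ∈ nondeg D) :
    ∃ a, JoinedIn (nondeg D) w (incl3 D (T a)) := by
  obtain ⟨w, rfl⟩ := exists_incl3 hw.1
  obtain ⟨ε, hε, hball⟩ := Metric.isOpen_iff.1 (isOpen_preimage_incl3 hD) w hw
  obtain ⟨a, ha⟩ := hT.exists_dist_lt w hε
  have hj : JoinedIn (Metric.ball w ε) w (T a) :=
    JoinedIn.of_segment_subset ((convex_ball w ε).segment_subset (Metric.mem_ball_self hε)
      (by rwa [Metric.mem_ball, dist_comm]))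
  have hj' := (hj.mono hball).map_continuousOn (f := incl3 D) continuous_incl3.continuousOn
  exact ⟨a, hj'.mono (Set.image_preimage_subset _ _)⟩

end Lift

section GelfandTriples

variable {𝒜 : Type*} [NormedCommRing 𝒜] [NormedAlgebra ℂ 𝒜] [CompleteSpace 𝒜]

/-- The Gelfand transform of a triple. -/
noncomputable def gelfand3 (a : 𝒜 × 𝒜 × 𝒜) : C(characterSpace ℂ 𝒜, ℂ) ×
    C(characterSpace ℂ 𝒜, ℂ) × C(characterSpace ℂ 𝒜, ℂ) := map3 (gelfandTransform ℂ 𝒜) a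

variable (𝒜) in
/-- The Gelfand transform of a triple, with values in the uniform closure of the range. -/
noncomputable def toGelfandAlg3 :
    𝒜 × 𝒜 × 𝒜 →ₗ[ℝ] gelfandAlg 𝒜 × gelfandAlg 𝒜 × gelfandAlg 𝒜 :=
  map3Linear (R := 𝒜) (S := gelfandAlg 𝒜) (toGelfandAlg 𝒜)

lemma incl3_toGelfandAlg3 (a : 𝒜 × 𝒜 × 𝒜) :
    incl3 (gelfandAlg 𝒜) (toGelfandAlg3 𝒜 a) = gelfand3 a := rfl

lemma dot3_gelfand3 (a b : 𝒜 × 𝒜 × 𝒜) (x : characterSpace ℂ 𝒜) :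
    dot3 (at3 (gelfand3 a) x) (at3 (gelfand3 b) x) = x (dot3 a b) := by
  exact (map_dot3 (CharacterSpace.toAlgHom x) a b).symm

lemma gelfand3_mem_nondeg_iff {a : 𝒜 × 𝒜 × 𝒜} :
    gelfand3 a ∈ nondeg (gelfandAlg 𝒜) ↔ dot3 a a ∈ _root_.posPart 𝒜 := by
  constructor
  · intro h ψ
    have := h.2 (CharacterSpace.equivAlgHom.symm ψ)
    rwa [reDot, dot3_gelfand3] at this
  · intro h
    refine ⟨incl3_mem (D := gelfandAlg 𝒜) (toGelfandAlg3 𝒜 a), fun x => ?_⟩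
    rw [reDot, dot3_gelfand3]
    exact h (CharacterSpace.toAlgHom x)

lemma denseRange_toGelfandAlg3 : DenseRange (toGelfandAlg3 𝒜) :=
  (denseRange_toGelfandAlg 𝒜).prodMap
    ((denseRange_toGelfandAlg 𝒜).prodMap (denseRange_toGelfandAlg 𝒜))

lemma preimage_toGelfandAlg3 : toGelfandAlg3 𝒜 ⁻¹' (incl3 (gelfandAlg 𝒜) ⁻¹'
    nondeg (gelfandAlg 𝒜)) = {a : 𝒜 × 𝒜 × 𝒜 | dot3 a a ∈ _root_.posPart 𝒜} :=
  Set.ext fun _ => gelfand3_mem_nondeg_iff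

/-- Nondegenerate triples with homotopic Gelfand transforms are homotopic. -/
lemma joinedIn_of_joinedIn_gelfand3 {a b : 𝒜 × 𝒜 × 𝒜} (ha : dot3 a a ∈ _root_.posPart 𝒜)
    (hb : dot3 b b ∈ _root_.posPart 𝒜) (h : JoinedIn (nondeg ⊤) (gelfand3 a) (gelfand3 b)) :
    JoinedIn {a : 𝒜 × 𝒜 × 𝒜 | dot3 a a ∈ _root_.posPart 𝒜} a b := by
  have h' := joinedIn_nondeg_of_top (isFull_gelfandAlg 𝒜) (isClosed_gelfandAlg 𝒜)
    (separates_gelfandAlg 𝒜) (gelfand3_mem_nondeg_iff.2 ha) (gelfand3_mem_nondeg_iff.2 hb) h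
  rw [← preimage_toGelfandAlg3]
  exact joinedIn_preimage_of_joinedIn_incl3 (isFull_gelfandAlg 𝒜) (toGelfandAlg3 𝒜)
    denseRange_toGelfandAlg3 h'

/-- Every nondegenerate triple of continuous functions is homotopic to a Gelfand transform. -/
lemma exists_joinedIn_gelfand3 {v : C(characterSpace ℂ 𝒜, ℂ) × C(characterSpace ℂ 𝒜, ℂ) ×
    C(characterSpace ℂ 𝒜, ℂ)} (hv : ∀ x, 0 < reDot (at3 v x) (at3 v x)) :
    ∃ a : 𝒜 × 𝒜 × 𝒜, dot3 a a ∈ _root_.posPart 𝒜 ∧ JoinedIn (nondeg ⊤) v (gelfand3 a) := by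
  obtain ⟨w, hw, hvw⟩ := exists_joinedIn_nondeg_top (isFull_gelfandAlg 𝒜) (isClosed_gelfandAlg 𝒜)
    (separates_gelfandAlg 𝒜) hv
  obtain ⟨a, ha⟩ := exists_joinedIn_incl3 (isFull_gelfandAlg 𝒜) denseRange_toGelfandAlg3 hw
  rw [incl3_toGelfandAlg3] at ha
  exact ⟨a, gelfand3_mem_nondeg_iff.1 ha.target_mem, hvw.trans (ha.mono (nondeg_mono le_top))⟩

end GelfandTriples

section Direction

/-- The real part of the vector of coordinates of a complex triple in a basis in which the
trace form is a sum of squares. -/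
noncomputable def reVec (v : ℂ × ℂ × ℂ) : EuclideanSpace ℝ (Fin 3) :=
  !₂[v.1.re, (v.2.1.re + v.2.2.re) / 2, (v.2.1.im - v.2.2.im) / 2]

/-- The complex triple whose vector of coordinates is a given real vector. -/
noncomputable def tripleOf (y : EuclideanSpace ℝ (Fin 3)) : ℂ × ℂ × ℂ :=
  (y 0, y 1 + y 2 * Complex.I, y 1 - y 2 * Complex.I)

lemma continuous_reVec : Continuous reVec := by
  unfold reVec
  refine (PiLp.continuous_toLp 2 _).comp (continuous_pi fun i => ?_)
  fin_cases i <;> simp <;> fun_prop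

lemma reVec_tripleOf (y : EuclideanSpace ℝ (Fin 3)) : reVec (tripleOf y) = y := by
  ext i
  fin_cases i <;> simp [reVec, tripleOf]

lemma dot3_tripleOf (y : EuclideanSpace ℝ (Fin 3)) :
    dot3 (tripleOf y) (tripleOf y) = (2 * ‖y‖ ^ 2 : ℝ) := by
  rw [EuclideanSpace.norm_sq_eq, Fin.sum_univ_three]
  simp only [dot3, tripleOf, Real.norm_eq_abs, sq_abs]
  push_cast
  linear_combination (-2 * (y 2 : ℂ) ^ 2) * Complex.I_sq

lemma reDot_tripleOf (v : ℂ × ℂ × ℂ) (y : EuclideanSpace ℝ (Fin 3)) :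
    reDot v (tripleOf y) = 2 * inner ℝ (reVec v) y := by
  simp [reDot, dot3, tripleOf, reVec, PiLp.inner_apply, Fin.sum_univ_three]
  ring

lemma reVec_ne_zero {v : ℂ × ℂ × ℂ} (h : 0 < reDot v v) : reVec v ≠ 0 := by
  intro h0
  have e0 := congr($h0 0)
  have e1 := congr($h0 1)
  have e2 := congr($h0 2)
  simp [reVec] at e0 e1 e2
  simp [reDot, dot3] at h
  rw [e0, eq_neg_of_add_eq_zero_right e1, ← sub_eq_zero.1 e2] at h
  nlinarith [sq_nonneg v.1.im, sq_nonneg (v.2.1.re), sq_nonneg (v.2.1.im)]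

/-- The direction of a nonzero vector. -/
noncomputable def unitDir (y : EuclideanSpace ℝ (Fin 3)) (hy : y ≠ 0) : TwoSphere :=
  ⟨‖y‖⁻¹ • y, by simp [norm_smul, hy]⟩

variable {X : Type*} [TopologicalSpace X] [CompactSpace X]

/-- The map to the sphere given by a nondegenerate triple of functions. -/
noncomputable def dirMap (v : C(X, ℂ) × C(X, ℂ) × C(X, ℂ))
    (hv : ∀ x, 0 < reDot (at3 v x) (at3 v x)) : C(X, TwoSphere) where
  toFun x := unitDir (reVec (at3 v x)) (reVec_ne_zero (hv x))
  continuous_toFun := by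
    have h : Continuous fun x => reVec (at3 v x) :=
      continuous_reVec.comp (continuous_at3.comp (Continuous.prodMk_right v))
    exact ((h.norm.inv₀ fun x => norm_ne_zero_iff.2 (reVec_ne_zero (hv x))).smul h).subtype_mk _

/-- The triple of functions given by a map to the sphere. -/
noncomputable def fieldOf (F : C(X, TwoSphere)) : C(X, ℂ) × C(X, ℂ) × C(X, ℂ) :=
  ((⟨fun y : TwoSphere => (tripleOf y).1, by unfold tripleOf; fun_prop⟩ : C(TwoSphere, ℂ)).comp F,
    (⟨fun y : TwoSphere => (tripleOf y).2.1, by unfold tripleOf; fun_prop⟩ :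
      C(TwoSphere, ℂ)).comp F,
    (⟨fun y : TwoSphere => (tripleOf y).2.2, by unfold tripleOf; fun_prop⟩ :
      C(TwoSphere, ℂ)).comp F)

lemma at3_fieldOf (F : C(X, TwoSphere)) (x : X) : at3 (fieldOf F) x = tripleOf (F x) := rfl

lemma continuous_fieldOf : Continuous (fieldOf : C(X, TwoSphere) → _) :=
  (ContinuousMap.continuous_postcomp _).prodMk ((ContinuousMap.continuous_postcomp _).prodMk
    (ContinuousMap.continuous_postcomp _))

lemma fieldOf_mem_nondeg (F : C(X, TwoSphere)) : fieldOf F ∈ nondeg (X := X) ⊤ := by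
  refine ⟨⟨trivial, trivial, trivial⟩, fun x => ?_⟩
  have h : ‖(F x : EuclideanSpace ℝ (Fin 3))‖ = 1 := by simp
  rw [at3_fieldOf, reDot, dot3_tripleOf, h]
  norm_num

lemma dirMap_fieldOf (F : C(X, TwoSphere)) : dirMap (fieldOf F) (fieldOf_mem_nondeg F).2 = F := by
  ext1 x
  refine Subtype.ext ?_
  simp [dirMap, unitDir, at3_fieldOf, reVec_tripleOf]

/-- Homotopic maps to the sphere give homotopic triples. -/
lemma joinedIn_fieldOf {F G : C(X, TwoSphere)} (h : F.Homotopic G) :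
    JoinedIn (nondeg ⊤) (fieldOf F) (fieldOf G) := by
  obtain ⟨H⟩ := h
  refine ⟨⟨⟨fun t => fieldOf (H.curry t), continuous_fieldOf.comp H.curry.continuous⟩, ?_, ?_⟩,
    fun t => fieldOf_mem_nondeg _⟩
  · exact congrArg fieldOf (by ext1 x; simp)
  · exact congrArg fieldOf (by ext1 x; simp)

/-- A nondegenerate triple is homotopic to the one given by its map to the sphere. -/
lemma joinedIn_fieldOf_dirMap {v : C(X, ℂ) × C(X, ℂ) × C(X, ℂ)}
    (hv : ∀ x, 0 < reDot (at3 v x) (at3 v x)) :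
    JoinedIn (nondeg ⊤) v (fieldOf (dirMap v hv)) := by
  refine joinedIn_nondeg_of_reDot_pos ⟨⟨trivial, trivial, trivial⟩, hv⟩ (fieldOf_mem_nondeg _)
    fun x => ?_
  have h0 : 0 < ‖reVec (at3 v x)‖ := norm_pos_iff.2 (reVec_ne_zero (hv x))
  have : ((dirMap v hv x : TwoSphere) : EuclideanSpace ℝ (Fin 3)) =
    ‖reVec (at3 v x)‖⁻¹ • reVec (at3 v x) := rfl
  rw [at3_fieldOf, reDot_tripleOf, this, inner_smul_right, real_inner_self_eq_norm_sq]
  positivity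

/-- Homotopic nondegenerate triples give homotopic maps to the sphere. -/
lemma homotopic_dirMap {v w : C(X, ℂ) × C(X, ℂ) × C(X, ℂ)} (h : JoinedIn (nondeg ⊤) v w) :
    (dirMap v h.source_mem.2).Homotopic (dirMap w h.target_mem.2) := by
  obtain ⟨γ, hγ⟩ := id h
  have hc : Continuous fun p : unitInterval × X => reVec (at3 (γ p.1) p.2) :=
    continuous_reVec.comp (continuous_at3.comp
      ((γ.continuous.comp continuous_fst).prodMk continuous_snd))
  have h0 : ∀ p : unitInterval × X, reVec (at3 (γ p.1) p.2) ≠ 0 := fun p =>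
    reVec_ne_zero ((hγ p.1).2 p.2)
  refine ⟨⟨⟨fun p => unitDir (reVec (at3 (γ p.1) p.2)) (h0 p), ?_⟩, fun x => ?_, fun x => ?_⟩⟩
  · exact ((hc.norm.inv₀ fun p => norm_ne_zero_iff.2 (h0 p)).smul hc).subtype_mk _
  · simp only [γ.source]; rfl
  · simp only [γ.target]; rfl

end Direction

section Matrices

lemma rank_eq_one_iff_trace_eq_one {M : Matrix (Fin 2) (Fin 2) ℂ} (h : M * M = M) :
    M.rank = 1 ↔ M.trace = 1 := by
  have hp : LinearMap.IsProj (LinearMap.range M.mulVecLin) M.mulVecLin :=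
    (LinearMap.isProj_range_iff_isIdempotentElem _).2 (by
      rw [IsIdempotentElem, Module.End.mul_eq_comp, ← Matrix.mulVecLin_mul, h])
  have ht := hp.trace
  rw [← Matrix.toLin'_apply', Matrix.trace_toLin'_eq, Matrix.toLin'_apply'] at ht
  rw [ht, Matrix.rank, Nat.cast_eq_one]

/-- The matrix `(1 + V) / 2`, where `V` is the trace-zero matrix of a triple. -/
noncomputable def matOf {R : Type*} [CommRing R] [Algebra ℂ R] (v : R × R × R) :
    Matrix (Fin 2) (Fin 2) R :=
  !![algebraMap ℂ R (1 / 2) * (1 + v.1), algebraMap ℂ R (1 / 2) * v.2.1;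
    algebraMap ℂ R (1 / 2) * v.2.2, algebraMap ℂ R (1 / 2) * (1 - v.1)]

/-- The triple of the trace-zero part of twice a matrix of trace one. -/
def vecOf {R : Type*} [CommRing R] (e : Matrix (Fin 2) (Fin 2) R) : R × R × R :=
  (e 0 0 - e 1 1, 2 * e 0 1, 2 * e 1 0)

section Algebraic

variable {R : Type*} [CommRing R] [Algebra ℂ R]

variable (R) in
lemma two_mul_algebraMap_half : 2 * algebraMap ℂ R (1 / 2) = 1 := by
  rw [← map_ofNat (algebraMap ℂ R) 2, ← map_mul]
  norm_num

lemma trace_matOf (v : R × R × R) : (matOf v).trace = 1 := by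
  simp only [matOf, Matrix.trace_fin_two_of]
  linear_combination two_mul_algebraMap_half R

lemma matOf_mul_self {v : R × R × R} (h : dot3 v v = 2) : matOf v * matOf v = matOf v := by
  have hc := two_mul_algebraMap_half R
  have h' : v.1 * v.1 + v.2.1 * v.2.2 = 1 := by
    rw [dot3] at h
    linear_combination algebraMap ℂ R (1 / 2) * h +
      (1 - v.1 * v.1 - v.2.1 * v.2.2) * hc
  simp only [matOf, Matrix.mul_fin_two]
  set c := algebraMap ℂ R (1 / 2)
  congr 2
  · congr 1
    · linear_combination c ^ 2 * h' + (c + c * v.1) * hc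
    · congr 1
      linear_combination c * v.2.1 * hc
  · congr 1
    congr 1
    · linear_combination c * v.2.2 * hc
    · congr 1
      linear_combination c ^ 2 * h' + (c - c * v.1) * hc

lemma vecOf_matOf (v : R × R × R) : vecOf (matOf v) = v := by
  have hc := two_mul_algebraMap_half R
  refine Prod.ext ?_ (Prod.ext ?_ ?_) <;> simp [vecOf, matOf, -one_div]
  · linear_combination v.1 * hc
  · linear_combination v.2.1 * hc
  · linear_combination v.2.2 * hc

lemma dot3_vecOf {e : Matrix (Fin 2) (Fin 2) R} (h : e * e = e) (ht : e.trace = 1) :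
    dot3 (vecOf e) (vecOf e) = 2 := by
  have h0 := congr($h 0 0)
  have h1 := congr($h 1 1)
  simp only [Matrix.mul_apply, Fin.sum_univ_two] at h0 h1
  rw [Matrix.trace_fin_two] at ht
  simp only [dot3, vecOf]
  linear_combination 4 * h0 + 4 * h1 - (2 * e 0 0 + 2 * e 1 1 - 2) * ht

lemma matOf_vecOf {e : Matrix (Fin 2) (Fin 2) R} (ht : e.trace = 1) : matOf (vecOf e) = e := by
  have hc := two_mul_algebraMap_half R
  rw [Matrix.trace_fin_two] at ht
  rw [Matrix.eta_fin_two e]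
  simp only [matOf, vecOf, Matrix.of_apply, Matrix.cons_val', Matrix.cons_val_zero,
    Matrix.cons_val_one, Matrix.cons_val_fin_one]
  set c := algebraMap ℂ R (1 / 2)
  congr 2
  · congr 1
    · linear_combination e 0 0 * hc - c * ht
    · congr 1
      linear_combination e 0 1 * hc
  · congr 1
    congr 1
    · linear_combination e 1 0 * hc
    · congr 1
      linear_combination e 1 1 * hc - c * ht

end Algebraic

variable {𝒜 : Type*} [NormedCommRing 𝒜] [NormedAlgebra ℂ 𝒜]

lemma continuous_matOf : Continuous (matOf : 𝒜 × 𝒜 × 𝒜 → Matrix (Fin 2) (Fin 2) 𝒜) := by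
  refine continuous_matrix fun i j => ?_
  fin_cases i <;> fin_cases j <;> simp [matOf] <;> fun_prop

lemma continuous_vecOf : Continuous (vecOf : Matrix (Fin 2) (Fin 2) 𝒜 → 𝒜 × 𝒜 × 𝒜) := by
  unfold vecOf
  fun_prop

variable [CompleteSpace 𝒜]

lemma rank_map_eq_one_iff {G : Matrix (Fin 2) (Fin 2) 𝒜} (h : G * G = G)
    (φ : characterSpace ℂ 𝒜) : (G.map fun a => φ a).rank = 1 ↔ φ G.trace = 1 := by
  have h' : (G.map fun a => φ a) * (G.map fun a => φ a) = G.map fun a => φ a := by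
    have := congrArg (fun M => M.map (CharacterSpace.toAlgHom φ)) h
    rw [Matrix.map_mul] at this
    exact this
  rw [rank_eq_one_iff_trace_eq_one h', Matrix.trace_fin_two, Matrix.trace_fin_two, map_add]
  rfl

lemma matOf_mem {v : 𝒜 × 𝒜 × 𝒜} (h : dot3 v v = 2) : matOf v * matOf v = matOf v ∧
    ∀ φ : characterSpace ℂ 𝒜, ((matOf v).map fun a => φ a).rank = 1 :=
  ⟨matOf_mul_self h, fun φ => (rank_map_eq_one_iff (matOf_mul_self h) φ).2 (by
    rw [trace_matOf, map_one])⟩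

lemma trace_eq_one (hG : Function.Injective (fun (f : 𝒜) => fun φ : characterSpace ℂ 𝒜 => φ f))
    (e : ID1 𝒜) : e.1.trace = 1 :=
  hG (funext fun φ => by
    beta_reduce
    rw [(rank_map_eq_one_iff e.2.1 φ).1 (e.2.2 φ), map_one])

end Matrices

section Normalisation

variable {𝒜 : Type*} [NormedCommRing 𝒜] [NormedAlgebra ℂ 𝒜] [CompleteSpace 𝒜]

lemma two_mem_posPart : (2 : 𝒜) ∈ _root_.posPart 𝒜 := fun ψ => by
  rw [map_ofNat]
  norm_num

/-- A path of nondegenerate triples can be normalised. -/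
lemma joinedIn_dot3_eq_two {a b : 𝒜 × 𝒜 × 𝒜} (ha : dot3 a a = 2) (hb : dot3 b b = 2)
    (h : JoinedIn {a : 𝒜 × 𝒜 × 𝒜 | dot3 a a ∈ _root_.posPart 𝒜} a b) :
    JoinedIn {a : 𝒜 × 𝒜 × 𝒜 | dot3 a a = 2} a b := by
  obtain ⟨σ, hσ, hσ'⟩ := exists_sqrt_fun 𝒜
  let c : 𝒜 := algebraMap ℂ 𝒜 (1 / 2)
  have hc : 2 * c = 1 := two_mul_algebraMap_half 𝒜
  have hpos : ∀ v : 𝒜 × 𝒜 × 𝒜, dot3 v v ∈ _root_.posPart 𝒜 →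
      c * dot3 v v ∈ _root_.posPart 𝒜 := by
    intro v hv ψ
    rw [map_mul, AlgHom.commutes]
    have := hv ψ
    simp only [Algebra.algebraMap_self, RingHom.id_apply, Complex.mul_re]
    norm_num
    exact this
  let N : 𝒜 × 𝒜 × 𝒜 → 𝒜 × 𝒜 × 𝒜 := fun v => Ring.inverse (σ (c * dot3 v v)) • v
  have hN : ∀ v, dot3 v v = 2 → N v = v := by
    intro v hv
    have h1 : c * dot3 v v = 1 := by rw [hv, mul_comm, hc]
    have h2 := hσ' 1 one_mem_posPart
    have h3 : σ 1 = 1 := sqrt_unique_of_mem_posPart h2.1 one_mem_posPart (by rw [h2.2, one_mul])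
    simp only [N, h1, h3, Ring.inverse_one, one_smul]
  have hNc : ContinuousOn N {v | dot3 v v ∈ _root_.posPart 𝒜} := by
    suffices h : ContinuousOn (fun v : 𝒜 × 𝒜 × 𝒜 => Ring.inverse (σ (c * dot3 v v)))
        {v | dot3 v v ∈ _root_.posPart 𝒜} from h.smul (g := fun v => v) continuousOn_id
    intro v hv
    have h0 : Continuous fun v : 𝒜 × 𝒜 × 𝒜 => c * dot3 v v :=
      continuous_const.mul (continuous_dot3 continuous_id continuous_id)
    have h1 : ContinuousWithinAt (fun v : 𝒜 × 𝒜 × 𝒜 => σ (c * dot3 v v))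
        {v | dot3 v v ∈ _root_.posPart 𝒜} v :=
      (hσ.comp h0.continuousOn hpos) v hv
    obtain ⟨u, hu⟩ := isUnit_of_mem_posPart (hσ' _ (hpos v hv)).1
    have h2 := NormedRing.inverse_continuousAt u
    rw [hu] at h2
    exact ContinuousAt.comp_continuousWithinAt (g := Ring.inverse)
      (f := fun v : 𝒜 × 𝒜 × 𝒜 => σ (c * dot3 v v)) h2 h1
  have h' := h.map_continuousOn hNc
  rw [hN a ha, hN b hb] at h'
  refine h'.mono ?_
  rintro _ ⟨v, hv, rfl⟩
  obtain ⟨h1, h2⟩ := hσ' _ (hpos v hv)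
  have h3 := Ring.inverse_mul_cancel _ (isUnit_of_mem_posPart h1)
  simp only [Set.mem_ofPred_eq, N]
  rw [dot3_smul_left, dot3_smul_right]
  set i := Ring.inverse (σ (c * dot3 v v))
  set s := σ (c * dot3 v v)
  linear_combination -(i * i * dot3 v v) * hc - 2 * i * i * h2 + 2 * (i * s + 1) * h3

end Normalisation

section Main

variable {𝒜 : Type*} [NormedCommRing 𝒜] [NormedAlgebra ℂ 𝒜] [CompleteSpace 𝒜]

lemma continuous_gelfand3 : Continuous (gelfand3 : 𝒜 × 𝒜 × 𝒜 → _) :=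
  continuous_map3 continuous_gelfandTransform

lemma joinedIn_gelfand3 {a b : 𝒜 × 𝒜 × 𝒜}
    (h : JoinedIn {a : 𝒜 × 𝒜 × 𝒜 | dot3 a a ∈ _root_.posPart 𝒜} a b) :
    JoinedIn (nondeg ⊤) (gelfand3 a) (gelfand3 b) := by
  refine (h.map_continuousOn continuous_gelfand3.continuousOn).mono ?_
  rintro _ ⟨v, hv, rfl⟩
  exact nondeg_mono le_top (gelfand3_mem_nondeg_iff.2 hv)

/-- The map to the sphere given by a nondegenerate triple of elements of a Banach algebra. -/
noncomputable def sphereMap (a : 𝒜 × 𝒜 × 𝒜) (ha : dot3 a a ∈ _root_.posPart 𝒜) :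
    C(characterSpace ℂ 𝒜, TwoSphere) :=
  dirMap (gelfand3 a) (gelfand3_mem_nondeg_iff.2 ha).2

lemma homotopic_sphereMap_iff {a b : 𝒜 × 𝒜 × 𝒜} (ha : dot3 a a ∈ _root_.posPart 𝒜)
    (hb : dot3 b b ∈ _root_.posPart 𝒜) :
    (sphereMap a ha).Homotopic (sphereMap b hb) ↔
      JoinedIn {a : 𝒜 × 𝒜 × 𝒜 | dot3 a a ∈ _root_.posPart 𝒜} a b := by
  refine ⟨fun h => joinedIn_of_joinedIn_gelfand3 ha hb ?_, fun h =>
    homotopic_dirMap (joinedIn_gelfand3 h)⟩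
  exact ((joinedIn_fieldOf_dirMap _).trans (joinedIn_fieldOf h)).trans
    (joinedIn_fieldOf_dirMap _).symm

lemma exists_sphereMap_homotopic (F : C(characterSpace ℂ 𝒜, TwoSphere)) :
    ∃ a : 𝒜 × 𝒜 × 𝒜, ∃ ha : dot3 a a = 2,
      (sphereMap a (ha ▸ two_mem_posPart)).Homotopic F := by
  obtain ⟨b, hb, hFb⟩ := exists_joinedIn_gelfand3 (fieldOf_mem_nondeg F).2
  obtain ⟨a, s, hs, ha, hab⟩ := exists_normalised_triple hb
  have ha' : dot3 a a ∈ _root_.posPart 𝒜 := ha ▸ two_mem_posPart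
  have hj : JoinedIn (nondeg ⊤) (gelfand3 b) (gelfand3 a) := by
    refine (joinedIn_nondeg_of_reDot_pos (gelfand3_mem_nondeg_iff.2 hb)
      (gelfand3_mem_nondeg_iff.2 ha') fun x => ?_).mono (nondeg_mono le_top)
    rw [reDot, dot3_gelfand3, hab, two_mul]
    exact add_mem_posPart hs hs (CharacterSpace.toAlgHom x)
  refine ⟨a, ha, ?_⟩
  have h := homotopic_dirMap (hFb.trans hj).symm
  rwa [dirMap_fieldOf] at h

lemma dot3_vecOf_mem
    (hG : Function.Injective (fun (f : 𝒜) => fun φ : characterSpace ℂ 𝒜 => φ f)) (e : ID1 𝒜) :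
    dot3 (vecOf e.1) (vecOf e.1) ∈ _root_.posPart 𝒜 :=
  dot3_vecOf e.2.1 (trace_eq_one hG e) ▸ two_mem_posPart

/-- The homotopy class of maps to the sphere given by an idempotent matrix. -/
noncomputable def htpyClass
    (hG : Function.Injective (fun (f : 𝒜) => fun φ : characterSpace ℂ 𝒜 => φ f)) (e : ID1 𝒜) :
    HtpyClasses (characterSpace ℂ 𝒜) TwoSphere :=
  Quotient.mk _ (sphereMap (vecOf e.1) (dot3_vecOf_mem hG e))

lemma htpyClass_eq_iff
    (hG : Function.Injective (fun (f : 𝒜) => fun φ : characterSpace ℂ 𝒜 => φ f)) (e e' : ID1 𝒜) :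
    htpyClass hG e = htpyClass hG e' ↔
      JoinedIn {a : 𝒜 × 𝒜 × 𝒜 | dot3 a a ∈ _root_.posPart 𝒜} (vecOf e.1) (vecOf e'.1) :=
  Quotient.eq.trans (homotopic_sphereMap_iff _ _)

lemma isLocallyConstant_htpyClass
    (hG : Function.Injective (fun (f : 𝒜) => fun φ : characterSpace ℂ 𝒜 => φ f)) :
    IsLocallyConstant (htpyClass hG) := by
  refine (IsLocallyConstant.iff_exists_open _).2 fun e => ?_
  have hopen : IsOpen {a : 𝒜 × 𝒜 × 𝒜 | dot3 a a ∈ _root_.posPart 𝒜} :=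
    isOpen_posPart.preimage (continuous_dot3 continuous_id continuous_id)
  obtain ⟨ε, hε, hball⟩ := Metric.isOpen_iff.1 hopen _ (dot3_vecOf_mem hG e)
  refine ⟨(fun e' : ID1 𝒜 => vecOf e'.1) ⁻¹' Metric.ball (vecOf e.1) ε,
    Metric.isOpen_ball.preimage (continuous_vecOf.comp continuous_subtype_val),
    Metric.mem_ball_self hε, fun e' he' => ?_⟩
  refine (htpyClass_eq_iff hG e' e).2 (JoinedIn.mono (JoinedIn.of_segment_subset ?_) hball)
  exact (convex_ball _ ε).segment_subset he' (Metric.mem_ball_self hε)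

lemma joined_of_htpyClass_eq
    (hG : Function.Injective (fun (f : 𝒜) => fun φ : characterSpace ℂ 𝒜 => φ f)) {e e' : ID1 𝒜}
    (h : htpyClass hG e = htpyClass hG e') : Joined e e' := by
  have h1 := joinedIn_dot3_eq_two (dot3_vecOf e.2.1 (trace_eq_one hG e))
    (dot3_vecOf e'.2.1 (trace_eq_one hG e')) ((htpyClass_eq_iff hG e e').1 h)
  have h2 := h1.map_continuousOn continuous_matOf.continuousOn
  rw [matOf_vecOf (trace_eq_one hG e), matOf_vecOf (trace_eq_one hG e')] at h2
  have h3 : JoinedIn {G : Matrix (Fin 2) (Fin 2) 𝒜 | G * G = G ∧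
      ∀ φ : characterSpace ℂ 𝒜, (G.map fun a => φ a).rank = 1} e.1 e'.1 := by
    refine h2.mono ?_
    rintro _ ⟨v, hv, rfl⟩
    exact matOf_mem hv
  exact h3.joined_subtype

lemma surjective_htpyClass
    (hG : Function.Injective (fun (f : 𝒜) => fun φ : characterSpace ℂ 𝒜 => φ f)) :
    Function.Surjective (htpyClass hG) := by
  intro q
  obtain ⟨F, rfl⟩ := Quotient.exists_rep q
  obtain ⟨a, ha, haF⟩ := exists_sphereMap_homotopic F
  refine ⟨⟨matOf a, matOf_mem ha⟩, Quotient.sound ?_⟩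
  simp only [vecOf_matOf]
  exact haF

end Main

/-! **Statement 8.**
Let `𝒜` be a complex Banach function algebra defined on its maximal ideal space `𝔐(𝒜)`
(i.e. a commutative complex Banach algebra whose Gelfand transform is injective).  Then
there is a bijection `i : [ID₁(𝒜₂)] → [𝔐(𝒜), S²]` from the set of connected components
of `ID₁(𝒜₂)` to the set of homotopy classes of continuous maps `𝔐(𝒜) → S²`. -/

theorem components_of_idempotents_biject_with_homotopy_classes
    (𝒜 : Type) [NormedCommRing 𝒜] [NormedAlgebra ℂ 𝒜] [CompleteSpace 𝒜]
    (hGelfand : Function.Injective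
      (fun (f : 𝒜) => fun φ : characterSpace ℂ 𝒜 => φ f)) :
    ∃ i : ConnectedComponents (ID1 𝒜) → HtpyClasses (characterSpace ℂ 𝒜) TwoSphere,
      Function.Bijective i := by
  refine ⟨Quotient.lift (htpyClass hGelfand) fun e e' h => ?_, ?_, ?_⟩
  · have h' : connectedComponent e = connectedComponent e' := h
    exact (isLocallyConstant_htpyClass hGelfand).apply_eq_of_isPreconnected
      isPreconnected_connectedComponent mem_connectedComponent (h' ▸ mem_connectedComponent)
  · rintro ⟨e⟩ ⟨e'⟩ h
    exact Quotient.sound (connectedComponent_eq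
      (pathComponent_subset_component e (joined_of_htpyClass_eq hGelfand h)))
  · intro q
    obtain ⟨e, rfl⟩ := surjective_htpyClass hGelfand q
    exact ⟨Quotient.mk _ e, rfl⟩
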